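/- arXiv:1212.4597 — 4 statements merged into one kernel-verified Lean document; each statement's English description precedes it below -/
import Mathlib

section
/- If noncommutative polynomials f_0,f_1,…,f_t ∈ F⟨x_1,…,x_m⟩ are M_n-locally linearly dependent, while f_1,…,f_t are M_n-locally linearly independent, then there exist central polynomials c_0,c_1,…,c_t of M_n (in possibly additional variables), with c_0 not a polynomial identity of M_n, such that Σ_{i=0}^t c_i f_i is a polynomial identity of M_n. -/
open scoped TensorProduct

variable (F : Type*) [Field F] [CharZero F] (n : ℕ)

/-- The commutative coefficient ring `C = F[x_{ij}^{(k)}]`. -/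
abbrev CPoly := MvPolynomial (Fin n × Fin n × ℕ) F

/-- The algebra of quasi-polynomials `C⟨X⟩`. -/
abbrev QPoly := FreeAlgebra (CPoly F n) ℕ

/-- The generic matrix `ξ_k`. -/
noncomputable def genMat (k : ℕ) : Matrix (Fin n) (Fin n) (CPoly F n) :=
  Matrix.of fun i j => MvPolynomial.X (i, j, k)

/-- `Φ : C⟨X⟩ → M_n(C)`, the `C`-algebra map sending `x_k` to `ξ_k`. -/
noncomputable def PhiQ : QPoly F n →ₐ[CPoly F n] Matrix (Fin n) (Fin n) (CPoly F n) :=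
  FreeAlgebra.lift _ (genMat F n)

/-- Evaluation of `C` at a sequence of matrices. -/
noncomputable def evalC (A : ℕ → Matrix (Fin n) (Fin n) F) : CPoly F n →ₐ[F] F :=
  MvPolynomial.aeval fun p => A p.2.2 p.1 p.2.1

/-- Evaluation `ev_A : C⟨X⟩ → M_n(F)`. -/
noncomputable def evalQ (A : ℕ → Matrix (Fin n) (Fin n) F) :
    QPoly F n →ₐ[F] Matrix (Fin n) (Fin n) F :=
  ((evalC F n A).mapMatrix).comp ((PhiQ F n).restrictScalars F)

def IsQuasiIdentity (P : QPoly F n) : Prop :=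
  ∀ A : ℕ → Matrix (Fin n) (Fin n) F, evalQ F n A P = 0

/-- Substitution endomorphisms of `C⟨X⟩`. -/
def IsSubstEndo (φ : QPoly F n →ₐ[F] QPoly F n) : Prop :=
  ∀ (i j : Fin n) (k : ℕ),
    φ (algebraMap (CPoly F n) (QPoly F n) (MvPolynomial.X (i, j, k))) =
      algebraMap (CPoly F n) (QPoly F n) (PhiQ F n (φ (FreeAlgebra.ι (CPoly F n) k)) i j)

def IsTIdeal (I : Set (QPoly F n)) : Prop :=
  (0 : QPoly F n) ∈ I ∧
  (∀ a b : QPoly F n, a ∈ I → b ∈ I → a + b ∈ I) ∧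
  (∀ r a : QPoly F n, a ∈ I → r * a ∈ I) ∧
  (∀ r a : QPoly F n, a ∈ I → a * r ∈ I) ∧
  (∀ φ : QPoly F n →ₐ[F] QPoly F n, IsSubstEndo F n φ → ∀ p ∈ I, φ p ∈ I)

/-- The T-ideal generated by a set. -/
def TIdealSpan (S : Set (QPoly F n)) : Set (QPoly F n) :=
  ⋂₀ {I : Set (QPoly F n) | IsTIdeal F n I ∧ S ⊆ I}

/-- The Cayley–Hamilton quasi-polynomial `q_n`. -/
noncomputable def chQ : QPoly F n :=
  ∑ i ∈ Finset.range (n + 1),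
    algebraMap (CPoly F n) (QPoly F n) ((genMat F n 0).charpoly.coeff i) *
      FreeAlgebra.ι (CPoly F n) 0 ^ i

/-- Noncommutative polynomials over `F`. -/
abbrev NCPoly := FreeAlgebra F ℕ

noncomputable def evalNC (A : ℕ → Matrix (Fin n) (Fin n) F) :
    NCPoly F →ₐ[F] Matrix (Fin n) (Fin n) F :=
  FreeAlgebra.lift F A

def IsCentralPoly (c : NCPoly F) : Prop :=
  ∀ A : ℕ → Matrix (Fin n) (Fin n) F, ∃ α : F,
    evalNC F n A c = α • (1 : Matrix (Fin n) (Fin n) F)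

def IsPolyIdentity (c : NCPoly F) : Prop :=
  ∀ A : ℕ → Matrix (Fin n) (Fin n) F, evalNC F n A c = 0

/-- The constant term of a noncommutative polynomial. -/
noncomputable def constantTerm : NCPoly F →ₐ[F] F :=
  FreeAlgebra.lift F (fun _ : ℕ => (0 : F))

/-- The inclusion `F⟨X⟩ → C⟨X⟩`. -/
noncomputable def toQPoly : NCPoly F →ₐ[F] QPoly F n :=
  FreeAlgebra.lift F (fun k => FreeAlgebra.ι (CPoly F n) k)

/-- Evaluation of a noncommutative polynomial in `m` variables at matrices. -/
noncomputable def evalNCFin (m : ℕ) (A : Fin m → Matrix (Fin n) (Fin n) F) :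
    FreeAlgebra F (Fin m) →ₐ[F] Matrix (Fin n) (Fin n) F :=
  FreeAlgebra.lift F A

/-- `f_1, …, f_t` are `M_n`-locally linearly dependent. -/
def MLocallyLinDep (m t : ℕ) (f : Fin t → FreeAlgebra F (Fin m)) : Prop :=
  ∀ A : Fin m → Matrix (Fin n) (Fin n) F,
    ¬ LinearIndependent F (fun i => evalNCFin F n m A (f i))

/-- The inclusion `F⟨x_1,…,x_m⟩ → F⟨X⟩`. -/
noncomputable def inclNC (m : ℕ) : FreeAlgebra F (Fin m) →ₐ[F] NCPoly F :=
  FreeAlgebra.lift F (fun i : Fin m => FreeAlgebra.ι F (i : ℕ))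

/-- The alternating sum of the Capelli words `∏ j, l j * x (σ j) * r j`, cut open at the letter `x k`
and rotated cyclically so that `x k` (which is then deleted) comes first. -/
def capelliCofactor {R : Type*} [Ring R] {N : ℕ} (x l r : Fin N → R) (k : Fin N) : R :=
  ∑ σ : Equiv.Perm (Fin N), Equiv.Perm.sign σ •
    (r (σ.symm k) *
      ((List.ofFn fun j => l j * x (σ j) * r j).drop (σ.symm k + 1)).prod *
      ((List.ofFn fun j => l j * x (σ j) * r j).take (σ.symm k)).prod * l (σ.symm k))

/-- Razmyslov's central polynomial, linear in `b`. -/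
def razmyslov {R : Type*} [Ring R] {N : ℕ} (x l r : Fin N → R) (b : R) : R :=
  ∑ k, x k * b * capelliCofactor x l r k

theorem map_razmyslov {R S : Type*} [Ring R] [Ring S] {N : ℕ} (φ : R →+* S)
    (x l r : Fin N → R) (b : R) :
    φ (razmyslov x l r b) = razmyslov (φ ∘ x) (φ ∘ l) (φ ∘ r) (φ b) := by
  simp [razmyslov, capelliCofactor, map_sum, Units.smul_def, map_list_prod, List.map_drop,
    List.map_take, List.map_ofFn, Function.comp_def]

/-- The trace of the Capelli polynomial, as an alternating map of the letters `x`. -/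
noncomputable def capelliTrace {K : Type*} [Field K] {n N : ℕ}
    (l r : Fin N → Matrix (Fin n) (Fin n) K) :
    Matrix (Fin n) (Fin n) K [⋀^Fin N]→ₗ[K] K :=
  MultilinearMap.alternatization
    ((Matrix.traceLinearMap (Fin n) K K).compMultilinearMap
      ((MultilinearMap.mkPiAlgebraFin K N (Matrix (Fin n) (Fin n) K)).compLinearMap fun j =>
        (LinearMap.mulRight K (r j)).comp (LinearMap.mulLeft K (l j))))

theorem capelliTrace_apply {K : Type*} [Field K] {n N : ℕ}
    (x l r : Fin N → Matrix (Fin n) (Fin n) K) :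
    capelliTrace l r x = ∑ σ : Equiv.Perm (Fin N), Equiv.Perm.sign σ •
      (List.ofFn fun j => l j * x (σ j) * r j).prod.trace := by
  simp [capelliTrace, MultilinearMap.alternatization_apply]

theorem capelliTrace_update {K : Type*} [Field K] {n N : ℕ}
    (x l r : Fin N → Matrix (Fin n) (Fin n) K) (k : Fin N) (w : Matrix (Fin n) (Fin n) K) :
    capelliTrace l r (Function.update x k w) = (w * capelliCofactor x l r k).trace := by
  rw [capelliTrace_apply, capelliCofactor, Finset.mul_sum, Matrix.trace_sum]
  refine Finset.sum_congr rfl fun σ _ => ?_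
  have hset : (List.ofFn fun j => l j * Function.update x k w (σ j) * r j) =
      (List.ofFn fun j => l j * x (σ j) * r j).set (σ.symm k)
        (l (σ.symm k) * w * r (σ.symm k)) := by
    refine List.ext_getElem (by simp) fun i h₁ h₂ => ?_
    simp only [List.length_ofFn] at h₁
    rw [List.getElem_set]
    split_ifs with h
    · have hi : (⟨i, h₁⟩ : Fin N) = σ.symm k := Fin.ext h.symm
      simp [hi]
    · have hi : σ ⟨i, h₁⟩ ≠ k := fun hk => h (by rw [← hk]; simp)
      simp [Function.update_of_ne hi]
  rw [hset, List.prod_set, if_pos (by simp), mul_smul_comm, Units.smul_def, Units.smul_def,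
    Matrix.trace_smul]
  congr 1
  have hcyc : ∀ a b c d : Matrix (Fin n) (Fin n) K,
      (a * (b * w * c) * d).trace = (w * (c * d * a * b)).trace := fun a b c d => by
    have h := Matrix.trace_mul_comm (a * b) (w * c * d)
    simpa only [mul_assoc] using h
  exact hcyc _ _ _ _

/-- Cramer's rule for an alternating form of top degree. -/
theorem AlternatingMap.sum_update_smul_eq {K V ι : Type*} [Field K] [AddCommGroup V] [Module K V]
    [Fintype ι] [DecidableEq ι] (e : Module.Basis ι K V) (D : V [⋀^ι]→ₗ[K] K) (x : ι → V) (w : V) :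
    ∑ k, D (Function.update x k w) • x k = D x • w := by
  have hD : ∀ v, D v = D e * (e.toMatrix v).det := fun v => by
    conv_lhs => rw [D.eq_smul_basis_det e]
    simp [Module.Basis.det_apply]
  apply e.repr.injective
  ext i
  have h := congrFun (Matrix.mulVec_cramer (e.toMatrix x) (e.repr w)) i
  simp only [Matrix.mulVec, dotProduct, Matrix.cramer_apply, Pi.smul_apply, smul_eq_mul,
    Module.Basis.toMatrix_apply] at h
  simp only [map_sum, map_smul, Finsupp.coe_finsetSum, Finset.sum_apply, Finsupp.smul_apply,
    smul_eq_mul, hD (Function.update x _ w), hD x, Module.Basis.toMatrix_update]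
  rw [mul_assoc, ← h, Finset.mul_sum]
  exact Finset.sum_congr rfl fun k _ => by ring

theorem razmyslov_eq {K : Type*} [Field K] {n : ℕ}
    (x l r : Fin (n * n) → Matrix (Fin n) (Fin n) K) (b : Matrix (Fin n) (Fin n) K) :
    razmyslov x l r b = (capelliTrace l r x * b.trace) • 1 := by
  have hcr : ∀ i j p q : Fin n, ∑ k, capelliCofactor x l r k j i * x k p q =
      capelliTrace l r x * Matrix.single i j 1 p q := fun i j p q => by
    have h := AlternatingMap.sum_update_smul_eq
      ((Matrix.stdBasis K (Fin n) (Fin n)).reindex finProdFinEquiv) (capelliTrace l r) x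
      (Matrix.single i j 1)
    have h' := congrFun (congrFun h p) q
    simpa [capelliTrace_update, Matrix.sum_apply, Matrix.trace_single_mul] using h'
  ext p q
  simp only [razmyslov, Matrix.sum_apply, Matrix.mul_apply, Finset.sum_mul, Matrix.smul_apply]
  rw [Finset.sum_comm]
  have : ∀ d c, ∑ k, x k p c * b c d * capelliCofactor x l r k d q =
      b c d * (capelliTrace l r x * Matrix.single q d 1 p c) := fun d c => by
    rw [← hcr, Finset.mul_sum]
    exact Finset.sum_congr rfl fun k _ => by ring
  simp_rw [Finset.sum_comm (s := Finset.univ (α := Fin (n * n))), this, Matrix.single_apply,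
    Matrix.one_apply, Matrix.trace, Matrix.diag]
  by_cases h : p = q
  · subst h; simp [← Finset.sum_mul, mul_comm]
  · simp [h, Ne.symm h]

theorem Matrix.list_prod_map_single {R ι : Type*} [Semiring R] [Fintype ι] [DecidableEq ι] (o : ι)
    {L : List R} (hL : L ≠ []) : (L.map (Matrix.single o o)).prod = Matrix.single o o L.prod := by
  induction L with
  | nil => exact absurd rfl hL
  | cons a L ih =>
    rcases eq_or_ne L [] with rfl | h
    · simp
    · simp [ih h]

theorem exists_capelliTrace_ne_zero (K : Type*) [Field K] {n : ℕ} (hn : 1 ≤ n) :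
    ∃ x l r : Fin (n * n) → Matrix (Fin n) (Fin n) K, capelliTrace l r x ≠ 0 := by
  let o : Fin n := ⟨0, hn⟩
  let e : Fin (n * n) ≃ Fin n × Fin n := finProdFinEquiv.symm
  refine ⟨fun j => Matrix.single (e j).1 (e j).2 1, fun j => Matrix.single o (e j).1 1,
    fun j => Matrix.single (e j).2 o 1, ?_⟩
  have hne : (List.finRange (n * n)) ≠ [] := by
    rw [Ne, List.finRange_eq_nil_iff]; positivity
  have hword : ∀ (σ : Equiv.Perm (Fin (n * n))), (List.ofFn fun j =>
      Matrix.single o (e j).1 1 * Matrix.single (e (σ j)).1 (e (σ j)).2 1 *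
        Matrix.single (e j).2 o (1 : K)).prod.trace = ∏ j, (1 : Matrix _ _ K) (σ j) j := fun σ => by
    have hslot : (fun j => Matrix.single o (e j).1 1 * Matrix.single (e (σ j)).1 (e (σ j)).2 1 *
        Matrix.single (e j).2 o (1 : K)) =
        fun j => Matrix.single o o ((1 : Matrix _ _ K) (σ j) j) := by
      ext1 j
      by_cases h : σ j = j
      · rw [h]; simp
      · have h' : ¬ ((e (σ j)).1 = (e j).1 ∧ (e (σ j)).2 = (e j).2) := fun h' =>
          h (e.injective (Prod.ext h'.1 h'.2))
        rw [Matrix.one_apply_ne h, Matrix.single_zero]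
        by_cases h₁ : (e (σ j)).1 = (e j).1
        · rw [mul_assoc, Matrix.single_mul_single_of_ne (h := fun h₂ => h' ⟨h₁, h₂⟩), mul_zero]
        · rw [Matrix.single_mul_single_of_ne (h := Ne.symm h₁), zero_mul]
    rw [hslot, List.ofFn_eq_map, ← Function.comp_def, ← List.map_map,
      Matrix.list_prod_map_single _ (by simpa using hne), Matrix.trace_single_eq_same,
      ← List.ofFn_eq_map, List.prod_ofFn]
  rw [capelliTrace_apply]
  simp_rw [hword]
  rw [← Matrix.det_apply, Matrix.det_one]
  exact one_ne_zero

/-- A linear functional on matrices is the trace against a fixed matrix. -/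
theorem Matrix.exists_trace_mul_eq {K : Type*} [Field K] {n : ℕ}
    (ψ : Matrix (Fin n) (Fin n) K →ₗ[K] K) :
    ∃ u : Matrix (Fin n) (Fin n) K, ∀ a, (a * u).trace = ψ a := by
  refine ⟨Matrix.of fun i j => ψ (Matrix.single j i 1), fun a => ?_⟩
  have h : (LinearMap.comp (Matrix.traceLinearMap (Fin n) K K)
      (LinearMap.mulRight K (Matrix.of fun i j => ψ (Matrix.single j i 1)))) = ψ := by
    refine (Matrix.stdBasis K (Fin n) (Fin n)).ext fun ⟨i, j⟩ => ?_
    simp [Matrix.stdBasis_eq_single, Matrix.trace_single_mul]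
  exact LinearMap.congr_fun h a

theorem LinearIndependent.exists_dual_family {K V ι : Type*} [Field K] [AddCommGroup V]
    [Module K V] [DecidableEq ι] {v : ι → V} (hv : LinearIndependent K v) :
    ∃ ψ : ι → V →ₗ[K] K, ∀ i j, ψ j (v i) = if i = j then 1 else 0 := by
  obtain ⟨g, hg⟩ := LinearMap.exists_leftInverse_of_injective (Finsupp.linearCombination K v)
    (LinearMap.ker_eq_bot.2 hv)
  refine ⟨fun j => (Finsupp.lapply j).comp g, fun i j => ?_⟩
  have := LinearMap.congr_fun hg (Finsupp.single i 1)
  simp only [LinearMap.comp_apply, Finsupp.linearCombination_single, one_smul,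
    LinearMap.id_apply] at this
  simp [this, Finsupp.single_apply]

/-- The Leibniz expansion of a determinant over a noncommutative ring, the factors ordered by column. -/
def orderedDet {R : Type*} [Ring R] {t : ℕ} (a : Fin t → Fin t → R) : R :=
  ∑ σ : Equiv.Perm (Fin t), Equiv.Perm.sign σ • (List.ofFn fun j => a (σ j) j).prod

theorem map_orderedDet {R S : Type*} [Ring R] [Ring S] {t : ℕ} (φ : R →+* S)
    (a : Fin t → Fin t → R) : φ (orderedDet a) = orderedDet fun i j => φ (a i j) := by
  simp [orderedDet, Units.smul_def, map_list_prod, List.map_ofFn, Function.comp_def]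

theorem orderedDet_algebraMap {R A : Type*} [CommRing R] [Ring A] [Algebra R A] {t : ℕ}
    (a : Matrix (Fin t) (Fin t) R) :
    orderedDet (fun i j => algebraMap R A (a i j)) = algebraMap R A a.det := by
  refine (map_orderedDet (algebraMap R A) a).symm.trans ?_
  congr 1
  rw [Matrix.det_apply]
  simp [orderedDet, List.prod_ofFn]

/-- Expanding along the column of values of a dependent family gives zero. -/
theorem sum_det_succAbove_smul_eq_zero {K V : Type*} [Field K] [AddCommGroup V] [Module K V]
    {t : ℕ} {g : Fin (t + 1) → V} (hg : ¬ LinearIndependent K g) (ψ : Fin t → V →ₗ[K] K)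
    (θ : V →ₗ[K] K) :
    ∑ i : Fin (t + 1), ((-1) ^ (i : ℕ) * (Matrix.of fun k j => ψ j (g (i.succAbove k))).det) * θ (g i) = 0 := by
  let M : Matrix (Fin (t + 1)) (Fin (t + 1)) K :=
    Matrix.of fun i => Fin.cons (θ (g i)) fun j => ψ j (g i)
  have hM : M.det = 0 := by
    obtain ⟨v, hv, i, hi⟩ := Fintype.not_linearIndependent_iff.1 hg
    refine Matrix.exists_vecMul_eq_zero_iff.1 ⟨v, fun h => hi (congrFun h i), ?_⟩
    ext j
    refine Fin.cases ?_ (fun j => ?_) j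
    · simpa [Matrix.vecMul, dotProduct, M] using congrArg θ hv
    · simpa [Matrix.vecMul, dotProduct, M] using congrArg (ψ j) hv
  rw [Matrix.det_succ_column_zero] at hM
  rw [← hM]
  refine Finset.sum_congr rfl fun i _ => ?_
  have : M.submatrix i.succAbove Fin.succ = Matrix.of fun k j => ψ j (g (i.succAbove k)) := by
    ext k j; simp [M]
  rw [this]
  simp [M]
  ring

theorem evalNC_inclNC (F : Type*) [Field F] [CharZero F] (n m : ℕ)
    (Z : ℕ → Matrix (Fin n) (Fin n) F) (f : FreeAlgebra F (Fin m)) :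
    evalNC F n Z (inclNC F m f) = evalNCFin F n m (fun i => Z i) f := by
  have : (evalNC F n Z).comp (inclNC F m) = evalNCFin F n m (fun i => Z i) := by
    ext i; simp [evalNC, inclNC, evalNCFin]
  exact DFunLike.congr_fun this f

theorem stmt7 (F : Type*) [Field F] [CharZero F] (n : ℕ) (hn : 1 ≤ n)
    (m t : ℕ) (f₀ : FreeAlgebra F (Fin m)) (f : Fin t → FreeAlgebra F (Fin m))
    (hdep : MLocallyLinDep F n m (t + 1) (Fin.cons f₀ f))
    (hindep : ¬ MLocallyLinDep F n m t f) :
    ∃ (c₀ : NCPoly F) (c : Fin t → NCPoly F),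
      IsCentralPoly F n c₀ ∧ (∀ i, IsCentralPoly F n (c i)) ∧
      ¬ IsPolyIdentity F n c₀ ∧
      IsPolyIdentity F n (c₀ * inclNC F m f₀ + ∑ i, c i * inclNC F m (f i)) := by
  let J := Fin m ⊕ Fin t ⊕ Fin (n * n) ⊕ Fin (n * n) ⊕ Fin (n * n)
  obtain ⟨var, hvar, hvar_inl⟩ : ∃ var : J → ℕ, var.Injective ∧
      ∀ i : Fin m, var (Sum.inl i) = i := by
    refine ⟨Sum.elim (fun i => i) fun s => m + Fintype.equivFin _ s, ?_, fun i => rfl⟩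
    refine Function.Injective.sumElim Fin.val_injective (fun a b h => ?_) fun i s h => ?_
    · simpa [Fin.val_inj] using h
    · have := i.2
      omega
  let X : J → NCPoly F := fun s => FreeAlgebra.ι F (var s)
  let x : Fin (n * n) → NCPoly F := fun j => X (.inr (.inr (.inl j)))
  let l : Fin (n * n) → NCPoly F := fun j => X (.inr (.inr (.inr (.inl j))))
  let r : Fin (n * n) → NCPoly F := fun j => X (.inr (.inr (.inr (.inr j))))
  let g : Fin (t + 1) → FreeAlgebra F (Fin m) := Fin.cons f₀ f
  let c : Fin (t + 1) → NCPoly F := fun i => (-1) ^ (i : ℕ) * orderedDet fun k j =>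
    razmyslov x l r (inclNC F m (g (i.succAbove k)) * X (.inr (.inl j)))
  have hX : ∀ Z s, evalNC F n Z (X s) = Z (var s) := fun Z s => by simp [evalNC, X]
  let D : (ℕ → Matrix (Fin n) (Fin n) F) → F := fun Z =>
    capelliTrace (fun j => Z (var (.inr (.inr (.inr (.inl j))))))
      (fun j => Z (var (.inr (.inr (.inr (.inr j))))))
      (fun j => Z (var (.inr (.inr (.inl j)))))
  let ψ : (ℕ → Matrix (Fin n) (Fin n) F) → Fin t → Matrix (Fin n) (Fin n) F →ₗ[F] F :=
    fun Z j => D Z • (Matrix.traceLinearMap (Fin n) F F).comp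
      (LinearMap.mulRight F (Z (var (.inr (.inl j)))))
  have hc : ∀ Z i, evalNC F n Z (c i) = algebraMap F _ ((-1) ^ (i : ℕ) *
      (Matrix.of fun k j =>
        ψ Z j (evalNCFin F n m (fun a => Z a) (g (i.succAbove k)))).det) := fun Z i => by
    rw [map_mul (algebraMap F _), ← orderedDet_algebraMap]
    have h := map_orderedDet (evalNC F n Z).toRingHom fun k j =>
      razmyslov x l r (inclNC F m (g (i.succAbove k)) * X (.inr (.inl j)))
    simp only [AlgHom.toRingHom_eq_coe, RingHom.coe_coe] at h
    simp only [c, map_mul, map_pow, map_neg, map_one, h]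
    congr 2
    ext1 k; ext1 j
    have h' := map_razmyslov (evalNC F n Z).toRingHom x l r
      (inclNC F m (g (i.succAbove k)) * X (.inr (.inl j)))
    simp only [AlgHom.toRingHom_eq_coe, RingHom.coe_coe] at h'
    rw [h', razmyslov_eq, Algebra.algebraMap_eq_smul_one]
    simp only [x, l, r, Function.comp_def, hX, map_mul, evalNC_inclNC]
    simp [ψ, D]
  have hcentral : ∀ i, IsCentralPoly F n (c i) := fun i Z =>
    ⟨_, by rw [hc, Algebra.algebraMap_eq_smul_one]⟩
  refine ⟨c 0, fun i => c i.succ, hcentral 0, fun i => hcentral _, fun h => ?_, fun Z => ?_⟩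
  · simp only [MLocallyLinDep, not_forall, not_not] at hindep
    obtain ⟨A, hA⟩ := hindep
    obtain ⟨φ, hφ⟩ := hA.exists_dual_family
    choose u hu using fun j => Matrix.exists_trace_mul_eq (φ j)
    obtain ⟨x', l', r', hD⟩ := exists_capelliTrace_ne_zero F hn
    let Z : ℕ → Matrix (Fin n) (Fin n) F := Function.extend var
      (Sum.elim A (Sum.elim u (Sum.elim x' (Sum.elim l' r')))) 0
    have hZ : ∀ s, Z (var s) = Sum.elim A (Sum.elim u (Sum.elim x' (Sum.elim l' r'))) s :=
      fun s => hvar.extend_apply _ _ s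
    have hZA : (fun i : Fin m => Z i) = A := by
      ext1 i; rw [← hvar_inl, hZ]; rfl
    have h0 := h Z
    have hmat : (Matrix.of fun k j => ψ Z j (evalNCFin F n m (fun a => Z a)
        (g (Fin.succAbove 0 k)))) = D Z • (1 : Matrix (Fin t) (Fin t) F) := by
      ext k j
      simp [ψ, hZ, hZA, g, hu, hφ, Matrix.one_apply]
    have : Nonempty (Fin n) := ⟨⟨0, hn⟩⟩
    have hDZ : D Z ≠ 0 := by simpa [D, hZ] using hD
    rw [hc, hmat, map_eq_zero_iff _ (algebraMap F (Matrix (Fin n) (Fin n) F)).injective] at h0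
    simp [hDZ] at h0
  · have hsum : c 0 * inclNC F m f₀ + ∑ i : Fin t, c i.succ * inclNC F m (f i) =
        ∑ i, c i * inclNC F m (g i) := by
      rw [Fin.sum_univ_succ]; simp [g]
    rw [hsum]
    ext p q
    have h := sum_det_succAbove_smul_eq_zero (hdep fun a => Z a) (ψ Z)
      (Matrix.entryLinearMap F F p q)
    simp only [map_sum, map_mul, hc, evalNC_inclNC, Matrix.sum_apply, Algebra.algebraMap_eq_smul_one,
      smul_mul_assoc, one_mul, Matrix.smul_apply, smul_eq_mul, Matrix.zero_apply]
    simpa [g, mul_assoc] using h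
end

section
/- Let M_1,…,M_t be monomials in the noncommuting variables x_1,…,x_m and λ_1,…,λ_t ∈ C. If the quasi-polynomial Σ_{i=1}^t λ_i M_i is a quasi-identity of M_n, then either λ_i = 0 for all i, or the monomials M_1,…,M_t (regarded as elements of the free algebra F⟨x_1,…,x_m⟩) are M_n-locally linearly dependent. -/
open scoped TensorProduct

variable (F : Type*) [Field F] [CharZero F] (n : ℕ)

/-- The monomial `x_{w 1} ⋯ x_{w r}` in the quasi-polynomial algebra `C⟨X⟩`. -/
noncomputable def monQ (m : ℕ) (w : List (Fin m)) : QPoly F n :=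
  (w.map (fun i => FreeAlgebra.ι (CPoly F n) (i : ℕ))).prod

/-- The monomial `x_{w 1} ⋯ x_{w r}` in the free algebra `F⟨x_1,…,x_m⟩`. -/
noncomputable def monF {m : ℕ} (w : List (Fin m)) : FreeAlgebra F (Fin m) :=
  (w.map (FreeAlgebra.ι F)).prod

/-- A quasi-identity vanishes on the generic matrices. -/
theorem IsQuasiIdentity.phiQ_eq_zero {F : Type*} [Field F] [CharZero F] {n : ℕ} {P : QPoly F n}
    (hP : IsQuasiIdentity F n P) : PhiQ F n P = 0 := by
  ext1 a b
  refine MvPolynomial.funext fun x => ?_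
  have h := congrFun (congrFun (hP fun k => Matrix.of fun i j => x (i, j, k)) a) b
  simpa [evalQ, evalC, MvPolynomial.aeval_eq_eval] using h

theorem evalQ_monQ (F : Type*) [Field F] [CharZero F] (n m : ℕ)
    (A : ℕ → Matrix (Fin n) (Fin n) F) (w : List (Fin m)) :
    evalQ F n A (monQ F n m w) = evalNCFin F n m (fun i => A i) (monF F w) := by
  have hι (k : ℕ) : evalQ F n A (FreeAlgebra.ι (CPoly F n) k) = A k := by
    ext a b
    simp [evalQ, evalC, PhiQ, genMat]
  induction w with
  | nil => simp [monQ, monF]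
  | cons i w ih =>
    have hQ : monQ F n m (i :: w) = FreeAlgebra.ι (CPoly F n) (i : ℕ) * monQ F n m w := by
      simp [monQ]
    have hF : monF F (i :: w) = FreeAlgebra.ι F i * monF F w := by simp [monF]
    rw [hQ, hF, map_mul, map_mul, ih, hι]
    simp [evalNCFin]

/-- Polynomial matrices that are linearly independent after specialization along an algebra
homomorphism to the base field are linearly independent over the polynomial ring. -/
theorem linearIndependent_of_mapMatrix {F R ι p : Type*} [Field F] [CommRing R] [IsDomain R]
    [Algebra F R] [Fintype ι] [Fintype p] [DecidableEq p]
    (e : R →ₐ[F] F) (N : ι → Matrix p p R)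
    (hN : LinearIndependent F fun i => e.mapMatrix (N i)) : LinearIndependent R N := by
  classical
  obtain ⟨g, hg⟩ := LinearMap.exists_leftInverse_of_injective
    (Fintype.linearCombination F fun i => e.mapMatrix (N i))
    (LinearMap.ker_eq_bot.2 hN.fintypeLinearCombination_injective)
  have hgv (i : ι) : g (e.mapMatrix (N i)) = Pi.single i 1 := by
    simpa [Fintype.linearCombination_apply_single] using LinearMap.congr_fun hg (Pi.single i 1)
  let D : Matrix ι ι R := Matrix.of fun i k =>
    ∑ a, ∑ b, N i a b * algebraMap F R (g (Matrix.single a b 1) k)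
  have hD : e.mapMatrix D = 1 := by
    ext i k
    have h := congrFun (hgv i) k
    rw [Matrix.matrix_eq_sum_single (e.mapMatrix (N i))] at h
    have hs (a b : p) (c : F) : Matrix.single a b c = c • Matrix.single a b 1 := by simp
    simp_rw [hs _ _ (e.mapMatrix (N i) _ _), map_sum, map_smul, Finset.sum_apply,
      Pi.smul_apply, smul_eq_mul] at h
    simpa [D, Matrix.one_apply, Pi.single_apply, eq_comm] using h
  have hdet : D.det ≠ 0 := by
    intro h0
    have h1 : e D.det = 1 := by rw [AlgHom.map_det, hD, Matrix.det_one]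
    simp [h0] at h1
  rw [Fintype.linearIndependent_iff]
  intro c hc
  refine congrFun (Matrix.eq_zero_of_vecMul_eq_zero hdet ?_)
  ext k
  have hc' (a b : p) : ∑ i, c i * N i a b = 0 := by
    simpa [Matrix.sum_apply] using congrFun (congrFun hc a) b
  simp only [Matrix.vecMul, dotProduct, D, Matrix.of_apply, Pi.zero_apply, Finset.mul_sum]
  rw [Finset.sum_comm]
  refine Finset.sum_eq_zero fun a _ => ?_
  rw [Finset.sum_comm]
  refine Finset.sum_eq_zero fun b _ => ?_
  simp_rw [← mul_assoc, ← Finset.sum_mul, hc', zero_mul]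

theorem stmt8 (F : Type*) [Field F] [CharZero F] (n : ℕ) (hn : 1 ≤ n)
    (m t : ℕ) (w : Fin t → List (Fin m)) (lam : Fin t → CPoly F n)
    (hP : IsQuasiIdentity F n
      (∑ i, algebraMap (CPoly F n) (QPoly F n) (lam i) * monQ F n m (w i))) :
    (∀ i, lam i = 0) ∨ MLocallyLinDep F n m t (fun i => monF F (w i)) := by
  refine or_iff_not_imp_right.2 fun hdep => ?_
  simp only [MLocallyLinDep, not_forall, not_not] at hdep
  obtain ⟨A, hA⟩ := hdep
  let A' : ℕ → Matrix (Fin n) (Fin n) F := fun k => if h : k < m then A ⟨k, h⟩ else 0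
  have hA' : (fun i : Fin m => A' i) = A := by
    ext1 i
    simp [A']
  have hind : LinearIndependent (CPoly F n) fun i => PhiQ F n (monQ F n m (w i)) := by
    refine linearIndependent_of_mapMatrix (evalC F n A') _ ?_
    convert hA using 2 with i
    rw [← hA', ← evalQ_monQ]
    rfl
  refine Fintype.linearIndependent_iff.1 hind lam ?_
  simpa [← Algebra.smul_def] using hP.phiQ_eq_zero
end

section
/- Let P = λ_0 M_0 + Σ_{i=1}^t λ_i M_i be a quasi-identity of M_n, where M_0,M_1,…,M_t are monomials in x_1,…,x_m and λ_0,λ_1,…,λ_t ∈ C. If M_1,…,M_t are M_n-locally linearly independent, then P is a consequence of the Cayley–Hamilton identity, i.e. P lies in the T-ideal of C⟨X⟩ generated by q_n. -/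
open scoped TensorProduct

variable (F : Type*) [Field F] [CharZero F] (n : ℕ)

section
set_option linter.unusedSectionVars false
open Equiv Function

/-- A central and cyclic additive map. -/
structure IsFormalTrace {Q : Type*} [Ring Q] (t : Q →+ Q) : Prop where
  cyclic : ∀ a b, t (a * b) = t (b * a)
  central : ∀ a b, Commute (t a) b

/-- The trace monomial of the permutation `σ` filled with `H`, for a formal trace `t`: the letters
of the list are eliminated one by one, the cycles of `σ` avoiding the base point `p` giving formal
traces of products and the cycle through `p` a product. -/
def elimCycles {α Q : Type*} [DecidableEq α] [Ring Q] (t : Q →+ Q) (p : α) :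
    List α → Perm α → (α → Q) → Q
  | [], _, H => H p
  | s :: l, σ, H =>
    if σ s = s then t (H s) * elimCycles t p l σ (update H s 1)
    else elimCycles t p l (σ * swap (σ⁻¹ s) s)
      (update (update H (σ⁻¹ s) (H (σ⁻¹ s) * H s)) s 1)

section
variable {α β Q Q' : Type*} [DecidableEq α] [DecidableEq β] [Ring Q] [Ring Q']
  {t : Q →+ Q} {t' : Q' →+ Q'}

theorem elimCycles_cons_of_fixed {p s : α} {σ : Perm α} (h : σ s = s) (l : List α) (H : α → Q) :
    elimCycles t p (s :: l) σ H = t (H s) * elimCycles t p l σ (update H s 1) := by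
  simp [elimCycles, h]

theorem elimCycles_cons_of_apply_eq {p s j : α} {σ : Perm α} (h : σ j = s) (hjs : j ≠ s)
    (l : List α) (H : α → Q) :
    elimCycles t p (s :: l) σ H =
      elimCycles t p l (σ * swap j s) (update (update H j (H j * H s)) s 1) := by
  subst h
  have : σ (σ j) ≠ σ j := fun h => hjs (σ.injective h).symm
  simp [elimCycles, this]

theorem map_elimCycles (f : Q →+* Q') (hf : ∀ q, f (t q) = t' (f q)) (p : α) (l : List α)
    (σ : Perm α) (H : α → Q) :
    f (elimCycles t p l σ H) = elimCycles t' p l σ (fun a => f (H a)) := by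
  have key : ∀ (H : α → Q) a x, (fun b => f (update H a x b)) = update (fun b => f (H b)) a (f x) :=
    fun H a x => by ext b; by_cases h : b = a <;> simp [h]
  induction l generalizing σ H with
  | nil => rfl
  | cons s l ih =>
    simp only [elimCycles]
    split_ifs
    · rw [map_mul, hf, ih, key, map_one]
    · rw [ih, key, key, map_one, map_mul]

theorem elimCycles_map (e : β ↪ α) (p : β) (l : List β) (σ : Perm β) (τ : Perm α)
    (hτ : ∀ b, τ (e b) = e (σ b)) (H : α → Q) :
    elimCycles t (e p) (l.map e) τ H = elimCycles t p l σ (H ∘ e) := by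
  induction l generalizing σ τ H with
  | nil => rfl
  | cons s l ih =>
    by_cases h : σ s = s
    · rw [List.map_cons, elimCycles_cons_of_fixed h, elimCycles_cons_of_fixed (by rw [hτ, h]),
        ih _ _ hτ, update_comp_eq_of_injective _ e.injective]
      rfl
    · obtain ⟨j, rfl⟩ := σ.surjective s
      have hj : j ≠ σ j := fun h' => h (congrArg σ h'.symm)
      rw [List.map_cons, elimCycles_cons_of_apply_eq rfl hj,
        elimCycles_cons_of_apply_eq (hτ j) (e.injective.ne hj), ih (σ * swap j (σ j)),
        update_comp_eq_of_injective _ e.injective, update_comp_eq_of_injective _ e.injective]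
      · rfl
      · intro b
        rw [Perm.mul_apply, Perm.mul_apply, e.swap_apply, hτ]

theorem elimCycles_cons_swap (ht : IsFormalTrace t) (p : α) {s s' : α} (hs : s ≠ s')
    (l : List α) (σ : Perm α) (H : α → Q) :
    elimCycles t p (s :: s' :: l) σ H = elimCycles t p (s' :: s :: l) σ H := by
  -- the case where the first letter is fixed
  have fix : ∀ s s' : α, s ≠ s' → σ s = s →
      elimCycles t p (s :: s' :: l) σ H = elimCycles t p (s' :: s :: l) σ H := by
    intro s s' hs h
    rw [elimCycles_cons_of_fixed h]
    by_cases h' : σ s' = s'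
    · rw [elimCycles_cons_of_fixed h', elimCycles_cons_of_fixed h', elimCycles_cons_of_fixed h,
        update_of_ne hs, update_of_ne hs.symm, update_comm hs, ← mul_assoc, ← mul_assoc,
        (ht.central _ _).eq]
    · obtain ⟨j, hj⟩ := σ.surjective s'
      have hj' : j ≠ s' := by rintro rfl; exact h' hj
      have hjs : j ≠ s := by rintro rfl; exact hs (h.symm.trans hj)
      rw [elimCycles_cons_of_apply_eq hj hj', elimCycles_cons_of_apply_eq hj hj',
        elimCycles_cons_of_fixed (by simp [swap_apply_of_ne_of_ne hjs.symm hs, h])]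
      congr 2
      · simp [update_of_ne hs, update_of_ne hjs.symm]
      · rw [update_of_ne hjs, update_of_ne hs.symm, update_comm hjs.symm, update_comm hs]
  -- the case of two consecutive eliminated letters in one cycle
  have path : ∀ s s' : α, s ≠ s' → σ s' = s → σ s ≠ s' →
      elimCycles t p (s :: s' :: l) σ H = elimCycles t p (s' :: s :: l) σ H := by
    intro s s' hs h h'
    obtain ⟨j, hj⟩ := σ.surjective s'
    have hjs : j ≠ s := by rintro rfl; exact h' hj
    have hjs' : j ≠ s' := by rintro rfl; exact hs (h.symm.trans hj)
    rw [elimCycles_cons_of_apply_eq h hs.symm, elimCycles_cons_of_apply_eq hj hjs',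
      elimCycles_cons_of_apply_eq (j := j) (s := s')
        (by simp [swap_apply_of_ne_of_ne hjs' hjs, hj]) hjs',
      elimCycles_cons_of_apply_eq (j := j) (s := s) (by simp [h]) hjs]
    congr 1
    · ext x
      simp only [Perm.mul_apply, swap_apply_def]
      grind
    · ext x
      simp only [update_apply]
      grind
  by_cases h : σ s = s
  · exact fix s s' hs h
  by_cases h' : σ s' = s'
  · exact (fix s' s hs.symm h').symm
  by_cases h1 : σ s' = s
  · by_cases h2 : σ s = s'
    · rw [elimCycles_cons_of_apply_eq h1 hs.symm, elimCycles_cons_of_apply_eq h2 hs,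
        elimCycles_cons_of_fixed (by simp [h2]), elimCycles_cons_of_fixed (by simp [h1]),
        swap_comm s' s]
      simp only [update_of_ne hs, update_of_ne hs.symm, update_self, ht.cyclic (H s)]
      congr 2
      ext x
      simp only [update_apply]
      grind
    · exact path s s' hs h1 h2
  by_cases h2 : σ s = s'
  · exact (path s' s hs.symm h2 h1).symm
  obtain ⟨j, hj⟩ := σ.surjective s
  obtain ⟨j', hj'⟩ := σ.surjective s'
  have n1 : j ≠ s := by rintro rfl; exact h hj
  have n2 : j' ≠ s' := by rintro rfl; exact h' hj'
  have n3 : j ≠ s' := by rintro rfl; exact h1 hj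
  have n4 : j' ≠ s := by rintro rfl; exact h2 hj'
  have n5 : j ≠ j' := by rintro rfl; exact hs (hj.symm.trans hj')
  rw [elimCycles_cons_of_apply_eq hj n1, elimCycles_cons_of_apply_eq hj' n2,
    elimCycles_cons_of_apply_eq (j := j') (s := s')
      (by simp [swap_apply_of_ne_of_ne n5.symm n4, hj']) n2,
    elimCycles_cons_of_apply_eq (j := j) (s := s)
      (by simp [swap_apply_of_ne_of_ne n5 n3, hj]) n1]
  congr 1
  · ext x
    simp only [Perm.mul_apply, swap_apply_def]
    grind
  · ext x
    simp only [update_apply]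
    grind

theorem elimCycles_perm (ht : IsFormalTrace t) (p : α) {l l' : List α} (h : l.Perm l')
    (hl : l.Nodup) (σ : Perm α) (H : α → Q) :
    elimCycles t p l σ H = elimCycles t p l' σ H := by
  induction h generalizing σ H with
  | nil => rfl
  | cons s h ih => simp only [elimCycles, ih (List.nodup_cons.1 hl).2]
  | swap s s' l =>
    refine elimCycles_cons_swap ht p ?_ l σ H
    rintro rfl
    simp at hl
  | trans h h' ih ih' => rw [ih hl, ih' ((h.nodup_iff).1 hl)]
end

section
variable {α β Q Q' : Type*} [DecidableEq α] [DecidableEq β] [Ring Q] [Ring Q']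
  {t : Q →+ Q} {t' : Q' →+ Q'}

theorem elimCycles_update_mul_left (ht : IsFormalTrace t) {p : α} {l : List α} (hp : p ∉ l)
    (σ : Perm α) (H : α → Q) (u v : Q) :
    elimCycles t p l σ (update H p (u * v)) = u * elimCycles t p l σ (update H p v) := by
  induction l generalizing σ H v with
  | nil => simp [elimCycles]
  | cons s l ih =>
    simp only [List.mem_cons, not_or] at hp
    by_cases h : σ s = s
    · rw [elimCycles_cons_of_fixed h, elimCycles_cons_of_fixed h, update_of_ne (Ne.symm hp.1),
        update_of_ne (Ne.symm hp.1), update_comm hp.1, update_comm hp.1, ih hp.2, ← mul_assoc,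
        ← mul_assoc, (ht.central _ _).eq]
    · obtain ⟨j, rfl⟩ := σ.surjective s
      have hj : j ≠ σ j := fun h' => h (congrArg σ h'.symm)
      rw [elimCycles_cons_of_apply_eq rfl hj, elimCycles_cons_of_apply_eq rfl hj,
        update_of_ne (Ne.symm hp.1), update_of_ne (Ne.symm hp.1)]
      by_cases hjp : j = p
      · subst hjp
        simp only [update_self, update_idem]
        rw [update_comm hj, update_comm hj, mul_assoc, ih hp.2]
      · rw [update_of_ne hjp, update_of_ne hjp, update_comm (Ne.symm hjp), update_comm hp.1,
          update_comm (Ne.symm hjp), update_comm hp.1, ih hp.2]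

theorem elimCycles_update_mul_right {p : α} {l : List α} (hp : p ∉ l)
    {σ : Perm α} (hσ : σ p = p) (H : α → Q) (u v : Q) :
    elimCycles t p l σ (update H p (u * v)) = elimCycles t p l σ (update H p u) * v := by
  induction l generalizing σ H with
  | nil => simp [elimCycles]
  | cons s l ih =>
    simp only [List.mem_cons, not_or] at hp
    by_cases h : σ s = s
    · rw [elimCycles_cons_of_fixed h, elimCycles_cons_of_fixed h, update_of_ne (Ne.symm hp.1),
        update_of_ne (Ne.symm hp.1), update_comm hp.1, update_comm hp.1, ih hp.2 hσ, ← mul_assoc]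
    · obtain ⟨j, rfl⟩ := σ.surjective s
      have hj : j ≠ σ j := fun h' => h (congrArg σ h'.symm)
      have hjp : j ≠ p := by rintro rfl; exact hj hσ.symm
      rw [elimCycles_cons_of_apply_eq rfl hj, elimCycles_cons_of_apply_eq rfl hj,
        update_of_ne (Ne.symm hp.1), update_of_ne (Ne.symm hp.1),
        update_of_ne hjp, update_of_ne hjp, update_comm (Ne.symm hjp), update_comm hp.1,
          update_comm (Ne.symm hjp), update_comm hp.1, ih hp.2]
      rw [Perm.mul_apply, swap_apply_of_ne_of_ne (Ne.symm hjp) hp.1, hσ]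

theorem elimCycles_move (ht : IsFormalTrace t) {p j : α} (hjp : j ≠ p) {l : List α} (hp : p ∉ l)
    (hj : j ∉ l) {σ : Perm α} (hσ : σ j = p) (hfix : ∀ x, x ∉ l → x ≠ p → x ≠ j → σ x = x)
    (H : α → Q) (A B D : Q) :
    elimCycles t p (l ++ [j]) σ (update (update H j D) p (A * B)) =
      A * elimCycles t j (l ++ [p]) σ (update (update H j 1) p B) * D := by
  induction l generalizing σ H B with
  | nil =>
    have hσp : σ p = j := by
      by_contra h
      have h1 : σ p ≠ p := fun h' => hjp (σ.injective (hσ.trans h'.symm))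
      exact h1 (σ.injective (hfix _ (by simp) h1 h))
    rw [List.nil_append, List.nil_append, elimCycles_cons_of_apply_eq hσp hjp.symm,
      elimCycles_cons_of_apply_eq hσ hjp]
    simp [elimCycles, hjp, hjp.symm]
  | cons s l ih =>
    simp only [List.mem_cons, not_or] at hp hj
    obtain ⟨hps, hp⟩ := hp
    obtain ⟨hjs, hj⟩ := hj
    rw [List.cons_append, List.cons_append]
    by_cases h : σ s = s
    · rw [elimCycles_cons_of_fixed h, elimCycles_cons_of_fixed h]
      simp only [update_of_ne (Ne.symm hps), update_of_ne (Ne.symm hjs)]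
      rw [update_comm hps, update_comm hjs, update_comm hps, update_comm hjs, ih hp hj hσ]
      · rw [← mul_assoc, ← mul_assoc, ← mul_assoc, (ht.central _ _).eq]
      · intro x h1 h2 h3
        by_cases hx : x = s
        · rw [hx, h]
        · exact hfix x (by simp [hx, h1]) h2 h3
    · obtain ⟨i, rfl⟩ := σ.surjective s
      have hi : i ≠ σ i := fun h' => h (congrArg σ h'.symm)
      have hij : i ≠ j := by rintro rfl; exact hps hσ.symm
      have hσ' : (σ * swap i (σ i)) j = p := by
        rw [Perm.mul_apply, swap_apply_of_ne_of_ne hij.symm hjs, hσ]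
      have hfix' : ∀ x, x ∉ l → x ≠ p → x ≠ j → (σ * swap i (σ i)) x = x := by
        intro x h1 h2 h3
        by_cases hx : x = σ i
        · simp [hx]
        · have : σ x = x := hfix x (by simp [hx, h1]) h2 h3
          have hxi : x ≠ i := by rintro rfl; exact hi this.symm
          rw [Perm.mul_apply, swap_apply_of_ne_of_ne hxi hx, this]
      rw [elimCycles_cons_of_apply_eq rfl hi, elimCycles_cons_of_apply_eq rfl hi]
      simp only [update_of_ne (Ne.symm hps), update_of_ne (Ne.symm hjs)]
      by_cases hip : i = p
      · subst hip
        simp only [update_self, update_idem]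
        rw [update_comm hps, update_comm hjs, update_comm hps, update_comm hjs, mul_assoc,
          ih hp hj hσ' hfix']
      · rw [update_of_ne hip, update_of_ne hip, update_of_ne hij, update_of_ne hij,
          update_comm (Ne.symm hip), update_comm hij.symm, update_comm hps, update_comm hjs,
          update_comm (Ne.symm hip), update_comm hij.symm, update_comm hps, update_comm hjs,
          ih hp hj hσ' hfix']

theorem elimCycles_update_add {p : α} {l : List α} (hp : p ∉ l) (hl : l.Nodup) {σ : Perm α}
    (hfix : ∀ x, x ∉ l → x ≠ p → σ x = x) {a : α} (ha : a ∈ l ∨ a = p) (H : α → Q) (u v : Q) :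
    elimCycles t p l σ (update H a (u + v)) =
      elimCycles t p l σ (update H a u) + elimCycles t p l σ (update H a v) := by
  induction l generalizing σ H a u v with
  | nil =>
    obtain rfl : a = p := by simpa using ha
    simp [elimCycles]
  | cons s l ih =>
    simp only [List.mem_cons, not_or] at hp ha
    rw [List.nodup_cons] at hl
    obtain ⟨hps, hp⟩ := hp
    by_cases h : σ s = s
    · simp only [elimCycles_cons_of_fixed h]
      by_cases has : a = s
      · subst has
        simp only [update_self, update_idem, map_add, add_mul]
      · simp only [update_of_ne (Ne.symm has), update_comm has]
        rw [ih hp hl.2, mul_add]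
        · intro x h1 h2
          by_cases hx : x = s
          · rw [hx, h]
          · exact hfix x (by simp [hx, h1]) h2
        · tauto
    · obtain ⟨i, rfl⟩ := σ.surjective s
      have hi : i ≠ σ i := fun h' => h (congrArg σ h'.symm)
      have hfix' : ∀ x, x ∉ l → x ≠ p → (σ * swap i (σ i)) x = x := by
        intro x h1 h2
        by_cases hx : x = σ i
        · simp [hx]
        · have : σ x = x := hfix x (by simp [hx, h1]) h2
          have hxi : x ≠ i := by rintro rfl; exact hi this.symm
          rw [Perm.mul_apply, swap_apply_of_ne_of_ne hxi hx, this]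
      have hil : i ∈ l ∨ i = p := by
        by_contra hcon
        rw [not_or] at hcon
        exact hi (hfix i (by simp [hcon.1, hi]) hcon.2).symm
      simp only [elimCycles_cons_of_apply_eq rfl hi]
      by_cases has : a = σ i
      · subst has
        simp only [update_self, update_of_ne hi, mul_add]
        simp only [update_comm hi, update_idem]
        exact ih hp hl.2 hfix' hil _ _ _
      · simp only [update_of_ne (Ne.symm has)]
        by_cases hai : a = i
        · subst hai
          simp only [update_self, update_idem, add_mul]
          simp only [update_comm has]
          exact ih hp hl.2 hfix' hil _ _ _
        · simp only [update_of_ne (Ne.symm hai)]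
          simp only [update_comm hai, update_comm has]
          exact ih hp hl.2 hfix' (by tauto) _ _ _

/-- Eliminating letters not moved by any of the permutations `π` does not depend on `π`. -/
theorem exists_elimCycles_append (G : Set (Perm α)) (p : α) (l l' : List α)
    (hG : ∀ π ∈ G, ∀ x ∈ l, π x = x) (σ : Perm α) (H : α → Q) :
    ∃ (c : Q) (σ' : Perm α) (H' : α → Q),
      (∀ π ∈ G, elimCycles t p (l ++ l') (π * σ) H = c * elimCycles t p l' (π * σ') H') ∧
      (∀ x, σ x = x → σ' x = x) ∧ (∀ x, σ x = x → H x = 1 → H' x = 1) ∧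
      ∀ x ∈ l, σ' x = x ∧ H' x = 1 := by
  induction l generalizing σ H with
  | nil => exact ⟨1, σ, H, by simp, by simp, fun _ _ h => h, by simp⟩
  | cons s l ih =>
    by_cases h : σ s = s
    · obtain ⟨c, σ', H', h1, h2, h3, h4⟩ := ih (fun π hπ x hx => hG π hπ x (by simp [hx])) σ
        (update H s 1)
      refine ⟨t (H s) * c, σ', H', fun π hπ => ?_, h2, fun x hx hHx => h3 x hx ?_, fun x hx => ?_⟩
      · rw [List.cons_append, elimCycles_cons_of_fixed (by simp [h, hG π hπ]), h1 π hπ, mul_assoc]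
      · rw [update_apply]; split_ifs <;> simp [hHx]
      · rcases List.mem_cons.1 hx with rfl | hx
        · exact ⟨h2 _ h, h3 _ h (by simp)⟩
        · exact h4 x hx
    · obtain ⟨i, rfl⟩ := σ.surjective s
      have hi : i ≠ σ i := fun h' => h (congrArg σ h'.symm)
      obtain ⟨c, σ', H', h1, h2, h3, h4⟩ := ih (fun π hπ x hx => hG π hπ x (by simp [hx]))
        (σ * swap i (σ i)) (update (update H i (H i * H (σ i))) (σ i) 1)
      have hfix : ∀ x, σ x = x → (σ * swap i (σ i)) x = x := by
        intro x hx
        have hxi : x ≠ i := by rintro rfl; exact hi hx.symm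
        have hxs : x ≠ σ i := by rintro rfl; exact h hx
        rw [Perm.mul_apply, swap_apply_of_ne_of_ne hxi hxs, hx]
      refine ⟨c, σ', H', fun π hπ => ?_, fun x hx => h2 x (hfix x hx),
        fun x hx hHx => h3 x (hfix x hx) ?_, fun x hx => ?_⟩
      · rw [List.cons_append, elimCycles_cons_of_apply_eq (j := i) (by simp [hG π hπ]) hi,
          mul_assoc, h1 π hπ]
      · have hxi : x ≠ i := by rintro rfl; exact hi hx.symm
        rw [update_apply, update_of_ne hxi, hHx, ite_self]
      · rcases List.mem_cons.1 hx with rfl | hx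
        · exact ⟨h2 _ (by simp), h3 _ (by simp) (by simp)⟩
        · exact h4 x hx
end

section
variable {α β ι K : Type*} [DecidableEq α] [Fintype α] [Fintype ι] [CommRing K]

/-- The trace of a tensor product of matrices composed with a permutation of the factors. -/
def permTrace (σ : Perm α) (G : α → Matrix ι ι K) : K :=
  ∑ I : α → ι, ∏ a, G a (I a) (I (σ a))

variable (ι K) in
/-- The trace of matrices, with values in scalar matrices. -/
def scalarTrace [DecidableEq ι] : Matrix ι ι K →+ Matrix ι ι K :=
  (algebraMap K (Matrix ι ι K)).toAddMonoidHom.comp (Matrix.traceAddMonoidHom ι K)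

theorem scalarTrace_apply [DecidableEq ι] (M : Matrix ι ι K) :
    scalarTrace ι K M = algebraMap K _ M.trace := rfl

theorem isFormalTrace_scalarTrace [DecidableEq ι] : IsFormalTrace (scalarTrace ι K) where
  cyclic a b := by rw [scalarTrace_apply, scalarTrace_apply, Matrix.trace_mul_comm]
  central a b := by rw [scalarTrace_apply]; exact Algebra.commute_algebraMap_left _ _

theorem card_smul_sum_eq_sum_update {R : Type*} [AddCommMonoid R] (f : (α → ι) → R) (s : α) :
    Fintype.card ι • ∑ I, f I = ∑ I, ∑ x, f (update I s x) := by
  rw [← Fintype.sum_prod_type', eq_comm]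
  trans ∑ q : (α → ι) × ι, f q.1
  · refine Finset.sum_nbij' (fun q => (update q.1 s q.2, q.1 s))
      (fun q => (update q.1 s q.2, q.1 s)) ?_ ?_ ?_ ?_ ?_ <;> simp
  · rw [Fintype.sum_prod_type]
    simp [Finset.sum_nsmul]

theorem card_mul_permTrace_of_fixed [DecidableEq ι] {σ : Perm α} {s : α} (h : σ s = s) (G : α → Matrix ι ι K) :
    Fintype.card ι * permTrace σ G = (G s).trace * permTrace σ (update G s 1) := by
  have hne : ∀ a ∈ Finset.univ.erase s, a ≠ s ∧ σ a ≠ s := fun a ha =>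
    ⟨Finset.ne_of_mem_erase ha, fun h' => Finset.ne_of_mem_erase ha (σ.injective (h'.trans h.symm))⟩
  rw [permTrace, permTrace, ← nsmul_eq_mul, card_smul_sum_eq_sum_update _ s, Finset.mul_sum]
  refine Finset.sum_congr rfl fun I _ => ?_
  rw [Matrix.trace, Finset.sum_mul]
  refine Finset.sum_congr rfl fun x _ => ?_
  rw [← Finset.mul_prod_erase _ _ (Finset.mem_univ s), ← Finset.mul_prod_erase _ _ (Finset.mem_univ s),
    update_self, h, update_self, update_self (f := G), Matrix.one_apply_eq, one_mul,
    Matrix.diag_apply]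
  congr 1
  refine Finset.prod_congr rfl fun a ha => ?_
  rw [update_of_ne (hne a ha).1, update_of_ne (hne a ha).2, update_of_ne (hne a ha).1]

theorem card_mul_permTrace_of_apply_eq [DecidableEq ι] {σ : Perm α} {s j : α} (h : σ j = s) (hj : j ≠ s)
    (G : α → Matrix ι ι K) :
    Fintype.card ι * permTrace σ G =
      permTrace (σ * swap j s) (update (update G j (G j * G s)) s 1) := by
  have hs : σ s ≠ s := fun h' => hj (σ.injective (h.trans h'.symm))
  have hne : ∀ a ∈ (Finset.univ.erase s).erase j, a ≠ s ∧ σ a ≠ s ∧ a ≠ j := fun a ha => by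
    rw [Finset.mem_erase, Finset.mem_erase] at ha
    exact ⟨ha.2.1, fun h' => ha.1 (σ.injective (h'.trans h.symm)), ha.1⟩
  have hjmem : j ∈ Finset.univ.erase s := by simp [hj]
  rw [permTrace, permTrace, ← nsmul_eq_mul, card_smul_sum_eq_sum_update _ s]
  refine Finset.sum_congr rfl fun I _ => ?_
  trans (G j * G s) (I j) (I (σ s)) *
      ∏ a ∈ (Finset.univ.erase s).erase j, G a (I a) (I (σ a))
  · rw [Matrix.mul_apply, Finset.sum_mul]
    refine Finset.sum_congr rfl fun x _ => ?_
    rw [← Finset.mul_prod_erase _ _ (Finset.mem_univ s), ← Finset.mul_prod_erase _ _ hjmem,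
      update_self, h, update_self, update_of_ne hs, update_of_ne hj, ← mul_assoc,
      mul_comm (G s _ _)]
    congr 1
    refine Finset.prod_congr rfl fun a ha => ?_
    rw [update_of_ne (hne a ha).1, update_of_ne (hne a ha).2.1]
  · rw [← Finset.mul_prod_erase _ _ (Finset.mem_univ s), ← Finset.mul_prod_erase _ _ hjmem,
      update_self, Perm.mul_apply, swap_apply_right, h, Matrix.one_apply_eq, one_mul,
      update_of_ne hj, update_self, Perm.mul_apply, swap_apply_left]
    congr 1
    refine Finset.prod_congr rfl fun a ha => ?_
    rw [update_of_ne (hne a ha).1, update_of_ne (hne a ha).2.2, Perm.mul_apply,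
      swap_apply_of_ne_of_ne (hne a ha).2.2 (hne a ha).1]

theorem permTrace_one [DecidableEq ι] (G : α → Matrix ι ι K) : permTrace 1 G = ∏ a, (G a).trace := by
  simp [permTrace, Matrix.trace, Finset.prod_univ_sum, Fintype.piFinset_univ]

theorem permTrace_eq_trace_elimCycles [DecidableEq ι] {p : α} {l : List α} (hl : l.Nodup) (hp : p ∉ l)
    {σ : Perm α} {G : α → Matrix ι ι K} (hσ : ∀ x, x ∉ l → x ≠ p → σ x = x)
    (hG : ∀ x, x ∉ l → x ≠ p → G x = 1) :
    (Fintype.card ι : K) ^ l.length * permTrace σ G =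
      (Fintype.card ι : K) ^ (Fintype.card α - 1) *
        (elimCycles (scalarTrace ι K) p l σ G).trace := by
  induction l generalizing σ G with
  | nil =>
    obtain rfl : σ = 1 := by
      have key : ∀ x, x ≠ p → σ x = x := fun x hx => hσ x (by simp) hx
      ext x
      by_cases hx : x = p
      · subst hx
        by_contra h
        exact h (σ.injective (key _ h))
      · exact key x hx
    rw [permTrace_one, ← Finset.mul_prod_erase _ _ (Finset.mem_univ p),
      Finset.prod_congr rfl (g := fun _ => (Fintype.card ι : K))]
    · simp [elimCycles, mul_comm]
    · intro x hx
      rw [hG x (by simp) (Finset.ne_of_mem_erase hx), Matrix.trace_one]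
  | cons s l ih =>
    simp only [List.mem_cons, not_or] at hp
    rw [List.nodup_cons] at hl
    obtain ⟨hps, hp⟩ := hp
    rw [List.length_cons, pow_succ, mul_assoc]
    by_cases h : σ s = s
    · rw [card_mul_permTrace_of_fixed h, elimCycles_cons_of_fixed h, mul_left_comm, ih hl.2 hp,
        scalarTrace_apply, ← Algebra.smul_def, Matrix.trace_smul, smul_eq_mul, mul_left_comm]
      · intro x h1 h2
        by_cases hx : x = s
        · rw [hx, h]
        · exact hσ x (by simp [hx, h1]) h2
      · intro x h1 h2
        by_cases hx : x = s
        · simp [hx]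
        · rw [update_of_ne hx, hG x (by simp [hx, h1]) h2]
    · obtain ⟨i, rfl⟩ := σ.surjective s
      have hi : i ≠ σ i := fun h' => h (congrArg σ h'.symm)
      rw [card_mul_permTrace_of_apply_eq rfl hi, elimCycles_cons_of_apply_eq rfl hi, ih hl.2 hp]
      · intro x h1 h2
        by_cases hx : x = σ i
        · simp [hx]
        · have : σ x = x := hσ x (by simp [hx, h1]) h2
          have hxi : x ≠ i := by rintro rfl; exact hi this.symm
          rw [Perm.mul_apply, swap_apply_of_ne_of_ne hxi hx, this]
      · intro x h1 h2
        by_cases hx : x = σ i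
        · simp [hx]
        · have hxi : x ≠ i := by
            rintro rfl
            exact hi (hσ x (by simp [hx, h1]) h2).symm
          rw [update_of_ne hx, update_of_ne hxi, hG x (by simp [hx, h1]) h2]

theorem sum_sign_mul_eq_zero {α β ι K : Type*} [DecidableEq α] [Fintype ι] [CommRing K]
    [Fintype β] [DecidableEq β] (e : β ↪ α) (hβ : Fintype.card ι < Fintype.card β)
    (f : (α → ι) → K) (I : α → ι) :
    ∑ π : Perm β, ((Perm.sign π : ℤ) : K) * f (I ∘ (π.viaEmbedding e)) = 0 := by
  obtain ⟨a, b, hab, h⟩ := Fintype.exists_ne_map_eq_of_card_lt (I ∘ e) hβ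
  refine Finset.sum_involution (fun π _ => swap a b * π) ?_ ?_ ?_ ?_
  · intro π _
    have : I ∘ ((swap a b * π).viaEmbedding e) = I ∘ π.viaEmbedding e := by
      ext x
      by_cases hx : x ∈ Set.range e
      · obtain ⟨y, rfl⟩ := hx
        simp only [comp_apply, Perm.viaEmbedding_apply, Perm.mul_apply] at h ⊢
        rw [swap_apply_def]
        split_ifs with h1 h2
        · rw [h1, h]
        · rw [h2, h]
        · rfl
      · simp only [comp_apply, Perm.viaEmbedding_apply_of_notMem _ _ _ hx]
    rw [this]
    simp [Perm.sign_mul, Perm.sign_swap hab]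
  · intro π _ _ h'
    exact hab (swap_eq_one_iff.1 (mul_eq_right.1 h'))
  · simp
  · intro π _
    rw [← mul_assoc, swap_mul_self, one_mul]

theorem sum_sign_mul_permTrace [Fintype β] [DecidableEq β] (e : β ↪ α) (hβ : Fintype.card ι < Fintype.card β)
    (σ : Perm α) (G : α → Matrix ι ι K) :
    ∑ π : Perm β, ((Perm.sign π : ℤ) : K) * permTrace (π.viaEmbedding e * σ) G = 0 := by
  simp only [permTrace, Finset.mul_sum]
  rw [Finset.sum_comm]
  refine Finset.sum_eq_zero fun I _ => ?_
  exact sum_sign_mul_eq_zero e hβ (fun J => ∏ a, G a (I a) (J (σ a))) I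
end

section
variable {F : Type*} [Field F] [CharZero F] {n : ℕ}

theorem evalQ_apply (A : ℕ → Matrix (Fin n) (Fin n) F) (q : QPoly F n) :
    evalQ F n A q = (PhiQ F n q).map (evalC F n A) := rfl

theorem PhiQ_algebraMap_mul (c : CPoly F n) (q : QPoly F n) :
    PhiQ F n (algebraMap _ _ c * q) = c • PhiQ F n q := by
  rw [map_mul, AlgHom.commutes, Algebra.smul_def]

theorem PhiQ_ι (k : ℕ) : PhiQ F n (FreeAlgebra.ι _ k) = genMat F n k :=
  FreeAlgebra.lift_ι_apply _ _

/-- Quasi-polynomials are generically linearly independent if they are independent somewhere. -/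
theorem linearIndependent_PhiQ {ι : Type*} [Finite ι] (q : ι → QPoly F n)
    (A : ℕ → Matrix (Fin n) (Fin n) F) (h : LinearIndependent F fun i => evalQ F n A (q i)) :
    LinearIndependent (CPoly F n) fun i => PhiQ F n (q i) := by
  classical
  have := Fintype.ofFinite ι
  obtain ⟨g, hg⟩ : ∃ g : ι → Matrix (Fin n) (Fin n) F,
      ∀ i j, ∑ a, ∑ b, g j a b * evalQ F n A (q i) a b = if j = i then 1 else 0 := by
    have key (j : ι) : ∃ φ : Module.Dual F (Matrix (Fin n) (Fin n) F),
        ∀ i, φ (evalQ F n A (q i)) = if j = i then 1 else 0 := by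
      obtain ⟨φ, hφ⟩ := (Finsupp.lapply j ∘ₗ h.repr).exists_extend
      refine ⟨φ, fun i => ?_⟩
      have := LinearMap.congr_fun hφ ⟨_, Submodule.subset_span ⟨i, rfl⟩⟩
      simp only [LinearMap.comp_apply, Submodule.subtype_apply] at this
      rw [this, h.repr_eq_single i _ rfl]
      simp [Finsupp.single_apply, eq_comm]
    choose φ hφ using key
    refine ⟨fun j a b => φ j (Matrix.single a b 1), fun i j => ?_⟩
    rw [← hφ j i]
    conv_rhs => rw [Matrix.matrix_eq_sum_single (evalQ F n A (q i))]
    simp only [map_sum]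
    refine Finset.sum_congr rfl fun a _ => Finset.sum_congr rfl fun b _ => ?_
    rw [← mul_one (evalQ F n A (q i) a b), ← smul_eq_mul (evalQ F n A (q i) a b),
      ← Matrix.smul_single, map_smul, smul_eq_mul, smul_eq_mul, mul_one, mul_comm]
  let D : Matrix ι ι (CPoly F n) := Matrix.of fun j i =>
    ∑ a, ∑ b, MvPolynomial.C (g j a b) * PhiQ F n (q i) a b
  have hD : D.det ≠ 0 := by
    intro h0
    have h1 : (evalC F n A).mapMatrix D = 1 := by
      ext j i
      rw [AlgHom.mapMatrix_apply, Matrix.map_apply, Matrix.one_apply, ← hg]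
      simp only [D, Matrix.of_apply, map_sum, map_mul]
      refine Finset.sum_congr rfl fun a _ => Finset.sum_congr rfl fun b _ => ?_
      congr 1
      simp [evalC]
    have h2 := congrArg Matrix.det h1
    rw [← AlgHom.map_det, h0, map_zero, Matrix.det_one] at h2
    exact zero_ne_one h2
  rw [Fintype.linearIndependent_iff]
  intro c hc
  refine congrFun (Matrix.eq_zero_of_mulVec_eq_zero hD (v := c) ?_)
  ext1 j
  simp only [D, Matrix.mulVec, dotProduct, Matrix.of_apply, Pi.zero_apply]
  trans ∑ a, ∑ b, MvPolynomial.C (g j a b) * (∑ i, c i • PhiQ F n (q i)) a b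
  · simp only [Finset.sum_mul, Matrix.sum_apply, Finset.mul_sum, Matrix.smul_apply, smul_eq_mul]
    rw [Finset.sum_comm]
    refine Finset.sum_congr rfl fun a _ => ?_
    rw [Finset.sum_comm]
    refine Finset.sum_congr rfl fun b _ => Finset.sum_congr rfl fun i _ => ?_
    ring
  · simp [hc]

theorem IsQuasiIdentity.PhiQ_eq_zero {P : QPoly F n} (hP : IsQuasiIdentity F n P) :
    PhiQ F n P = 0 := by
  ext1 i j
  refine MvPolynomial.funext fun x => ?_
  have := congrFun (congrFun (hP fun k => Matrix.of fun i j => x (i, j, k)) i) j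
  rw [evalQ_apply, Matrix.map_apply] at this
  simpa [evalC, MvPolynomial.aeval_eq_eval] using this

theorem linearIndependent_genMat_pow :
    LinearIndependent (CPoly F n) fun i : Fin n => genMat F n 0 ^ (i : ℕ) := by
  have := linearIndependent_PhiQ (fun i : Fin n => FreeAlgebra.ι (CPoly F n) 0 ^ (i : ℕ))
    (fun _ => Matrix.diagonal fun i : Fin n => ((i : ℕ) : F)) ?_
  · simpa only [map_pow, PhiQ_ι] using this
  rw [Fintype.linearIndependent_iff]
  intro c hc
  refine congrFun (Matrix.eq_zero_of_mulVec_eq_zero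
    (M := Matrix.vandermonde fun i : Fin n => ((i : ℕ) : F)) ?_ (v := c) ?_)
  · rw [Matrix.det_vandermonde_ne_zero_iff]
    exact Nat.cast_injective.comp Fin.val_injective
  · ext1 j
    have h1 : evalQ F n (fun _ => Matrix.diagonal fun i : Fin n => ((i : ℕ) : F))
        (FreeAlgebra.ι (CPoly F n) 0) = Matrix.diagonal fun i : Fin n => ((i : ℕ) : F) := by
      ext i j
      simp [evalQ_apply, PhiQ_ι, genMat, evalC]
    have := congrFun (congrFun hc j) j
    simp only [map_pow, h1, Matrix.diagonal_pow, Matrix.sum_apply] at this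
    simpa [Matrix.mulVec, dotProduct, Matrix.vandermonde_apply, mul_comm] using this

theorem charpoly_genMat_dvd {f : Polynomial (CPoly F n)}
    (hf : Polynomial.aeval (genMat F n 0) f = 0) : (genMat F n 0).charpoly ∣ f := by
  have hm := (genMat F n 0).charpoly_monic
  rw [← Polynomial.modByMonic_eq_zero_iff_dvd hm]
  by_cases hn : n = 0
  · subst hn
    have : (genMat F 0 0).charpoly = 1 := by simp [Matrix.charpoly]
    rw [this, Polynomial.modByMonic_one]
  set r := f %ₘ (genMat F n 0).charpoly with hr
  have h0 : Polynomial.aeval (genMat F n 0) r = 0 := by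
    rw [hr, Polynomial.modByMonic_eq_sub_mul_div _ _, map_sub, map_mul, hf,
      Matrix.aeval_self_charpoly, zero_mul, sub_zero]
  have hdeg : r.natDegree < n := by
    have := Polynomial.natDegree_modByMonic_lt f hm (by
      intro h
      have := (genMat F n 0).charpoly_natDegree_eq_dim
      rw [h, Polynomial.natDegree_one, Fintype.card_fin] at this
      exact hn this.symm)
    rwa [Matrix.charpoly_natDegree_eq_dim, Fintype.card_fin] at this
  rw [Polynomial.aeval_eq_sum_range' hdeg, Finset.sum_range] at h0
  have h1 := Fintype.linearIndependent_iff.1 linearIndependent_genMat_pow _ h0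
  ext1 i
  by_cases hi : i < n
  · exact h1 ⟨i, hi⟩
  · rw [Polynomial.coeff_eq_zero_of_natDegree_lt (by omega), Polynomial.coeff_zero]
end

section
variable {F : Type*} [Field F] [CharZero F] {n : ℕ}

variable (F n) in
/-- The formal trace `q ↦ tr (Φ q)` on quasi-polynomials. -/
noncomputable def formalTrace : QPoly F n →+ QPoly F n :=
  (algebraMap (CPoly F n) (QPoly F n)).toAddMonoidHom.comp
    ((Matrix.traceAddMonoidHom (Fin n) (CPoly F n)).comp (PhiQ F n).toRingHom.toAddMonoidHom)

theorem formalTrace_apply (q : QPoly F n) :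
    formalTrace F n q = algebraMap (CPoly F n) _ (PhiQ F n q).trace := rfl

theorem isFormalTrace_formalTrace : IsFormalTrace (formalTrace F n) where
  cyclic a b := by
    rw [formalTrace_apply, formalTrace_apply, map_mul, map_mul, Matrix.trace_mul_comm]
  central a b := by rw [formalTrace_apply]; exact Algebra.commute_algebraMap_left _ _

theorem PhiQ_formalTrace (q : QPoly F n) :
    PhiQ F n (formalTrace F n q) = scalarTrace (Fin n) (CPoly F n) (PhiQ F n q) := by
  rw [formalTrace_apply, AlgHom.commutes, scalarTrace_apply]

/-- The action of a substitution endomorphism on coefficients. -/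
noncomputable def substCoeff (φ : QPoly F n →ₐ[F] QPoly F n) : CPoly F n →ₐ[F] CPoly F n :=
  MvPolynomial.aeval fun p => PhiQ F n (φ (FreeAlgebra.ι _ p.2.2)) p.1 p.2.1

theorem IsSubstEndo.map_algebraMap {φ : QPoly F n →ₐ[F] QPoly F n} (hφ : IsSubstEndo F n φ)
    (c : CPoly F n) : φ (algebraMap _ _ c) = algebraMap _ _ (substCoeff φ c) := by
  have : φ.comp (IsScalarTower.toAlgHom F (CPoly F n) (QPoly F n)) =
      (IsScalarTower.toAlgHom F (CPoly F n) (QPoly F n)).comp (substCoeff φ) := by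
    ext ⟨i, j, k⟩
    simpa [substCoeff] using hφ i j k
  exact DFunLike.congr_fun this c

theorem IsSubstEndo.PhiQ_map {φ : QPoly F n →ₐ[F] QPoly F n} (hφ : IsSubstEndo F n φ)
    (q : QPoly F n) : PhiQ F n (φ q) = (substCoeff φ).mapMatrix (PhiQ F n q) := by
  induction q using FreeAlgebra.induction with
  | grade0 c =>
    rw [hφ.map_algebraMap, AlgHom.commutes, AlgHom.commutes]
    ext1 i j
    rw [AlgHom.mapMatrix_apply, Matrix.map_apply, Matrix.algebraMap_matrix_apply,
      Matrix.algebraMap_matrix_apply, apply_ite (substCoeff φ), map_zero]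
    rfl
  | grade1 k =>
    ext i j
    simp [PhiQ_ι, genMat, substCoeff]
  | mul a b ha hb => simp only [map_mul, ha, hb]
  | add a b ha hb => simp only [map_add, ha, hb]

theorem IsSubstEndo.map_formalTrace {φ : QPoly F n →ₐ[F] QPoly F n} (hφ : IsSubstEndo F n φ)
    (q : QPoly F n) : φ (formalTrace F n q) = formalTrace F n (φ q) := by
  rw [formalTrace_apply, formalTrace_apply, hφ.map_algebraMap, hφ.PhiQ_map,
    AlgHom.mapMatrix_apply, ← AddMonoidHom.map_trace]

theorem exists_isSubstEndo (H : ℕ → QPoly F n) :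
    ∃ φ : QPoly F n →ₐ[F] QPoly F n, IsSubstEndo F n φ ∧ ∀ k, φ (FreeAlgebra.ι _ k) = H k := by
  let ψ : CPoly F n →ₐ[F] CPoly F n := MvPolynomial.aeval fun p => PhiQ F n (H p.2.2) p.1 p.2.1
  let θ : MonoidAlgebra (CPoly F n) (FreeMonoid ℕ) →+* QPoly F n :=
    MonoidAlgebra.liftNCRingHom ((algebraMap (CPoly F n) (QPoly F n)).comp ψ.toRingHom)
      (FreeMonoid.lift H) fun c w => Algebra.commute_algebraMap_left (ψ c) _
  let Θ : QPoly F n →+* QPoly F n :=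
    θ.comp (FreeAlgebra.equivMonoidAlgebraFreeMonoid :
      FreeAlgebra (CPoly F n) ℕ ≃ₐ[CPoly F n] _).toAlgHom.toRingHom
  have h1 (c : CPoly F n) : Θ (algebraMap _ _ c) = algebraMap _ _ (ψ c) := by
    simp [Θ, θ, FreeAlgebra.equivMonoidAlgebraFreeMonoid]
  have h2 (k : ℕ) : Θ (FreeAlgebra.ι _ k) = H k := by
    simp [Θ, θ, FreeAlgebra.equivMonoidAlgebraFreeMonoid]
  refine ⟨{ Θ with commutes' := fun r => ?_ }, fun i j k => ?_, h2⟩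
  · rw [IsScalarTower.algebraMap_apply F (CPoly F n) (QPoly F n)]
    exact (h1 _).trans (by rw [AlgHom.commutes])
  · refine (h1 _).trans ?_
    refine congrArg _ ?_
    refine Eq.trans ?_ (congrArg (fun q => PhiQ F n q i j) (h2 k)).symm
    simp [ψ]
end

theorem MultilinearMap.factorial_smul_eq_sum {S M N : Type*} [Fintype S] [DecidableEq S]
    [AddCommGroup M] [AddCommGroup N] (f : MultilinearMap ℤ (fun _ : S => M) N)
    (hf : ∀ (r : Perm S) (x : S → M), f (x ∘ r) = f x) (x : S → M) :
    (Fintype.card S).factorial • f x =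
      ∑ T : Finset S, (-1 : ℤ) ^ T.card • f fun _ => ∑ s ∈ Tᶜ, x s := by
  have h1 (T : Finset S) : (-1 : ℤ) ^ T.card • f (fun _ => ∑ s ∈ Tᶜ, x s) =
      ∑ r : S → S, (if T ⊆ (Finset.univ.image r)ᶜ then (-1 : ℤ) ^ T.card else 0) • f (x ∘ r) := by
    rw [f.map_sum_finset (fun _ => x) (fun _ => Tᶜ), Finset.smul_sum]
    simp only [ite_smul, zero_smul]
    rw [← Finset.sum_filter]
    refine Finset.sum_congr ?_ fun _ _ => rfl
    ext r
    simp only [Fintype.mem_piFinset, Finset.mem_compl, Finset.mem_filter, Finset.mem_univ,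
      true_and, Finset.subset_iff, Finset.mem_image, not_exists]
    exact ⟨fun h s hs i hi => h i (hi ▸ hs), fun h i hi => h hi i rfl⟩
  have h2 (r : S → S) : ∑ T : Finset S, (if T ⊆ (Finset.univ.image r)ᶜ then (-1 : ℤ) ^ T.card else 0)
      = if Bijective r then 1 else 0 := by
    rw [← Finset.sum_filter, Finset.filter_congr_decidable]
    trans ∑ T ∈ (Finset.univ.image r)ᶜ.powerset, (-1 : ℤ) ^ T.card
    · refine Finset.sum_congr ?_ fun _ _ => rfl
      ext T
      simp
    · rw [Finset.sum_powerset_neg_one_pow_card]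
      refine if_congr ?_ rfl rfl
      rw [Finset.compl_eq_empty_iff, ← Finite.surjective_iff_bijective, Finset.eq_univ_iff_forall]
      simp [Surjective]
  simp only [h1]
  rw [Finset.sum_comm]
  simp only [← Finset.sum_smul, h2]
  simp only [ite_smul, one_smul, zero_smul]
  rw [← Finset.sum_filter]
  trans ∑ r : Perm S, f (x ∘ r)
  · simp [hf, Fintype.card_perm]
  · refine Finset.sum_bij (fun r _ => r) (by simp) (by simp [DFunLike.coe_injective.eq_iff]) ?_
      fun _ _ => rfl
    intro r hr
    exact ⟨Equiv.ofBijective r (by simpa using hr), Finset.mem_univ _, rfl⟩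

section
variable {F : Type*} [Field F] [CharZero F] {n : ℕ}

/-- A T-ideal as a left ideal. -/
def IsTIdeal.toIdeal {I : Set (QPoly F n)} (hI : IsTIdeal F n I) : Ideal (QPoly F n) where
  carrier := I
  zero_mem' := hI.1
  add_mem' := hI.2.1 _ _
  smul_mem' r _ ha := hI.2.2.1 r _ ha

variable {I : Set (QPoly F n)} (hI : IsTIdeal F n I)

theorem IsTIdeal.mul_mem_toIdeal {q : QPoly F n} (hq : q ∈ hI.toIdeal) (r : QPoly F n) :
    q * r ∈ hI.toIdeal := hI.2.2.2.1 r q hq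

theorem IsTIdeal.mem_of_natCast_smul_mem {q : QPoly F n} {k : ℕ} (hk : k ≠ 0)
    (hq : k • q ∈ hI.toIdeal) : q ∈ hI.toIdeal := by
  have : q = algebraMap F (QPoly F n) (k : F)⁻¹ * (k • q) := by
    rw [← Algebra.smul_def, ← Nat.cast_smul_eq_nsmul F, smul_smul,
      inv_mul_cancel₀ (Nat.cast_ne_zero.2 hk), one_smul]
  rw [this]
  exact hI.toIdeal.mul_mem_left _ hq
end
section
variable {F : Type*} [Field F] [CharZero F] {n : ℕ}

/-- The alternating sum of the formal trace monomials in `n + 1` slots, the slot `none`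
being filled with `1`. -/
noncomputable def altElim {Q : Type*} [Ring Q] (t : Q →+ Q) (n : ℕ) (H : Option (Fin n) → Q) : Q :=
  ∑ π : Perm (Option (Fin n)), (Perm.sign π : ℤ) •
    elimCycles t none ((List.finRange n).map some) π H

theorem map_altElim {Q Q' : Type*} [Ring Q] [Ring Q'] {t : Q →+ Q} {t' : Q' →+ Q'} (f : Q →+* Q')
    (hf : ∀ q, f (t q) = t' (f q)) (n : ℕ) (H : Option (Fin n) → Q) :
    f (altElim t n H) = altElim t' n (fun a => f (H a)) := by
  simp only [altElim, map_sum, map_zsmul, map_elimCycles f hf]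

theorem altElim_scalarTrace (hn : n ≠ 0) {K : Type*} [CommRing K] [IsDomain K] [CharZero K]
    (H : Option (Fin n) → Matrix (Fin n) (Fin n) K) (hH : H none = 1) :
    altElim (scalarTrace (Fin n) K) n H = 0 := by
  refine Matrix.ext_iff_trace_mul_left.2 fun Y => ?_
  have hl : (none : Option (Fin n)) ∉ (List.finRange n).map some := by simp
  rw [mul_zero, Matrix.trace_zero]
  have h1 : (n : K) ^ n * (Y * altElim (scalarTrace (Fin n) K) n H).trace =
      (n : K) ^ n * ∑ π : Perm (Option (Fin n)), ((Perm.sign π : ℤ) : K) *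
        permTrace π (update H none Y) := by
    rw [altElim, Finset.mul_sum, Matrix.trace_sum, Finset.mul_sum, Finset.mul_sum]
    refine Finset.sum_congr rfl fun π _ => ?_
    have h2 := permTrace_eq_trace_elimCycles (p := none) (l := (List.finRange n).map some)
      (σ := π) (G := update H none Y)
      ((List.nodup_finRange n).map (Option.some_injective _)) hl
      (by rintro (_ | x) <;> simp) (by rintro (_ | x) <;> simp)
    rw [List.length_map, List.length_finRange, Fintype.card_option, Fintype.card_fin,
      Nat.add_sub_cancel, ← mul_one Y, elimCycles_update_mul_left isFormalTrace_scalarTrace hl,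
      ← hH, update_eq_self, hH, mul_one] at h2
    rw [mul_smul_comm, Matrix.trace_smul, mul_left_comm, h2, zsmul_eq_mul, mul_left_comm]
  have h3 := sum_sign_mul_permTrace (ι := Fin n) (K := K) (Embedding.refl (Option (Fin n)))
    (by simp) 1 (update H none Y)
  have h4 (π : Perm (Option (Fin n))) :
      π.viaEmbedding (Embedding.refl (Option (Fin n))) = π := by
    ext1 x
    exact Perm.viaEmbedding_apply π (Embedding.refl _) x
  simp only [h4, mul_one] at h3
  rw [h3, mul_zero] at h1
  exact (mul_eq_zero.1 h1).resolve_left (pow_ne_zero _ (Nat.cast_ne_zero.2 hn))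

theorem altElim_comp_optionCongr {Q : Type*} [Ring Q] {t : Q →+ Q} (ht : IsFormalTrace t)
    (r : Perm (Fin n)) (H : Option (Fin n) → Q) :
    altElim t n (H ∘ optionCongr r) = altElim t n H := by
  have hl : ((List.finRange n).map some).map (optionCongr r).toEmbedding |>.Perm
      ((List.finRange n).map (some : Fin n → Option (Fin n))) := by
    refine (List.perm_ext_iff_of_nodup ?_ ?_).2 ?_
    · exact ((List.nodup_finRange n).map (Option.some_injective _)).map (Equiv.injective _)
    · exact (List.nodup_finRange n).map (Option.some_injective _)
    · rintro (_ | x)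
      · simp
      · simpa using r.surjective x
  refine Fintype.sum_equiv (optionCongr r).permCongr _ _ fun π => ?_
  rw [Perm.sign_permCongr, ← elimCycles_perm ht none hl ?_ ((optionCongr r).permCongr π)]
  · refine congrArg _ (Eq.symm ?_)
    exact elimCycles_map (optionCongr r).toEmbedding none _ π ((optionCongr r).permCongr π)
      (fun b => by
        rw [permCongr_apply, Equiv.coe_toEmbedding, Equiv.symm_apply_apply]) H
  · exact ((List.nodup_finRange n).map (Option.some_injective _)).map (Equiv.injective _)

/-- `altElim` as a multilinear map. -/
noncomputable def altElimMultilinear {Q : Type*} [Ring Q] (t : Q →+ Q) (n : ℕ) :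
    MultilinearMap ℤ (fun _ : Fin n => Q) Q := by
  have hadd (h : Fin n → Q) (i : Fin n) (x y : Q) :
      altElim t n (fun o => o.elim 1 (update h i (x + y))) =
        altElim t n (fun o => o.elim 1 (update h i x)) +
          altElim t n (fun o => o.elim 1 (update h i y)) := by
    have key (u : Q) : (fun o : Option (Fin n) => o.elim 1 (update h i u)) =
        update (fun o => o.elim 1 h) (some i) u := by
      ext (_ | j)
      · simp
      · by_cases hj : j = i <;> simp [hj]
    simp only [key, altElim, ← Finset.sum_add_distrib, ← smul_add]
    refine Finset.sum_congr rfl fun π _ => ?_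
    rw [elimCycles_update_add (by simp)
      ((List.nodup_finRange n).map (Option.some_injective _)) (by rintro (_ | x) <;> simp)
      (by simp)]
  exact
  { toFun := fun h => altElim t n fun o => o.elim 1 h
    map_update_add' := by
      intro inst h i x y
      cases Subsingleton.elim inst (instDecidableEqFin n)
      exact hadd h i x y
    map_update_smul' := by
      intro inst h i c x
      cases Subsingleton.elim inst (instDecidableEqFin n)
      exact map_zsmul (AddMonoidHom.mk' (fun u => altElim t n fun o => o.elim 1 (update h i u))
        (hadd h i)) c x }

theorem altElim_const_mem {I : Set (QPoly F n)} (hI : IsTIdeal F n I) (hq : chQ F n ∈ I)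
    (hn : n ≠ 0) (x : QPoly F n) :
    altElim (formalTrace F n) n (fun o => o.elim 1 fun _ => x) ∈ hI.toIdeal := by
  let t' : Polynomial (CPoly F n) →+ Polynomial (CPoly F n) :=
    Polynomial.C.toAddMonoidHom.comp ((Matrix.traceAddMonoidHom (Fin n) (CPoly F n)).comp
      (Polynomial.aeval (genMat F n 0)).toRingHom.toAddMonoidHom)
  have ht' (f : Polynomial (CPoly F n)) :
      t' f = Polynomial.C (Polynomial.aeval (genMat F n 0) f).trace := rfl
  let f : Polynomial (CPoly F n) := altElim t' n (fun o => o.elim 1 fun _ => Polynomial.X)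
  have h1 : (genMat F n 0).charpoly ∣ f := by
    refine charpoly_genMat_dvd ?_
    let g : Polynomial (CPoly F n) →+* Matrix (Fin n) (Fin n) (CPoly F n) :=
      (Polynomial.aeval (genMat F n 0)).toRingHom
    refine (map_altElim (t := t') (t' := scalarTrace (Fin n) (CPoly F n)) g ?_ n _).trans ?_
    · intro q
      exact Polynomial.aeval_C _ _
    · exact altElim_scalarTrace hn _ (by simp)
  have h2 : altElim (formalTrace F n) n
      (fun o => o.elim 1 fun _ => FreeAlgebra.ι (CPoly F n) 0) ∈ hI.toIdeal := by
    have : altElim (formalTrace F n) n (fun o => o.elim 1 fun _ => FreeAlgebra.ι (CPoly F n) 0) =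
        Polynomial.aeval (FreeAlgebra.ι (CPoly F n) 0) f := by
      let g : Polynomial (CPoly F n) →+* QPoly F n :=
        (Polynomial.aeval (FreeAlgebra.ι (CPoly F n) 0)).toRingHom
      refine Eq.trans (congrArg _ ?_) (map_altElim (t := t') (t' := formalTrace F n) g ?_ n _).symm
      · ext1 (_ | i) <;> simp [g]
      · intro q
        refine (Polynomial.aeval_C _ _).trans ?_
        rw [formalTrace_apply]
        refine congrArg (fun M : Matrix (Fin n) (Fin n) (CPoly F n) =>
          algebraMap (CPoly F n) (QPoly F n) M.trace) ?_
        refine Eq.trans ?_ (Polynomial.aeval_algHom_apply (PhiQ F n) _ _)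
        rw [PhiQ_ι]
        rfl
    rw [this]
    obtain ⟨g, hg⟩ := h1
    rw [hg, map_mul]
    refine hI.mul_mem_toIdeal ?_ _
    rw [Polynomial.aeval_eq_sum_range, Matrix.charpoly_natDegree_eq_dim, Fintype.card_fin]
    simp only [Algebra.smul_def]
    exact hq
  obtain ⟨φ, hφ, hx⟩ := exists_isSubstEndo (fun _ => x)
  have h3 := hI.2.2.2.2 φ hφ _ h2
  have h4 := map_altElim (t := formalTrace F n) (t' := formalTrace F n) φ.toRingHom
    hφ.map_formalTrace n (fun o => o.elim 1 fun _ => FreeAlgebra.ι (CPoly F n) 0)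
  have h5 : (fun o : Option (Fin n) =>
      φ.toRingHom (o.elim 1 fun _ => FreeAlgebra.ι (CPoly F n) 0)) = fun o => o.elim 1 fun _ => x := by
    ext1 (_ | i)
    · exact map_one φ
    · exact hx 0
  rw [h5] at h4
  rw [← h4]
  exact h3

theorem altElim_mem {I : Set (QPoly F n)} (hI : IsTIdeal F n I) (hq : chQ F n ∈ I)
    (hn : n ≠ 0) (h : Fin n → QPoly F n) :
    altElim (formalTrace F n) n (fun o => o.elim 1 h) ∈ hI.toIdeal := by
  refine hI.mem_of_natCast_smul_mem (Nat.factorial_ne_zero n) ?_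
  have := (altElimMultilinear (formalTrace F n) n).factorial_smul_eq_sum ?_ h
  · rw [Fintype.card_fin] at this
    refine (congrArg (· ∈ hI.toIdeal) this).mpr ?_
    exact sum_mem fun T _ => zsmul_mem (altElim_const_mem hI hq hn _) _
  · intro r x
    refine Eq.trans (congrArg (altElim _ n) ?_)
      (altElim_comp_optionCongr isFormalTrace_formalTrace r _)
    ext1 (_ | i) <;> simp
end

section
variable {α β Q : Type*} [DecidableEq α] [DecidableEq β] [Fintype β] [Ring Q] {t : Q →+ Q}

theorem exists_perm_apply_embedding (e : β ↪ α) {σ : Perm α} (hσ : ∀ x, x ∉ Set.range e → σ x = x) :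
    ∃ τ : Perm β, ∀ b, σ (e b) = e (τ b) := by
  have h1 (b : β) : ∃ c, e c = σ (e b) := by
    by_contra h
    have h2 : σ (e b) ∉ Set.range e := h
    exact h2 ⟨b, (σ.injective (hσ _ h2)).symm⟩
  choose f hf using h1
  have hinj : Injective f := fun a b hab =>
    e.injective (σ.injective (by rw [← hf, ← hf, hab]))
  exact ⟨Equiv.ofBijective f (Finite.injective_iff_bijective.1 hinj), fun b => (hf b).symm⟩

theorem exists_elimCycles_eq_algebraMap {C : Type*} [CommRing C] [Algebra C Q]
    (htC : ∀ q, ∃ c : C, t q = algebraMap C Q c) {p : α} {l : List α} (hp : p ∉ l) {σ : Perm α}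
    (hσ : σ p = p) {H : α → Q} (hH : H p = 1) :
    ∃ c : C, elimCycles t p l σ H = algebraMap C Q c := by
  induction l generalizing σ H with
  | nil => exact ⟨1, by simp [elimCycles, hH]⟩
  | cons s l ih =>
    simp only [List.mem_cons, not_or] at hp
    by_cases h : σ s = s
    · rw [elimCycles_cons_of_fixed h]
      obtain ⟨c, hc⟩ := htC (H s)
      obtain ⟨d, hd⟩ := ih hp.2 hσ (H := update H s 1) (by rw [update_of_ne hp.1, hH])
      exact ⟨c * d, by rw [hc, hd, map_mul]⟩
    · obtain ⟨i, rfl⟩ := σ.surjective s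
      have hi : i ≠ σ i := fun h' => h (congrArg σ h'.symm)
      have hip : p ≠ i := by rintro rfl; exact hi hσ.symm
      rw [elimCycles_cons_of_apply_eq rfl hi]
      refine ih hp.2 ?_ ?_
      · rw [Perm.mul_apply, swap_apply_of_ne_of_ne hip hp.1, hσ]
      · rw [update_of_ne hp.1, update_of_ne hip, hH]
end

section
variable {F : Type*} [Field F] [CharZero F] {n : ℕ} {α β : Type*} [Fintype α] [DecidableEq α]
  [Fintype β] [DecidableEq β]

theorem sum_sign_elimCycles_perm_mem {I : Set (QPoly F n)} (hI : IsTIdeal F n I)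
    (hq : chQ F n ∈ I) (hn : n ≠ 0) (hβ : Fintype.card β = n + 1) (b : β) {l : List β}
    (hl : l.Nodup) (hlb : ∀ x, x ∈ l ↔ x ≠ b) (H : β → QPoly F n) :
    ∑ π : Perm β, (Perm.sign π : ℤ) • elimCycles (formalTrace F n) b l π H ∈ hI.toIdeal := by
  obtain ⟨ε, rfl⟩ : ∃ ε : Option (Fin n) ≃ β, ε none = b := by
    have ε : Option (Fin n) ≃ β := Fintype.equivOfCardEq (by simp [hβ])
    exact ⟨(swap none (ε.symm b)).trans ε, by simp⟩
  have hL : ((List.finRange n).map some : List (Option (Fin n))).Nodup :=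
    (List.nodup_finRange n).map (Option.some_injective _)
  have hperm : l.Perm (((List.finRange n).map some).map ε.toEmbedding) := by
    refine (List.perm_ext_iff_of_nodup hl (hL.map ε.injective)).2 fun x => ?_
    obtain ⟨y, rfl⟩ := ε.surjective x
    rw [hlb]
    cases y <;> simp
  have h1 : ∑ π : Perm β, (Perm.sign π : ℤ) • elimCycles (formalTrace F n) (ε none) l π H =
      altElim (formalTrace F n) n (H ∘ ε) := by
    refine (Fintype.sum_equiv ε.permCongr _ _ fun π => ?_).symm
    rw [Perm.sign_permCongr, elimCycles_perm isFormalTrace_formalTrace _ hperm hl]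
    refine congrArg _ (Eq.symm ?_)
    exact elimCycles_map ε.toEmbedding none _ π (ε.permCongr π) (fun x => by
      rw [permCongr_apply, Equiv.coe_toEmbedding, Equiv.symm_apply_apply]) H
  have h2 : H ∘ ε = update (fun o => o.elim 1 fun i => H (ε (some i))) none (H (ε none) * 1) := by
    ext1 (_ | i) <;> simp
  rw [h1, h2, altElim]
  simp only [elimCycles_update_mul_left isFormalTrace_formalTrace
    (show (none : Option (Fin n)) ∉ (List.finRange n).map some by simp), ← mul_smul_comm]
  rw [← Finset.mul_sum]
  refine hI.toIdeal.mul_mem_left _ ?_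
  have h3 : update (fun o => o.elim 1 fun i => H (ε (some i))) none 1 =
      fun o : Option (Fin n) => o.elim 1 fun i => H (ε (some i)) := by
    ext1 (_ | i) <;> simp
  rw [h3]
  exact altElim_mem hI hq hn _

theorem sum_sign_elimCycles_range_mem {I : Set (QPoly F n)} (hI : IsTIdeal F n I)
    (hq : chQ F n ∈ I) (hn : n ≠ 0) (hβ : Fintype.card β = n + 1) (e : β ↪ α) (b : β) {l : List β}
    (hl : l.Nodup) (hlb : ∀ x, x ∈ l ↔ x ≠ b) {σ : Perm α}
    (hσ : ∀ x, x ∉ Set.range e → σ x = x) (H : α → QPoly F n) :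
    ∑ π : Perm β, (Perm.sign π : ℤ) •
      elimCycles (formalTrace F n) (e b) (l.map e) (π.viaEmbedding e * σ) H ∈ hI.toIdeal := by
  obtain ⟨τ, hτ⟩ := exists_perm_apply_embedding e hσ
  have h1 : ∑ π : Perm β, (Perm.sign π : ℤ) •
      elimCycles (formalTrace F n) (e b) (l.map e) (π.viaEmbedding e * σ) H =
      (Perm.sign τ : ℤ) • ∑ π : Perm β, (Perm.sign π : ℤ) •
        elimCycles (formalTrace F n) b l π (H ∘ e) := by
    rw [← Finset.sum_zsmul]
    refine Fintype.sum_equiv (Equiv.mulRight τ) _ _ fun π => ?_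
    rw [Equiv.coe_mulRight, Perm.sign_mul, smul_smul, elimCycles_map e b l (π * τ)]
    · congr 1
      rcases Int.units_eq_one_or (Perm.sign τ) with h | h <;> simp [h]
    · intro x
      rw [Perm.mul_apply, hτ, Perm.viaEmbedding_apply, Perm.mul_apply]
  rw [h1]
  exact zsmul_mem (sum_sign_elimCycles_perm_mem hI hq hn hβ b hl hlb _) _

theorem sum_sign_elimCycles_eq_zero (hn : n ≠ 0) (hβ : Fintype.card β = n + 1) (e : β ↪ α)
    {p : α} (hp : p ∉ Set.range e) {l : List α} (hl : l.Nodup) (hpl : p ∉ l) {σ : Perm α}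
    (hσp : σ p = p) (hle : ∀ x, x ∉ l → x ∉ Set.range e)
    (hσ : ∀ x, x ∉ l → x ≠ p → σ x = x) {H : α → QPoly F n} (hHp : H p = 1)
    (hH : ∀ x, x ∉ l → x ≠ p → H x = 1) :
    ∑ π : Perm β, (Perm.sign π : ℤ) •
      elimCycles (formalTrace F n) p l (π.viaEmbedding e * σ) H = 0 := by
  have hsc (π : Perm β) : ∃ c : CPoly F n,
      elimCycles (formalTrace F n) p l (π.viaEmbedding e * σ) H = algebraMap _ _ c := by
    refine exists_elimCycles_eq_algebraMap (fun q => ⟨_, formalTrace_apply q⟩) hpl ?_ hHp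
    rw [Perm.mul_apply, hσp, Perm.viaEmbedding_apply_of_notMem _ _ _ hp]
  choose c hc using hsc
  have hn' : (n : CPoly F n) ≠ 0 := Nat.cast_ne_zero.2 hn
  have h1 (π : Perm β) : (n : CPoly F n) ^ l.length *
      permTrace (π.viaEmbedding e * σ) (fun x => PhiQ F n (H x)) =
      (n : CPoly F n) ^ (Fintype.card α - 1) * (n * c π) := by
    have h2 := permTrace_eq_trace_elimCycles (K := CPoly F n) (ι := Fin n) hl hpl
      (σ := π.viaEmbedding e * σ) (G := fun x => PhiQ F n (H x)) ?_ ?_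
    · rw [Fintype.card_fin] at h2
      have h3 : elimCycles (scalarTrace (Fin n) (CPoly F n)) p l (π.viaEmbedding e * σ)
          (fun x => PhiQ F n (H x)) = algebraMap _ _ (c π) :=
        (map_elimCycles (PhiQ F n).toRingHom PhiQ_formalTrace p l _ H).symm.trans
          ((congrArg (PhiQ F n) (hc π)).trans ((PhiQ F n).commutes _))
      rw [h2, h3]
      simp [Matrix.algebraMap_eq_diagonal, Matrix.trace_diagonal]
    · intro x hx hxp
      rw [Perm.mul_apply, hσ x hx hxp, Perm.viaEmbedding_apply_of_notMem _ _ _ (hle x hx)]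
    · intro x hx hxp
      rw [hH x hx hxp, map_one]
  have h2 := sum_sign_mul_permTrace (ι := Fin n) (K := CPoly F n) e (by simp [hβ]) σ
    (fun x => PhiQ F n (H x))
  have h3 : (n : CPoly F n) ^ (Fintype.card α - 1) *
      (n * ∑ π : Perm β, (Perm.sign π : ℤ) • c π) = 0 := by
    rw [Finset.mul_sum, Finset.mul_sum, ← mul_zero ((n : CPoly F n) ^ l.length), ← h2,
      Finset.mul_sum]
    refine Finset.sum_congr rfl fun π _ => ?_
    rw [zsmul_eq_mul, mul_left_comm ((n : CPoly F n) ^ l.length), h1]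
    ring
  have h4 := (mul_eq_zero.1 ((mul_eq_zero.1 h3).resolve_left (pow_ne_zero _ hn'))).resolve_left hn'
  simp only [hc, ← map_zsmul, ← map_sum]
  rw [h4, map_zero]

theorem sum_sign_elimCycles_mem {I : Set (QPoly F n)} (hI : IsTIdeal F n I)
    (hq : chQ F n ∈ I) (hn : n ≠ 0) (hβ : Fintype.card β = n + 1) (e : β ↪ α) (p : α)
    {l : List α} (hl : l.Nodup) (hlp : ∀ x, x ∈ l ↔ x ≠ p) (σ : Perm α) (H : α → QPoly F n) :
    ∑ π : Perm β, (Perm.sign π : ℤ) •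
      elimCycles (formalTrace F n) p l (π.viaEmbedding e * σ) H ∈ hI.toIdeal := by
  let G : Set (Perm α) := Set.range fun π : Perm β => π.viaEmbedding e
  let l₁ : List α := (Finset.univ.filter fun x => x ∉ Set.range e ∧ x ≠ p).toList
  have hl₁ (x : α) : x ∈ l₁ ↔ x ∉ Set.range e ∧ x ≠ p := by simp [l₁]
  have hG : ∀ π ∈ G, ∀ x ∉ Set.range e, π x = x := by
    rintro _ ⟨π, rfl⟩ x hx
    exact Perm.viaEmbedding_apply_of_notMem _ _ _ hx
  have herase (b : β) (x : β) : x ∈ (Finset.univ.erase b).toList ↔ x ≠ b := by simp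
  by_cases hp : p ∈ Set.range e
  · obtain ⟨b, rfl⟩ := hp
    have hperm : l.Perm (l₁ ++ (Finset.univ.erase b).toList.map e) := by
      refine (List.perm_ext_iff_of_nodup hl ?_).2 fun x => ?_
      · refine (Finset.nodup_toList _).append ((Finset.nodup_toList _).map e.injective) ?_
        intro x hx hx'
        obtain ⟨y, _, rfl⟩ := List.mem_map.1 hx'
        exact ((hl₁ _).1 hx).1 ⟨y, rfl⟩
      · rw [hlp, List.mem_append, hl₁, List.mem_map]
        constructor
        · intro hx
          by_cases hx' : x ∈ Set.range e
          · obtain ⟨y, rfl⟩ := hx'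
            exact Or.inr ⟨y, (herase _ _).2 fun h => hx (h ▸ rfl), rfl⟩
          · exact Or.inl ⟨hx', hx⟩
        · rintro (h | ⟨y, hy, rfl⟩)
          · exact h.2
          · exact e.injective.ne ((herase _ _).1 hy)
    obtain ⟨c, σ', H', h1, -, -, h4⟩ := exists_elimCycles_append (t := formalTrace F n) G (e b) l₁
      ((Finset.univ.erase b).toList.map e) (fun π hπ x hx => hG π hπ x ((hl₁ x).1 hx).1) σ H
    have h5 (π : Perm β) : elimCycles (formalTrace F n) (e b) l (π.viaEmbedding e * σ) H =
        c * elimCycles (formalTrace F n) (e b) ((Finset.univ.erase b).toList.map e)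
          (π.viaEmbedding e * σ') H' := by
      rw [elimCycles_perm isFormalTrace_formalTrace _ hperm hl, h1 _ ⟨π, rfl⟩]
    simp only [h5, ← mul_smul_comm]
    rw [← Finset.mul_sum]
    refine hI.toIdeal.mul_mem_left _ ?_
    exact sum_sign_elimCycles_range_mem hI hq hn hβ e b (Finset.nodup_toList _) (herase b)
      (fun x hx => (h4 x ((hl₁ x).2 ⟨hx, by rintro rfl; exact hx ⟨b, rfl⟩⟩)).1) _
  · have hperm : l.Perm (l₁ ++ (Finset.univ : Finset β).toList.map e) := by
      refine (List.perm_ext_iff_of_nodup hl ?_).2 fun x => ?_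
      · refine (Finset.nodup_toList _).append ((Finset.nodup_toList _).map e.injective) ?_
        intro x hx hx'
        obtain ⟨y, _, rfl⟩ := List.mem_map.1 hx'
        exact ((hl₁ _).1 hx).1 ⟨y, rfl⟩
      · rw [hlp, List.mem_append, hl₁, List.mem_map]
        constructor
        · intro hx
          by_cases hx' : x ∈ Set.range e
          · obtain ⟨y, rfl⟩ := hx'
            exact Or.inr ⟨y, by simp, rfl⟩
          · exact Or.inl ⟨hx', hx⟩
        · rintro (h | ⟨y, hy, rfl⟩)
          · exact h.2
          · rintro rfl
            exact hp ⟨y, rfl⟩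
    obtain ⟨c, σ', H', h1, -, -, h4⟩ := exists_elimCycles_append (t := formalTrace F n) G p l₁
      ((Finset.univ : Finset β).toList.map e) (fun π hπ x hx => hG π hπ x ((hl₁ x).1 hx).1) σ H
    have h5 (π : Perm β) : elimCycles (formalTrace F n) p l (π.viaEmbedding e * σ) H =
        c * elimCycles (formalTrace F n) p ((Finset.univ : Finset β).toList.map e)
          (π.viaEmbedding e * σ') H' := by
      rw [elimCycles_perm isFormalTrace_formalTrace _ hperm hl, h1 _ ⟨π, rfl⟩]
    simp only [h5, ← mul_smul_comm]
    rw [← Finset.mul_sum]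
    refine hI.toIdeal.mul_mem_left _ ?_
    have hfix (x : α) (hx : x ∉ Set.range e) (hxp : x ≠ p) := h4 x ((hl₁ x).2 ⟨hx, hxp⟩)
    have hmem (x : α) : x ∈ (Finset.univ : Finset β).toList.map e ↔ x ∈ Set.range e := by simp
    by_cases hσp : σ' p = p
    · have h6 (π : Perm β) : elimCycles (formalTrace F n) p ((Finset.univ : Finset β).toList.map e)
          (π.viaEmbedding e * σ') H' =
          elimCycles (formalTrace F n) p ((Finset.univ : Finset β).toList.map e)
          (π.viaEmbedding e * σ') (update H' p 1) * H' p := by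
        rw [← elimCycles_update_mul_right (by rw [hmem]; exact hp), one_mul, update_eq_self]
        rw [Perm.mul_apply, hσp, Perm.viaEmbedding_apply_of_notMem _ _ _ hp]
      simp only [h6, ← smul_mul_assoc]
      rw [← Finset.sum_mul, sum_sign_elimCycles_eq_zero hn hβ e hp
        ((Finset.nodup_toList _).map e.injective) (by rw [hmem]; exact hp) hσp, zero_mul]
      · exact zero_mem _
      · exact fun x hx => by rwa [hmem] at hx
      · exact fun x hx hxp => (hfix x (by rwa [hmem] at hx) hxp).1
      · simp
      · intro x hx hxp
        rw [update_of_ne hxp, (hfix x (by rwa [hmem] at hx) hxp).2]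
    · obtain ⟨j, hj⟩ := σ'.surjective p
      have hjp : j ≠ p := by rintro rfl; exact hσp hj
      obtain ⟨b, rfl⟩ : j ∈ Set.range e := by
        by_contra h
        exact hjp ((hfix j h hjp).1.symm.trans hj)
      set L : List α := (Finset.univ.erase b).toList.map e with hLdef
      have hL : L.Nodup := (Finset.nodup_toList _).map e.injective
      have hbL : e b ∉ L := by simp [L]
      have hpL : p ∉ L := by
        intro h
        obtain ⟨y, _, rfl⟩ := List.mem_map.1 h
        exact hp ⟨y, rfl⟩
      have hxL (x : α) (h1 : x ∉ L) (h2 : x ≠ e b) : x ∉ Set.range e := by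
        rintro ⟨y, rfl⟩
        exact h1 (List.mem_map.2 ⟨y, (herase _ _).2 fun h => h2 (h ▸ rfl), rfl⟩)
      have hperm2 : ((Finset.univ : Finset β).toList.map e).Perm (L ++ [e b]) := by
        refine (List.perm_ext_iff_of_nodup ((Finset.nodup_toList _).map e.injective) ?_).2
          fun x => ?_
        · refine hL.append (List.nodup_singleton _) ?_
          intro x hx hx'
          rw [List.mem_singleton.1 hx'] at hx
          exact hbL hx
        · rw [hmem, List.mem_append, List.mem_singleton]
          constructor
          · intro hx
            by_contra h
            rw [not_or] at h
            exact hxL x h.1 h.2 hx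
          · rintro (h | rfl)
            · obtain ⟨y, _, rfl⟩ := List.mem_map.1 h
              exact ⟨y, rfl⟩
            · exact ⟨b, rfl⟩
      have hperm3 : (L ++ [p]).Perm ([p] ++ L) := List.perm_append_comm
      have hnd3 : (L ++ [p]).Nodup := by
        refine hL.append (List.nodup_singleton _) ?_
        intro x hx hx'
        rw [List.mem_singleton.1 hx'] at hx
        exact hpL hx
      obtain ⟨d, σ'', H'', k1, k2, -, k4⟩ := exists_elimCycles_append (t := formalTrace F n) G (e b)
        [p] L (fun π hπ x hx => hG π hπ x (by rw [List.mem_singleton.1 hx]; exact hp)) σ'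
        (update (update H' (e b) 1) p 1)
      have h6 (π : Perm β) : elimCycles (formalTrace F n) p ((Finset.univ : Finset β).toList.map e)
          (π.viaEmbedding e * σ') H' =
          H' p * d * elimCycles (formalTrace F n) (e b) L (π.viaEmbedding e * σ'') H'' *
            H' (e b) := by
        have h7 := elimCycles_move isFormalTrace_formalTrace hjp hpL hbL
          (σ := π.viaEmbedding e * σ') ?_ ?_ H' (H' p) 1 (H' (e b))
        · rw [mul_one, update_eq_self, update_eq_self] at h7
          rw [elimCycles_perm isFormalTrace_formalTrace _ hperm2
            ((Finset.nodup_toList _).map e.injective), h7,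
            elimCycles_perm isFormalTrace_formalTrace _ hperm3 hnd3, k1 _ ⟨π, rfl⟩, ← mul_assoc (H' p)]
        · rw [Perm.mul_apply, hj, Perm.viaEmbedding_apply_of_notMem _ _ _ hp]
        · intro x h1 h2 h3
          have := hxL x h1 h3
          rw [Perm.mul_apply, (hfix x this h2).1, Perm.viaEmbedding_apply_of_notMem _ _ _ this]
      have h8 : ∑ π : Perm β, (Perm.sign π : ℤ) •
          elimCycles (formalTrace F n) p ((Finset.univ : Finset β).toList.map e)
            (π.viaEmbedding e * σ') H' = H' p * d * (∑ π : Perm β, (Perm.sign π : ℤ) •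
          elimCycles (formalTrace F n) (e b) L (π.viaEmbedding e * σ'') H'') * H' (e b) := by
        rw [Finset.mul_sum, Finset.sum_mul]
        refine Finset.sum_congr rfl fun π _ => ?_
        rw [h6, mul_smul_comm, smul_mul_assoc]
      rw [h8]
      refine hI.mul_mem_toIdeal (hI.toIdeal.mul_mem_left _ ?_) _
      refine sum_sign_elimCycles_range_mem hI hq hn hβ e b (Finset.nodup_toList _) (herase b) ?_ _
      intro x hx
      by_cases hxp : x = p
      · rw [hxp]; exact (k4 p (by simp)).1
      · exact k2 x (hfix x hx hxp).1
end

section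
variable {n k : ℕ}

theorem exists_minimal_moved {m : ℕ} {ρ : Perm (Fin m)} (hρ : ρ ≠ 1) :
    ∃ i, i < ρ i ∧ ∀ j < i, ρ j = j := by
  have hne : (Finset.univ.filter fun i => ρ i ≠ i).Nonempty := by
    by_contra h
    rw [Finset.not_nonempty_iff_eq_empty, Finset.filter_eq_empty_iff] at h
    exact hρ (Equiv.ext fun i => not_not.1 (h (Finset.mem_univ i)))
  have hmin (j : Fin m) (hj : j < (Finset.univ.filter fun i => ρ i ≠ i).min' hne) : ρ j = j := by
    by_contra h
    exact absurd (Finset.min'_le _ j (by simpa using h)) (not_le.2 hj)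
  have hmem := Finset.min'_mem _ hne
  set i := (Finset.univ.filter fun i => ρ i ≠ i).min' hne
  refine ⟨i, ?_, hmin⟩
  have h1 : ρ i ≠ i := by simpa using hmem
  refine lt_of_le_of_ne (not_lt.1 fun h => h1 (ρ.injective (hmin _ h))) h1.symm

/-- A permutation that is not a union of `n` increasing subsequences has a decreasing subsequence
of length `n + 1`. -/
theorem exists_strictAnti_comp_of_forall_coloring (σ : Perm (Fin k))
    (h : ∀ c : Fin k → Fin n, ∃ i j, i < j ∧ c i = c j ∧ σ j < σ i) :
    ∃ e : Fin (n + 1) ↪o Fin k, StrictAnti (σ ∘ e) := by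
  let chains (i : Fin k) : Finset (Finset (Fin k)) :=
    Finset.univ.filter fun P => StrictAntiOn σ P ∧ i ∈ P ∧ ∀ x ∈ P, x ≤ i
  have hmem (i : Fin k) (P : Finset (Fin k)) :
      P ∈ chains i ↔ StrictAntiOn σ P ∧ i ∈ P ∧ ∀ x ∈ P, x ≤ i := by simp [chains]
  let len (i : Fin k) : ℕ := (chains i).sup Finset.card
  have hpos (i : Fin k) : 0 < len i := by
    have : ({i} : Finset (Fin k)) ∈ chains i := by simp [hmem]
    exact (Finset.card_pos.2 (Finset.singleton_nonempty i)).trans_le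
      (Finset.le_sup (f := Finset.card) this)
  by_cases hlen : ∀ i, len i ≤ n
  · obtain ⟨i, j, hij, hc, hσ⟩ := h fun i => ⟨len i - 1, by have := hlen i; have := hpos i; omega⟩
    have h1 : len i < len j := by
      have hne : (chains i).Nonempty := ⟨{i}, by simp [hmem]⟩
      obtain ⟨P, hP, hPi⟩ := Finset.exists_mem_eq_sup _ hne Finset.card
      obtain ⟨hanti, hiP, hle⟩ := (hmem i P).1 hP
      have hjP : j ∉ P := fun hj => absurd (hle j hj) (not_le.2 hij)
      have h2 : insert j P ∈ chains j := by
        refine (hmem _ _).2 ⟨?_, Finset.mem_insert_self _ _, fun x hx => ?_⟩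
        · have key (x : Fin k) (hx : x ∈ P) : σ j < σ x := by
            rcases (hle x hx).eq_or_lt with rfl | h
            · exact hσ
            · exact hσ.trans (hanti hx hiP h)
          intro x hx y hy hxy
          rw [Finset.mem_coe, Finset.mem_insert] at hx hy
          rcases hx with rfl | hx <;> rcases hy with rfl | hy
          · exact absurd hxy (lt_irrefl _)
          · exact absurd (hxy.trans_le (hle y hy)) (not_lt.2 hij.le)
          · exact key x hx
          · exact hanti hx hy hxy
        · rcases Finset.mem_insert.1 hx with rfl | hx
          · exact le_rfl
          · exact (hle x hx).trans hij.le
      have h3 : (insert j P).card ≤ len j := Finset.le_sup (f := Finset.card) h2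
      rw [Finset.card_insert_of_notMem hjP] at h3
      have h4 : len i = P.card := hPi
      omega
    have := hpos i
    have hc' : len i - 1 = len j - 1 := congrArg Fin.val hc
    omega
  · push Not at hlen
    obtain ⟨i, hi⟩ := hlen
    have hne : (chains i).Nonempty := ⟨{i}, by simp [hmem]⟩
    obtain ⟨P, hP, hPi⟩ := Finset.exists_mem_eq_sup _ hne Finset.card
    have hcard : n + 1 ≤ P.card := by
      have h4 : len i = P.card := hPi
      omega
    obtain ⟨P', hP', hcard'⟩ := Finset.exists_subset_card_eq hcard
    refine ⟨P'.orderEmbOfFin hcard', fun a b hab => ?_⟩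
    exact ((hmem i P).1 hP).1 (hP' (Finset.orderEmbOfFin_mem _ _ _))
      (hP' (Finset.orderEmbOfFin_mem _ _ _)) ((P'.orderEmbOfFin hcard').strictMono hab)

variable {K : Type*} [Field K]

variable (n k K) in
/-- The span of the antisymmetrizers on `n + 1` letters, in the group algebra of `Perm (Fin k)`. -/
def antisymSpan : Submodule K (Perm (Fin k) → K) :=
  Submodule.span K {b | ∃ (e : Fin (n + 1) ↪ Fin k) (σ : Perm (Fin k)),
    b = ∑ π : Perm (Fin (n + 1)),
      (Perm.sign π : ℤ) • (Pi.single (π.viaEmbedding e * σ) 1 : Perm (Fin k) → K)}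

theorem single_mem_antisymSpan_sup (σ : Perm (Fin k)) :
    (Pi.single σ 1 : Perm (Fin k) → K) ∈ antisymSpan n k K ⊔ Submodule.span K
      {b | ∃ τ : Perm (Fin k), (∃ c : Fin k → Fin n, ∀ i j, i < j → c i = c j → τ i < τ j) ∧
        b = Pi.single τ 1} := by
  have hwf : WellFounded fun σ τ : Perm (Fin k) => toLex (σ : Fin k → Fin k) < toLex (τ : Fin k → Fin k) :=
    InvImage.wf (fun σ : Perm (Fin k) => toLex (σ : Fin k → Fin k)) wellFounded_lt
  induction σ using hwf.induction with
  | _ σ ih =>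
  by_cases hgood : ∃ c : Fin k → Fin n, ∀ i j, i < j → c i = c j → σ i < σ j
  · exact Submodule.mem_sup_right (Submodule.subset_span ⟨σ, hgood, rfl⟩)
  · obtain ⟨pos, hpos⟩ := exists_strictAnti_comp_of_forall_coloring (n := n) σ (by
      intro c
      by_contra hcon
      push Not at hcon
      exact hgood ⟨c, fun i j hij hc => lt_of_le_of_ne (hcon i j hij hc) (σ.injective.ne hij.ne)⟩)
    let e : Fin (n + 1) ↪ Fin k := pos.toEmbedding.trans σ.toEmbedding
    have hsum : ∑ π : Perm (Fin (n + 1)), (Perm.sign π : ℤ) •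
        (Pi.single (π.viaEmbedding e * σ) 1 : Perm (Fin k) → K) ∈ antisymSpan n k K :=
      Submodule.subset_span ⟨e, σ, rfl⟩
    rw [← Finset.add_sum_erase _ _ (Finset.mem_univ 1)] at hsum
    have h1 : (Perm.viaEmbedding 1 e * σ : Perm (Fin k)) = σ := by
      rw [← Perm.viaEmbeddingHom_apply, map_one, one_mul]
    rw [h1, Perm.sign_one, Units.val_one, one_smul] at hsum
    rw [← add_sub_cancel_right (Pi.single σ 1) (∑ π ∈ Finset.univ.erase (1 : Perm (Fin (n + 1))),
      (Perm.sign π : ℤ) • (Pi.single (π.viaEmbedding e * σ) 1 : Perm (Fin k) → K))]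
    refine sub_mem (Submodule.mem_sup_left hsum) (sum_mem fun π hπ => zsmul_mem (ih _ ?_) _)
    obtain ⟨a, ha, hlt⟩ := exists_minimal_moved (Finset.ne_of_mem_erase hπ)
    have h2 (b : Fin (n + 1)) : (π.viaEmbedding e * σ) (pos b) = σ (pos (π b)) :=
      Perm.viaEmbedding_apply π e b
    refine ⟨pos a, fun x hx => ?_, ?_⟩
    · show (π.viaEmbedding e * σ) x = σ x
      by_cases hx' : x ∈ Set.range pos
      · obtain ⟨b, rfl⟩ := hx'
        rw [h2, hlt b (pos.lt_iff_lt.1 hx)]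
      · refine Perm.viaEmbedding_apply_of_notMem _ _ _ ?_
        rintro ⟨b, hb⟩
        exact hx' ⟨b, σ.injective hb⟩
    · show (π.viaEmbedding e * σ) (pos a) < σ (pos a)
      rw [h2]
      exact hpos ha

/-- The second fundamental theorem: the kernel of the action of the symmetric group algebra on
tensors is spanned by antisymmetrizers. -/
theorem mem_antisymSpan {a : Perm (Fin k) → K}
    (ha : ∀ I J : Fin k → Fin n, ∑ σ, a σ * (if J = I ∘ σ then 1 else 0) = 0) :
    a ∈ antisymSpan n k K := by
  classical
  have hker : antisymSpan n k K ≤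
      { carrier := {a | ∀ I J : Fin k → Fin n, ∑ σ, a σ * (if J = I ∘ σ then 1 else 0) = 0}
        add_mem' := by
          intro a b ha hb I J
          simp only [Pi.add_apply, add_mul, Finset.sum_add_distrib, ha I J, hb I J, add_zero]
        zero_mem' := by simp
        smul_mem' := by
          intro c a ha I J
          simp only [Pi.smul_apply, smul_eq_mul, mul_assoc, ← Finset.mul_sum, ha I J, mul_zero] } := by
    refine Submodule.span_le.2 ?_
    rintro _ ⟨e, τ, rfl⟩ I J
    have := sum_sign_mul_eq_zero (K := K) (ι := Fin n) e (by simp)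
      (fun I => if J = I ∘ τ then 1 else 0) I
    refine Eq.trans ?_ this
    simp only [Finset.sum_apply, Finset.sum_mul]
    rw [Finset.sum_comm]
    refine Finset.sum_congr rfl fun π _ => ?_
    simp only [Pi.smul_apply, zsmul_eq_mul, mul_assoc, ← Finset.mul_sum]
    congr 1
    rw [Finset.sum_eq_single (π.viaEmbedding e * τ), Pi.single_eq_same, one_mul]
    · rfl
    · intro x _ hx
      rw [Pi.single_eq_of_ne hx, zero_mul]
    · simp
  have htop : a ∈ antisymSpan n k K ⊔ Submodule.span K
      {b | ∃ τ : Perm (Fin k), (∃ c : Fin k → Fin n, ∀ i j, i < j → c i = c j → τ i < τ j) ∧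
        b = Pi.single τ 1} := by
    have : a = ∑ σ, a σ • (Pi.single σ 1 : Perm (Fin k) → K) := by
      ext σ
      simp [Pi.single_apply]
    rw [this]
    exact sum_mem fun σ _ => Submodule.smul_mem _ _ (single_mem_antisymSpan_sup σ)
  obtain ⟨b, hb, g, hg, rfl⟩ := Submodule.mem_sup.1 htop
  have hgood (σ : Perm (Fin k)) (hσ : g σ ≠ 0) :
      ∃ c : Fin k → Fin n, ∀ i j, i < j → c i = c j → σ i < σ j := by
    revert hσ
    contrapose
    intro hσ
    clear ha htop
    induction hg using Submodule.span_induction with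
    | mem x hx =>
      obtain ⟨τ, hτ, rfl⟩ := hx
      rw [Pi.single_apply, if_neg]
      rintro rfl
      exact hσ hτ
    | zero => rfl
    | add x y _ _ hx hy => rw [Pi.add_apply, hx, hy, add_zero]
    | smul c x _ hx => rw [Pi.smul_apply, hx, smul_zero]
  have hgker (I J : Fin k → Fin n) : ∑ σ, g σ * (if J = I ∘ σ then 1 else 0) = 0 := by
    have h1 := ha I J
    have h2 := hker hb I J
    simpa only [Pi.add_apply, add_mul, Finset.sum_add_distrib, h2, zero_add] using h1
  suffices g = 0 by rwa [this, add_zero]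
  by_contra hg0
  have hne : (Finset.univ.filter fun σ => g σ ≠ 0).Nonempty := by
    obtain ⟨σ, hσ⟩ := Function.ne_iff.1 hg0
    exact ⟨σ, by simpa using hσ⟩
  obtain ⟨σ, hσ, hmax⟩ := Finset.exists_max_image _
    (fun σ : Perm (Fin k) => toLex (σ : Fin k → Fin k)) hne
  simp only [Finset.mem_filter, Finset.mem_univ, true_and] at hσ hmax
  obtain ⟨c, hc⟩ := hgood σ hσ
  have h1 := hgker (c ∘ σ.symm) c
  rw [Finset.sum_eq_single σ] at h1
  · rw [if_pos (by ext1 x; simp), mul_one] at h1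
    exact hσ h1
  · intro τ _ hτ
    by_contra hcon
    have hgτ : g τ ≠ 0 := left_ne_zero_of_mul hcon
    have hcτ : c = (c ∘ σ.symm) ∘ τ := by
      by_contra h
      rw [if_neg h, mul_zero] at hcon
      exact hcon rfl
    obtain ⟨i, hi, hlt⟩ := exists_minimal_moved (ρ := σ⁻¹ * τ) (by
      intro h
      exact hτ (inv_mul_eq_one.1 h).symm)
    refine absurd (hmax τ hgτ) (not_le.2 ⟨i, fun j hj => ?_, ?_⟩)
    · show σ j = τ j
      conv_lhs => rw [← hlt j hj]
      simp
    · show σ i < τ i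
      have := hc i _ hi (congrFun hcτ i)
      simpa using this
  · simp
end

section
variable {G V K : Type*} [Field K] [CharZero K] [Group G] [Fintype G] [AddCommGroup V] [Module K V]

/-- The double centralizer theorem for representations of finite groups. -/
theorem Representation.exists_eq_sum_smul_of_commute [FiniteDimensional K V] (ρ : Representation K G V)
    (L : Module.End K V) (hL : ∀ φ : Module.End K V, (∀ g, Commute φ (ρ g)) → Commute L φ) :
    ∃ a : G → K, L = ∑ g, a g • ρ g := by
  let f : Module.End (Module.End (MonoidAlgebra K G) ρ.asModule) ρ.asModule :=
    { toFun := fun m => ρ.asModuleEquiv.symm (L (ρ.asModuleEquiv m))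
      map_add' := by simp
      map_smul' := by
        intro φ m
        let ψ : Module.End K V :=
          ρ.asModuleEquiv.toLinearMap ∘ₗ φ.restrictScalars K ∘ₗ ρ.asModuleEquiv.symm.toLinearMap
        have hψ : ∀ g, Commute ψ (ρ g) := by
          intro g
          ext v
          show ρ.asModuleEquiv (φ (ρ.asModuleEquiv.symm (ρ g v))) =
            ρ g (ρ.asModuleEquiv (φ (ρ.asModuleEquiv.symm v)))
          rw [Representation.asModuleEquiv_symm_map_rho, map_smul,
            Representation.asModuleEquiv_map_smul, Representation.asAlgebraHom_of]
        exact congrArg ρ.asModuleEquiv.symm (LinearMap.congr_fun (hL ψ hψ) (ρ.asModuleEquiv m)) }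
  obtain ⟨s, hs⟩ := (Module.Finite.fg_top (R := K) (M := V))
  obtain ⟨r, hr⟩ := jacobson_density f (s.map ρ.asModuleEquiv.symm.toEquiv.toEmbedding)
  refine ⟨fun g => r.coeff g, LinearMap.ext_on hs fun v hv => ?_⟩
  have h := hr (ρ.asModuleEquiv.symm v) (Finset.mem_map_of_mem _ hv)
  have h2 : L v = ρ.asAlgebraHom r v := h
  rw [h2, Representation.asAlgebraHom_def, MonoidAlgebra.lift_apply, Finsupp.sum_fintype]
  · simp
end

section
variable {α ι K : Type*} [Fintype α] [Fintype ι] [CommRing K]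

/-- The Kronecker product of a family of matrices. -/
def tensorMatrix (f : α → Matrix ι ι K) : Matrix (α → ι) (α → ι) K :=
  Matrix.of fun I J => ∏ a, f a (I a) (J a)

theorem tensorMatrix_apply (f : α → Matrix ι ι K) (I J : α → ι) :
    tensorMatrix f I J = ∏ a, f a (I a) (J a) := rfl

variable [DecidableEq α]

theorem tensorMatrix_mul (f g : α → Matrix ι ι K) :
    tensorMatrix f * tensorMatrix g = tensorMatrix (f * g) := by
  ext I J
  simp only [Matrix.mul_apply, tensorMatrix_apply, Pi.mul_apply, Finset.prod_univ_sum,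
    Fintype.piFinset_univ, Finset.prod_mul_distrib]

variable [DecidableEq ι]

theorem tensorMatrix_one : tensorMatrix (1 : α → Matrix ι ι K) = 1 := by
  ext I J
  simp only [tensorMatrix_apply, Pi.one_apply, Matrix.one_apply, Finset.prod_ite_zero]
  simp [funext_iff]

theorem tensorMatrix_single (I J : α → ι) :
    tensorMatrix (fun a => Matrix.single (I a) (J a) (1 : K)) = Matrix.single I J 1 := by
  ext I' J'
  simp only [tensorMatrix_apply, Matrix.single_apply, Finset.prod_ite_zero]
  simp [funext_iff, forall_and]

/-- The derivation action of a matrix on a tensor power. -/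
def derivMatrix (α : Type*) [Fintype α] [DecidableEq α] (E : Matrix ι ι K) :
    Matrix (α → ι) (α → ι) K :=
  ∑ a : α, tensorMatrix (Pi.mulSingle a E)

/-- The symmetrization of a Kronecker product of matrices. -/
def symMatrix (f : α → Matrix ι ι K) : Matrix (α → ι) (α → ι) K :=
  ∑ σ : Perm α, tensorMatrix (f ∘ σ)

theorem symMatrix_comp (f : α → Matrix ι ι K) (σ : Perm α) : symMatrix (f ∘ σ) = symMatrix f :=
  Fintype.sum_equiv (Equiv.mulLeft σ) _ _ fun _ => rfl

theorem derivMatrix_mul_symMatrix (E : Matrix ι ι K) (f : α → Matrix ι ι K) :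
    derivMatrix α E * symMatrix f = ∑ a, symMatrix (Pi.mulSingle a E * f) := by
  simp only [derivMatrix, symMatrix, Finset.sum_mul_sum, tensorMatrix_mul]
  rw [Finset.sum_comm, Finset.sum_comm (s := Finset.univ (α := α))]
  refine Finset.sum_congr rfl fun σ _ => ?_
  refine Fintype.sum_equiv σ _ _ fun a => ?_
  congr 1
  ext1 b
  simp only [Pi.mul_apply, comp_apply, Pi.mulSingle_apply, σ.injective.eq_iff]

end

section
variable {α ι K : Type*} [Fintype α] [Fintype ι] [Field K] [CharZero K] [DecidableEq α] [DecidableEq ι]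
  {L : Matrix (α → ι) (α → ι) K}

theorem commute_symMatrix (hL : ∀ E, Commute L (derivMatrix α E)) (f : α → Matrix ι ι K) :
    Commute L (symMatrix f) := by
  have key (s : Finset α) : ∀ f : α → Matrix ι ι K, (∀ a ∉ s, f a = 1) → Commute L (symMatrix f) := by
    induction s using Finset.induction_on with
    | empty =>
      intro f hf
      have : f = 1 := funext fun a => hf a (Finset.notMem_empty a)
      have h1 : symMatrix f = (Fintype.card (Perm α) : Matrix (α → ι) (α → ι) K) := by
        rw [symMatrix, this]
        simp [show ∀ σ : Perm α, ((1 : α → Matrix ι ι K) ∘ σ) = 1 from fun _ => rfl,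
          tensorMatrix_one]
      rw [h1]
      exact Nat.commute_cast _ _
    | insert b s hb ih =>
      intro f hf
      set f0 := update f b 1 with hf0
      have hf0s : ∀ a ∉ s, f0 a = 1 := by
        intro a ha
        by_cases hab : a = b
        · subst hab; simp [hf0]
        · rw [hf0, update_of_ne hab]
          exact hf a (by simp [hab, ha])
      have h1 : Commute L (∑ a, symMatrix (Pi.mulSingle a (f b) * f0)) := by
        rw [← derivMatrix_mul_symMatrix]
        exact (hL _).mul_right (ih f0 hf0s)
      have h2 : ∀ a ∈ s, Commute L (symMatrix (Pi.mulSingle a (f b) * f0)) := by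
        intro a ha
        refine ih _ fun c hc => ?_
        rw [Pi.mul_apply, hf0s c hc, Pi.mulSingle_eq_of_ne (by rintro rfl; exact hc ha), one_mul]
      have h3 : ∀ a ∈ sᶜ, symMatrix (Pi.mulSingle a (f b) * f0) = symMatrix f := by
        intro a ha
        rw [Finset.mem_compl] at ha
        rw [← symMatrix_comp _ (swap a b)]
        congr 1
        ext1 c
        simp only [comp_apply, Pi.mul_apply]
        rcases eq_or_ne c b with rfl | hcb
        · rw [swap_apply_right, Pi.mulSingle_eq_same, hf0s a ha, mul_one]
        · rcases eq_or_ne c a with rfl | hca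
          · rw [swap_apply_left, Pi.mulSingle_eq_of_ne hcb.symm, hf0s b hb, one_mul,
              hf c (by simp [hcb, ha])]
          · rw [swap_apply_of_ne_of_ne hca hcb, Pi.mulSingle_eq_of_ne hca, hf0, one_mul,
              update_of_ne hcb]
      rw [← Finset.sum_add_sum_compl s, Finset.sum_congr rfl h3, Finset.sum_const] at h1
      have h4 := h1.sub_right (Commute.sum_right _ _ _ h2)
      rw [add_sub_cancel_left] at h4
      have hcard : ((sᶜ : Finset α).card : K) ≠ 0 := by
        rw [Nat.cast_ne_zero, Finset.card_ne_zero]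
        exact ⟨b, by simpa using hb⟩
      have h5 := h4.smul_right (((sᶜ : Finset α).card : K)⁻¹)
      rwa [← Nat.cast_smul_eq_nsmul K, smul_smul, inv_mul_cancel₀ hcard, one_smul] at h5
  exact key Finset.univ f (by simp)

variable (α ι K) in
/-- The permutation action on a tensor power. -/
def tensorPerm : Representation K (Perm α) ((α → ι) → K) where
  toFun σ := LinearMap.funLeft K K fun I => I ∘ σ
  map_one' := rfl
  map_mul' _ _ := rfl

theorem tensorPerm_apply (σ : Perm α) (v : (α → ι) → K) (I : α → ι) :
    tensorPerm α ι K σ v I = v (I ∘ σ) := rfl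

/-- A matrix commuting with the derivation action on a tensor power is a combination of
permutations. -/
theorem exists_eq_sum_of_commute_derivMatrix (hL : ∀ E, Commute L (derivMatrix α E)) :
    ∃ a : Perm α → K, ∀ I J, L I J = ∑ σ, a σ * (if J = I ∘ σ then 1 else 0) := by
  obtain ⟨a, ha⟩ := (tensorPerm α ι K).exists_eq_sum_smul_of_commute (Matrix.toLin' L) (by
    intro φ hφ
    obtain ⟨M, rfl⟩ := Matrix.toLin'.surjective φ
    suffices Commute L M from this.map (Matrix.toLinAlgEquiv' (R := K) (n := α → ι))
    have hM (σ : Perm α) (I J : α → ι) : M I J = M (I ∘ σ) (J ∘ σ) := by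
      have h1 := congrFun (LinearMap.congr_fun (hφ σ) (Pi.single (J ∘ σ) 1)) I
      have h2 : tensorPerm α ι K σ (Pi.single (J ∘ σ) 1) = Pi.single J 1 := by
        ext I'
        rw [tensorPerm_apply]
        by_cases h : I' = J
        · subst h; simp
        · rw [Pi.single_eq_of_ne h, Pi.single_eq_of_ne]
          exact fun h' => h (σ.surjective.injective_comp_right h')
      rw [Module.End.mul_apply, Module.End.mul_apply, h2, tensorPerm_apply] at h1
      simpa using h1
    have hsum : (Fintype.card (Perm α) : K) • M = ∑ I, ∑ J, M I J • symMatrix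
        (fun b => Matrix.single (I b) (J b) (1 : K)) := by
      have h1 (σ : Perm α) : M = ∑ I, ∑ J, M I J • Matrix.single (I ∘ σ) (J ∘ σ) (1 : K) := by
        conv_lhs => rw [Matrix.matrix_eq_sum_single M]
        refine (Fintype.sum_equiv (σ.symm.arrowCongr (Equiv.refl ι)) _ _ fun I => ?_).symm
        refine Fintype.sum_equiv (σ.symm.arrowCongr (Equiv.refl ι)) _ _ fun J => ?_
        rw [Matrix.smul_single, smul_eq_mul, mul_one, hM σ]
        rfl
      have h2 : (Fintype.card (Perm α) : K) • M = ∑ σ : Perm α, M := by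
        simp [Nat.cast_smul_eq_nsmul]
      rw [h2, Finset.sum_congr rfl fun σ _ => h1 σ, Finset.sum_comm]
      refine Finset.sum_congr rfl fun I _ => ?_
      rw [Finset.sum_comm]
      refine Finset.sum_congr rfl fun J _ => ?_
      rw [← Finset.smul_sum, symMatrix]
      congr 1
      refine Finset.sum_congr rfl fun σ _ => ?_
      exact (tensorMatrix_single _ _).symm
    have hc : (Fintype.card (Perm α) : K) ≠ 0 := Nat.cast_ne_zero.2 Fintype.card_ne_zero
    rw [← one_smul K M, ← inv_mul_cancel₀ hc, mul_smul, hsum]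
    exact (Commute.sum_right _ _ _ fun I _ => Commute.sum_right _ _ _ fun J _ =>
      (commute_symMatrix hL _).smul_right _).smul_right _)
  refine ⟨a, fun I J => ?_⟩
  have h := congrFun (LinearMap.congr_fun ha (Pi.single J 1)) I
  simpa [tensorPerm_apply, Pi.single_apply, eq_comm] using h
end

section
variable {α T K : Type*} [Fintype α] [DecidableEq α]

theorem exists_perm_comp_of_sum_single_eq {x y : α → T}
    (h : ∑ a, Finsupp.single (x a) 1 = ∑ a, Finsupp.single (y a) 1) :
    ∃ s : Perm α, y = x ∘ s := by
  classical
  have hcount (z : α → T) (t : T) : (∑ a, Finsupp.single (z a) 1 : T →₀ ℕ) t =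
      Fintype.card {a // z a = t} := by
    rw [Finsupp.finsetSum_apply, Fintype.card_subtype, Finset.card_filter]
    exact Finset.sum_congr rfl fun a _ => Finsupp.single_apply
  have hcard (t : T) : Nonempty ({a // y a = t} ≃ {a // x a = t}) := by
    rw [← Fintype.card_eq, ← hcount, ← hcount, h]
  let e (t : T) := (hcard t).some
  exact ⟨Equiv.ofFiberEquiv e, funext fun a => (Equiv.ofFiberEquiv_map e a).symm⟩

/-- A linear relation between monomials symmetrizes to a relation between multi-indices. -/
theorem sum_sum_ite_eq_zero_of_sum_prod_X_eq_zero [DecidableEq T] [Field K] {Ω : Type*} [Fintype Ω]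
    (b : Ω → K) (y : Ω → α → T)
    (h : ∑ ω, MvPolynomial.C (b ω) * ∏ a, (MvPolynomial.X (y ω a) : MvPolynomial T K) = 0)
    (x : α → T) : ∑ s : Perm α, ∑ ω, b ω * (if y ω = x ∘ s then 1 else 0) = 0 := by
  have hprod (z : α → T) : ∏ a, (MvPolynomial.X (z a) : MvPolynomial T K) =
      MvPolynomial.monomial (∑ a, Finsupp.single (z a) 1) 1 := by
    rw [MvPolynomial.monomial_sum_one]; rfl
  have hcount (z : α → T) : ∑ s : Perm α, (if z = x ∘ s then (1 : K) else 0) =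
      (∑ s : Perm α, if x = x ∘ s then (1 : K) else 0) *
        (MvPolynomial.coeff (∑ a, Finsupp.single (x a) 1)
          (∏ a, (MvPolynomial.X (z a) : MvPolynomial T K))) := by
    rw [hprod, MvPolynomial.coeff_monomial]
    split_ifs with hz
    · obtain ⟨s, rfl⟩ := exists_perm_comp_of_sum_single_eq hz.symm
      rw [mul_one]
      refine Fintype.sum_equiv (Equiv.mulRight s⁻¹) _ _ fun r => ?_
      congr 1
      rw [eq_iff_iff]
      constructor
      · intro h
        ext1 a
        simpa using congrFun h (s⁻¹ a)
      · intro h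
        ext1 a
        simpa using congrFun h (s a)
    · rw [mul_zero]
      refine Finset.sum_eq_zero fun s _ => if_neg ?_
      rintro rfl
      exact hz (Fintype.sum_equiv s _ _ fun _ => rfl)
  rw [Finset.sum_comm]
  rw [Finset.sum_congr rfl fun ω _ => (Finset.mul_sum _ _ (b ω)).symm.trans
    (congrArg (b ω * ·) (hcount (y ω)))]
  have := congrArg (MvPolynomial.coeff (∑ a, Finsupp.single (x a) 1)) h
  simp only [MvPolynomial.coeff_sum, MvPolynomial.coeff_C_mul, MvPolynomial.coeff_zero] at this
  refine Eq.trans ?_ ((congrArg ((∑ s : Perm α, if x = x ∘ s then (1 : K) else 0) * ·) this).trans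
    (mul_zero _))
  simp only [Finset.mul_sum]
  exact Finset.sum_congr rfl fun ω _ => mul_left_comm _ _ _
end

namespace MvPolynomial
variable {T K : Type*} [Field K]

/-- The iterated partial derivative. -/
noncomputable def iterPDeriv : (d : ℕ) → (Fin d → T) → MvPolynomial T K → MvPolynomial T K
  | 0, _, f => f
  | d + 1, x, f => iterPDeriv d (Fin.tail x) (pderiv (x 0) f)

theorem iterPDeriv_succ {d : ℕ} (x : Fin (d + 1) → T) (f : MvPolynomial T K) :
    iterPDeriv (d + 1) x f = iterPDeriv d (Fin.tail x) (pderiv (x 0) f) := by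
  rw [iterPDeriv]

/-- The iterated partial derivative as a linear map. -/
noncomputable def iterPDerivₗ (d : ℕ) (x : Fin d → T) : MvPolynomial T K →ₗ[K] MvPolynomial T K where
  toFun := iterPDeriv d x
  map_add' f g := by
    induction d generalizing f g with
    | zero => rfl
    | succ d ih => rw [iterPDeriv_succ, map_add, ih]; rfl
  map_smul' c f := by
    induction d generalizing f with
    | zero => rfl
    | succ d ih => rw [iterPDeriv_succ, Derivation.map_smul, ih]; rfl

theorem iterPDerivₗ_apply (d : ℕ) (x : Fin d → T) (f : MvPolynomial T K) :
    iterPDerivₗ d x f = iterPDeriv d x f := rfl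

theorem pderiv_comm (i j : T) (f : MvPolynomial T K) :
    pderiv i (pderiv j f) = pderiv j (pderiv i f) := by
  have : ⁅(pderiv i : Derivation K (MvPolynomial T K) (MvPolynomial T K)),
      (pderiv j : Derivation K (MvPolynomial T K) (MvPolynomial T K))⁆ = 0 := by
    classical
    refine derivation_ext fun k => ?_
    simp only [Derivation.commutator_apply, pderiv_X, Pi.single_apply, Derivation.zero_apply]
    split_ifs <;> simp
  simpa [Derivation.commutator_apply, sub_eq_zero] using congrArg (fun D => D f) this

variable {A : Type*} [Fintype A] (v : A ↪ T)

/-- Euler's identity for a homogeneous polynomial involving finitely many variables. -/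
theorem IsHomogeneous.sum_X_mul_pderiv_of_pderiv_eq_zero [CharZero K] {d : ℕ}
    {f : MvPolynomial T K} (hf : f.IsHomogeneous d) (h : ∀ i ∉ Set.range v, pderiv i f = 0) :
    ∑ i, X (v i) * pderiv (v i) f = d • f := by
  classical
  have key (i : T) (m : T →₀ ℕ) : coeff m (X i * pderiv i f) = m i * coeff m f := by
    rw [coeff_X_mul', coeff_pderiv]
    split_ifs with hi
    · have h1 : m - Finsupp.single i 1 + Finsupp.single i 1 = m :=
        tsub_add_cancel_of_le (Finsupp.single_le_iff.2
          (Nat.one_le_iff_ne_zero.2 (Finsupp.mem_support_iff.1 hi)))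
      rw [h1]
      have h2 := DFunLike.congr_fun h1 i
      rw [Finsupp.add_apply, Finsupp.single_eq_same] at h2
      rw [← h2]
      push_cast
      ring
    · rw [Finsupp.notMem_support_iff.1 hi, Nat.cast_zero, zero_mul]
  ext m
  rw [coeff_sum, coeff_smul]
  simp only [key, ← Finset.sum_mul]
  rw [nsmul_eq_mul]
  by_cases hm : coeff m f = 0
  · rw [hm, mul_zero, mul_zero]
  congr 1
  rw [← hf hm, ← Nat.cast_sum]
  congr 1
  have hsupp : m.support ⊆ Finset.univ.map v := by
    intro i hi
    by_contra hcon
    have := key i m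
    rw [h i (by simpa using hcon), mul_zero, coeff_zero, eq_comm, mul_eq_zero] at this
    exact this.elim (by simpa using hi) hm
  rw [Finsupp.weight_apply, Finsupp.sum_of_support_subset _ hsupp]
  · simp
  · simp

/-- Taylor's formula for a homogeneous polynomial involving finitely many variables. -/
theorem IsHomogeneous.factorial_smul_eq_sum [CharZero K] {d : ℕ} {f : MvPolynomial T K}
    (hf : f.IsHomogeneous d) (h : ∀ i ∉ Set.range v, pderiv i f = 0) :
    d.factorial • f =
      ∑ x : Fin d → A, C (constantCoeff (iterPDeriv d (v ∘ x) f)) * ∏ a, X (v (x a)) := by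
  induction d generalizing f with
  | zero =>
    rw [← totalDegree_zero_iff_isHomogeneous, totalDegree_eq_zero_iff_eq_C] at hf
    simp only [Nat.factorial_zero, one_smul, Finset.univ_unique, Finset.univ_eq_empty,
      Finset.prod_empty, mul_one, Finset.sum_singleton, iterPDeriv]
    exact hf
  | succ d ih =>
    have h1 (i : A) : d.factorial • pderiv (v i) f = _ :=
      ih hf.pderiv fun j hj => by rw [pderiv_comm, h j hj, map_zero]
    rw [Nat.factorial_succ, mul_comm, mul_smul, ← hf.sum_X_mul_pderiv_of_pderiv_eq_zero v h,
      Finset.smul_sum, ← (Fin.consEquiv fun _ => A).sum_comp, Fintype.sum_prod_type]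
    refine Finset.sum_congr rfl fun i _ => ?_
    rw [← mul_smul_comm, h1, Finset.mul_sum]
    refine Finset.sum_congr rfl fun x _ => ?_
    rw [Fin.prod_univ_succ]
    simp only [Fin.consEquiv_apply, iterPDeriv_succ, comp_apply, Fin.cons_zero, Fin.cons_succ]
    have h2 : Fin.tail (v ∘ (Fin.consEquiv fun _ => A) (i, x)) = v ∘ x := rfl
    rw [h2]
    ring
end MvPolynomial

section
variable {α ι K : Type*} [Fintype α] [DecidableEq α] [Fintype ι] [DecidableEq ι] [Field K]

theorem sum_tensorMatrix_mulSingle_mul (a : α) (E : Matrix ι ι K) (I : α → ι) (g : (α → ι) → K) :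
    ∑ J, tensorMatrix (Pi.mulSingle a E) I J * g J = ∑ q, E (I a) q * g (update I a q) := by
  symm
  refine Fintype.sum_of_injective (update I a) (update_injective I a) _ _ ?_ ?_
  · intro J hJ
    obtain ⟨b, hb, hJb⟩ : ∃ b, b ≠ a ∧ J b ≠ I b := by
      by_contra! h
      exact hJ ⟨J a, by ext1 b; by_cases hb : b = a
                        · subst hb; simp
                        · simp [hb, h b hb]⟩
    rw [tensorMatrix_apply, Finset.prod_eq_zero (Finset.mem_univ b), zero_mul]
    rw [Pi.mulSingle_eq_of_ne hb, Matrix.one_apply_ne hJb.symm]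
  · intro q
    congr 1
    rw [tensorMatrix_apply, Finset.prod_eq_single a]
    · simp
    · intro b _ hb
      simp [hb]
    · simp

theorem derivMatrix_transpose (E : Matrix ι ι K) :
    (derivMatrix α E).transpose = derivMatrix α E.transpose := by
  ext I J
  simp only [derivMatrix, Matrix.transpose_apply, Matrix.sum_apply, tensorMatrix_apply]
  refine Finset.sum_congr rfl fun a _ => Finset.prod_congr rfl fun b _ => ?_
  by_cases h : b = a
  · subst h; simp
  · simp [h, Matrix.one_apply, eq_comm]

theorem derivMatrix_mul_apply (E : Matrix ι ι K) (L : Matrix (α → ι) (α → ι) K) (J I : α → ι) :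
    (derivMatrix α E * L) J I = ∑ a, ∑ q, E (J a) q * L (update J a q) I := by
  rw [derivMatrix, Finset.sum_mul, Matrix.sum_apply]
  exact Finset.sum_congr rfl fun a _ => sum_tensorMatrix_mulSingle_mul a E J fun J => L J I

theorem mul_derivMatrix_apply (E : Matrix ι ι K) (L : Matrix (α → ι) (α → ι) K) (J I : α → ι) :
    (L * derivMatrix α E) J I = ∑ a, ∑ q, E q (I a) * L J (update I a q) := by
  rw [← Matrix.transpose_apply (L * _), Matrix.transpose_mul, derivMatrix_transpose,
    derivMatrix_mul_apply]
  rfl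
end

section
variable {F : Type*} [Field F] {n : ℕ}
open MvPolynomial

theorem Derivation.sum_apply {R A M κ : Type*} [CommSemiring R] [CommSemiring A] [AddCommMonoid M]
    [Algebra R A] [Module A M] [Module R M] (s : Finset κ) (D : κ → Derivation R A M) (a : A) :
    (∑ i ∈ s, D i) a = ∑ i ∈ s, D i a := by
  rw [← Derivation.coeFnAddMonoidHom_apply, map_sum, Finset.sum_apply]
  rfl

theorem Derivation.map_matrix_mul (D : Derivation F (CPoly F n) (CPoly F n))
    (A B : Matrix (Fin n) (Fin n) (CPoly F n)) :
    (A * B).map D = A.map D * B + A * B.map D := by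
  ext1 i j
  simp only [Matrix.map_apply, Matrix.mul_apply, Matrix.add_apply, map_sum, Derivation.leibniz,
    smul_eq_mul, ← Finset.sum_add_distrib]
  exact Finset.sum_congr rfl fun k _ => by ring

/-- A constant matrix, seen as a matrix of polynomials. -/
noncomputable abbrev constMat : Matrix (Fin n) (Fin n) F →+* Matrix (Fin n) (Fin n) (CPoly F n) :=
  (C : F →+* CPoly F n).mapMatrix

theorem constMat_apply (E : Matrix (Fin n) (Fin n) F) (i j : Fin n) :
    constMat E i j = C (E i j) := rfl

/-- The infinitesimal simultaneous conjugation of the generic matrices by `E`. -/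
noncomputable def adDeriv (E : Matrix (Fin n) (Fin n) F) : Derivation F (CPoly F n) (CPoly F n) :=
  mkDerivation F fun x => (genMat F n x.2.2 * constMat E - constMat E * genMat F n x.2.2) x.1 x.2.1

theorem adDeriv_X (E : Matrix (Fin n) (Fin n) F) (x : Fin n × Fin n × ℕ) : adDeriv E (X x) =
    (genMat F n x.2.2 * constMat E - constMat E * genMat F n x.2.2) x.1 x.2.1 :=
  mkDerivation_X _ _ _

theorem genMat_map_adDeriv (E : Matrix (Fin n) (Fin n) F) (k : ℕ) :
    (genMat F n k).map (adDeriv E) = genMat F n k * constMat E - constMat E * genMat F n k := by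
  ext1 i j
  exact adDeriv_X E (i, j, k)

theorem constMat_map_derivation (D : Derivation F (CPoly F n) (CPoly F n))
    (E : Matrix (Fin n) (Fin n) F) : (constMat E).map D = 0 := by
  ext1 i j
  exact D.map_algebraMap _

/-- Derivations that agree on the generic matrices are equal. -/
theorem Derivation.ext_genMat {D D' : Derivation F (CPoly F n) (CPoly F n)}
    (h : ∀ k, (genMat F n k).map D = (genMat F n k).map D') : D = D' :=
  derivation_ext fun x => congrFun (congrFun (h x.2.2) x.1) x.2.1

/-- `adDeriv` as a linear map in the matrix. -/
noncomputable def adDerivₗ (f : CPoly F n) : Matrix (Fin n) (Fin n) F →ₗ[F] CPoly F n where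
  toFun E := adDeriv E f
  map_add' E E' := by
    have : adDeriv (E + E') = adDeriv E + adDeriv E' := by
      refine derivation_ext fun x => ?_
      rw [Derivation.add_apply]
      simp only [adDeriv_X, map_add, mul_add, add_mul, Matrix.add_apply, Matrix.sub_apply]
      ring
    rw [this]; rfl
  map_smul' c E := by
    have : adDeriv (c • E) = c • adDeriv E := by
      refine derivation_ext fun x => ?_
      have h : constMat (c • E) = c • constMat E := by
        ext1 i j
        simp [smul_eq_C_mul]
      rw [Derivation.smul_apply]
      simp only [adDeriv_X, h, mul_smul_comm, smul_mul_assoc, ← smul_sub, Matrix.smul_apply]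
    rw [this]; rfl

theorem adDerivₗ_apply (f : CPoly F n) (E : Matrix (Fin n) (Fin n) F) :
    adDerivₗ f E = adDeriv E f := rfl

theorem adDeriv_one : adDeriv (1 : Matrix (Fin n) (Fin n) F) = 0 := by
  refine derivation_ext fun x => ?_
  rw [adDeriv_X, map_one, mul_one, one_mul, sub_self]
  rfl

theorem adDeriv_commutator (E E' : Matrix (Fin n) (Fin n) F) :
    adDeriv (E * E' - E' * E) = ⁅adDeriv E, adDeriv E'⁆ := by
  refine Derivation.ext_genMat fun k => ?_
  have h1 : (genMat F n k).map (⁅adDeriv E, adDeriv E'⁆ : Derivation F (CPoly F n) (CPoly F n)) =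
      ((genMat F n k).map (adDeriv E')).map (adDeriv E) -
      ((genMat F n k).map (adDeriv E)).map (adDeriv E') := by
    ext1 i j
    exact Derivation.commutator_apply ..
  have hsub (D : Derivation F (CPoly F n) (CPoly F n)) (A B : Matrix (Fin n) (Fin n) (CPoly F n)) :
      (A - B).map D = A.map D - B.map D := Matrix.map_sub D (fun a b => map_sub D a b) A B
  rw [h1]
  simp only [genMat_map_adDeriv, hsub, Derivation.map_matrix_mul, constMat_map_derivation, map_sub,
    map_mul]
  noncomm_ring

theorem constantCoeff_adDeriv (E : Matrix (Fin n) (Fin n) F) (f : CPoly F n) :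
    constantCoeff (adDeriv E f) = 0 := by
  induction f using MvPolynomial.induction_on with
  | C a => rw [derivation_C, map_zero]
  | add p q hp hq => rw [map_add, map_add, hp, hq, add_zero]
  | mul_X p x hp =>
    rw [Derivation.leibniz, map_add, smul_eq_mul, smul_eq_mul, map_mul, map_mul, hp, mul_zero,
      add_zero, adDeriv_X]
    simp [Matrix.mul_apply, genMat]

theorem pderiv_adDeriv (E : Matrix (Fin n) (Fin n) F) (x : Fin n × Fin n × ℕ) (f : CPoly F n) :
    pderiv x (adDeriv E f) = adDeriv E (pderiv x f) +
      (∑ q, E x.2.1 q • pderiv (x.1, q, x.2.2) f - ∑ p, E p x.1 • pderiv (p, x.2) f) := by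
  obtain ⟨a, b, k⟩ := x
  have h : ⁅(pderiv (a, b, k) : Derivation F (CPoly F n) (CPoly F n)), adDeriv E⁆ =
      ∑ q, E b q • (pderiv (a, q, k) : Derivation F (CPoly F n) (CPoly F n)) -
      ∑ p, E p a • (pderiv (p, b, k) : Derivation F (CPoly F n) (CPoly F n)) := by
    refine derivation_ext fun x => ?_
    obtain ⟨i, j, l⟩ := x
    have h0 : adDeriv E (pderiv (a, b, k) (X (i, j, l))) = 0 := by
      rw [pderiv_X, Pi.single_apply]
      split_ifs <;> simp
    rw [Derivation.commutator_apply, h0, sub_zero, adDeriv_X]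
    simp only [Matrix.sub_apply, Matrix.mul_apply, genMat, Matrix.of_apply, constMat_apply, map_sub,
      map_sum, Derivation.leibniz, derivation_C, smul_eq_mul,
      pderiv_X, Pi.single_apply, Derivation.sub_apply, Derivation.sum_apply,
      Derivation.smul_apply, Prod.mk.injEq]
    by_cases hi : i = a <;> by_cases hj : j = b <;> by_cases hl : l = k <;>
      simp [hi, hj, hl, smul_eq_C_mul]
  have h' := congrArg (fun D => D f) h
  simp only [Derivation.commutator_apply, Derivation.sub_apply, sub_eq_iff_eq_add'] at h'
  rw [h']
  simp only [Derivation.sum_apply, Derivation.smul_apply]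

theorem iterPDeriv_adDeriv (E : Matrix (Fin n) (Fin n) F) {d : ℕ} (x : Fin d → Fin n × Fin n × ℕ)
    (f : CPoly F n) :
    iterPDeriv d x (adDeriv E f) = adDeriv E (iterPDeriv d x f) + ∑ a,
      (∑ q, E (x a).2.1 q • iterPDeriv d (update x a ((x a).1, q, (x a).2.2)) f -
        ∑ p, E p (x a).1 • iterPDeriv d (update x a (p, (x a).2)) f) := by
  induction d generalizing f with
  | zero => simp [iterPDeriv]
  | succ d ih =>
    rw [Fin.sum_univ_succ]
    simp only [iterPDeriv_succ, Fin.tail_update_zero, Fin.tail_update_succ, update_self,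
      update_of_ne (Fin.succ_ne_zero _).symm]
    rw [pderiv_adDeriv, ← iterPDerivₗ_apply,
      map_add, map_sub, map_sum, map_sum]
    simp only [map_smul, iterPDerivₗ_apply]
    rw [ih]
    exact add_right_comm _ _ _ |>.trans (add_assoc _ _ _)

theorem adDeriv_isHomogeneous (E : Matrix (Fin n) (Fin n) F) {d : ℕ} {f : CPoly F n}
    (hf : f.IsHomogeneous d) : (adDeriv E f).IsHomogeneous d := by
  rw [f.as_sum, map_sum]
  refine IsHomogeneous.sum _ _ _ fun s hs => ?_
  rw [adDeriv, mkDerivation_monomial]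
  refine (homogeneousSubmodule _ F d).smul_mem _ ?_
  refine IsHomogeneous.sum _ _ _ fun i hi => ?_
  have hd : s.degree = d := by
    have := hf (mem_support_iff.1 hs)
    rwa [Finsupp.degree_eq_weight_one]
  have h1 : (s - Finsupp.single i 1) + Finsupp.single i 1 = s :=
    tsub_add_cancel_of_le (Finsupp.single_le_iff.2
      (Nat.one_le_iff_ne_zero.2 (Finsupp.mem_support_iff.1 hi)))
  have h2 : d = (s - Finsupp.single i 1).degree + 1 := by
    rw [← hd]
    conv_lhs => rw [← h1]
    rw [map_add, Finsupp.degree_single]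
  rw [h2]
  refine (isHomogeneous_monomial _ rfl).mul ?_
  simp only [Matrix.sub_apply, Matrix.mul_apply, genMat, Matrix.of_apply, constMat_apply]
  refine IsHomogeneous.sub (IsHomogeneous.sum _ _ _ fun q _ => ?_)
    (IsHomogeneous.sum _ _ _ fun q _ => ?_)
  · exact (isHomogeneous_X F _).mul (isHomogeneous_C _ _)
  · exact (isHomogeneous_C _ _).mul (isHomogeneous_X F _)

theorem adDeriv_homogeneousComponent (E : Matrix (Fin n) (Fin n) F) (d : ℕ) (f : CPoly F n) :
    adDeriv E (homogeneousComponent d f) = homogeneousComponent d (adDeriv E f) := by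
  conv_rhs => rw [← f.sum_homogeneousComponent, map_sum, map_sum]
  rw [Finset.sum_congr rfl fun i _ => homogeneousComponent_of_mem
    (adDeriv_isHomogeneous E (homogeneousComponent_isHomogeneous i f)), Finset.sum_ite_eq]
  split_ifs with h
  · rfl
  · rw [homogeneousComponent_eq_zero, map_zero]
    simpa using h

theorem pderiv_homogeneousComponent_eq_zero {x : Fin n × Fin n × ℕ} (d : ℕ) {f : CPoly F n}
    (h : x ∉ f.vars) : pderiv x (homogeneousComponent d f) = 0 := by
  refine pderiv_eq_zero_of_notMem_vars fun hx => h ?_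
  rw [mem_vars_iff_mem_support] at hx ⊢
  obtain ⟨s, hs, hxs⟩ := hx
  refine ⟨s, ?_, hxs⟩
  rw [mem_support_iff, coeff_homogeneousComponent] at hs
  rw [mem_support_iff]
  intro h0
  simp [h0] at hs
end

section
variable {F : Type*} [Field F] [CharZero F] {n : ℕ}
open MvPolynomial

theorem exists_constantCoeff_iterPDeriv_eq_sum {f : CPoly F n} (hf : ∀ E, adDeriv E f = 0) {d : ℕ}
    (c : Fin d → ℕ) : ∃ a : Perm (Fin d) → F, ∀ I J : Fin d → Fin n,
      constantCoeff (iterPDeriv d (fun b => (I b, J b, c b)) f) =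
        ∑ σ, a σ * (if I = J ∘ σ then 1 else 0) := by
  let L : Matrix (Fin d → Fin n) (Fin d → Fin n) F := Matrix.of fun J I =>
    constantCoeff (iterPDeriv d (fun b => (I b, J b, c b)) f)
  obtain ⟨a, ha⟩ := exists_eq_sum_of_commute_derivMatrix (L := L) fun E => by
    ext J I
    rw [mul_derivMatrix_apply, derivMatrix_mul_apply, eq_comm, ← sub_eq_zero,
      ← Finset.sum_sub_distrib]
    have h := congrArg constantCoeff (iterPDeriv_adDeriv E (fun b => (I b, J b, c b)) f)
    rw [hf E, map_add, constantCoeff_adDeriv, zero_add, ← iterPDerivₗ_apply, map_zero, map_zero] at h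
    refine Eq.trans ?_ h.symm
    rw [map_sum]
    refine Finset.sum_congr rfl fun a _ => ?_
    rw [map_sub, map_sum, map_sum]
    congr 1
    · refine Finset.sum_congr rfl fun q _ => ?_
      rw [constantCoeff_smul, smul_eq_mul]
      refine congrArg (fun y => _ * constantCoeff (iterPDeriv d y f)) (funext fun b => ?_)
      by_cases hb : b = a
      · subst hb; simp
      · simp [hb]
    · refine Finset.sum_congr rfl fun q _ => ?_
      rw [constantCoeff_smul, smul_eq_mul]
      refine congrArg (fun y => _ * constantCoeff (iterPDeriv d y f)) (funext fun b => ?_)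
      by_cases hb : b = a
      · subst hb; simp
      · simp [hb]
  exact ⟨a, fun I J => ha J I⟩

/-- The span of the trace monomials in the first `N` generic matrices. -/
noncomputable def traceSpan (F : Type*) [Field F] (n N : ℕ) : Submodule F (CPoly F n) :=
  Submodule.span F {g | ∃ (d : ℕ) (σ : Perm (Fin d)) (c : Fin d → Fin N),
    g = permTrace σ fun a => genMat F n (c a)}

/-- The inclusion of the indices of the entries of the first `N` generic matrices. -/
def genIndex (n N : ℕ) : Fin n × Fin n × Fin N ↪ Fin n × Fin n × ℕ :=
  (Embedding.refl _).prodMap ((Embedding.refl _).prodMap Fin.valEmbedding)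

theorem mem_traceSpan_of_isHomogeneous {f : CPoly F n} (hf : ∀ E, adDeriv E f = 0) {d N : ℕ}
    (hd : f.IsHomogeneous d) (hN : ∀ x ∉ Set.range (genIndex n N), pderiv x f = 0) :
    f ∈ traceSpan F n N := by
  suffices h : d.factorial • f ∈ traceSpan F n N by
    rw [← Nat.cast_smul_eq_nsmul F] at h
    exact ((traceSpan F n N).smul_mem_iff (Nat.cast_ne_zero.2 d.factorial_ne_zero)).1 h
  rw [hd.factorial_smul_eq_sum (genIndex n N) hN]
  let e : (Fin d → Fin n × Fin n × Fin N) ≃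
      (Fin d → Fin N) × (Fin d → Fin n) × (Fin d → Fin n) :=
    { toFun := fun x => (fun a => (x a).2.2, fun a => (x a).2.1, fun a => (x a).1)
      invFun := fun y a => (y.2.2 a, y.2.1 a, y.1 a)
      left_inv := fun _ => rfl
      right_inv := fun _ => rfl }
  rw [← e.symm.sum_comp, Fintype.sum_prod_type]
  refine Submodule.sum_mem _ fun c _ => ?_
  obtain ⟨a, ha⟩ := exists_constantCoeff_iterPDeriv_eq_sum hf fun b => (c b : ℕ)
  have key : ∑ y : (Fin d → Fin n) × (Fin d → Fin n),
      C (constantCoeff (iterPDeriv d (genIndex n N ∘ e.symm (c, y)) f)) *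
        ∏ b, X (genIndex n N (e.symm (c, y) b)) =
      ∑ σ : Perm (Fin d), a σ • permTrace σ⁻¹ fun b => genMat F n (c b) := by
    have h1 (y : (Fin d → Fin n) × (Fin d → Fin n)) :
        constantCoeff (iterPDeriv d (genIndex n N ∘ e.symm (c, y)) f) =
        ∑ σ, a σ * (if y.2 = y.1 ∘ σ then 1 else 0) := ha y.2 y.1
    simp only [h1, map_sum, Finset.sum_mul]
    rw [Finset.sum_comm]
    refine Finset.sum_congr rfl fun σ _ => ?_
    rw [Fintype.sum_prod_type, permTrace, Finset.smul_sum]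
    refine Fintype.sum_equiv (σ.symm.arrowCongr (Equiv.refl _)) _ _ fun J => ?_
    rw [Finset.sum_eq_single (J ∘ σ)]
    · rw [if_pos rfl, mul_one, smul_eq_C_mul]
      congr 1
      refine Finset.prod_congr rfl fun b _ => ?_
      simp [e, genIndex, genMat, Equiv.arrowCongr]
    · intro I _ hI
      simp [hI]
    · simp
  rw [key]
  exact Submodule.sum_mem _ fun σ _ => Submodule.smul_mem _ _ (Submodule.subset_span ⟨d, _, c, rfl⟩)

/-- The first fundamental theorem of matrix invariants. -/
theorem mem_traceSpan {f : CPoly F n} (hf : ∀ E, adDeriv E f = 0) {N : ℕ}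
    (hN : ∀ x ∈ f.vars, x.2.2 < N) : f ∈ traceSpan F n N := by
  rw [← f.sum_homogeneousComponent]
  refine Submodule.sum_mem _ fun d _ => mem_traceSpan_of_isHomogeneous (d := d) (fun E => ?_)
    (homogeneousComponent_isHomogeneous d f) fun x hx => pderiv_homogeneousComponent_eq_zero d fun h =>
      hx ⟨(x.1, x.2.1, ⟨x.2.2, hN x h⟩), rfl⟩
  rw [adDeriv_homogeneousComponent, hf, map_zero]
end

theorem exists_eq_mul_of_ne_zero {R κ : Type*} [CommRing R] [IsDomain R]
    [UniqueFactorizationMonoid R] [Fintype κ] (f : κ → R) (k : κ) (hf : f k ≠ 0) :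
    ∃ (d : R) (g : κ → R), (∀ i, f i = d * g i) ∧ g k ≠ 0 ∧
      ∀ a b, (∀ i, a ∣ b * g i) → a ∣ b := by
  classical
  let := UniqueFactorizationMonoid.strongNormalizationMonoid (α := R)
  let := UniqueFactorizationMonoid.toNormalizedGCDMonoid R
  obtain ⟨g, hg, hgcd⟩ := Finset.univ.extract_gcd f ⟨k, Finset.mem_univ k⟩
  refine ⟨_, g, fun i => hg i (Finset.mem_univ i), fun h => hf ?_, fun a b h => ?_⟩
  · rw [hg k (Finset.mem_univ k), h, mul_zero]
  · have := Finset.dvd_gcd (s := Finset.univ) (f := fun i => b * g i) fun i _ => h i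
    have h1 := this.trans (Finset.gcd_mul_left' ..).dvd
    rwa [hgcd, mul_one] at h1

section
variable {F : Type*} [Field F] [CharZero F] {n : ℕ}
open MvPolynomial

theorem monQ_nil (m : ℕ) : monQ F n m [] = 1 := rfl

theorem monQ_cons {m : ℕ} (k : Fin m) (w : List (Fin m)) :
    monQ F n m (k :: w) = FreeAlgebra.ι _ (k : ℕ) * monQ F n m w := rfl

theorem PhiQ_monQ_map_adDeriv (E : Matrix (Fin n) (Fin n) F) {m : ℕ} (w : List (Fin m)) :
    (PhiQ F n (monQ F n m w)).map (adDeriv E) =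
      PhiQ F n (monQ F n m w) * constMat E - constMat E * PhiQ F n (monQ F n m w) := by
  induction w with
  | nil =>
    rw [monQ_nil, map_one, one_mul, mul_one, sub_self]
    rw [← map_one (constMat (F := F) (n := n)), constMat_map_derivation]
  | cons k w ih =>
    rw [monQ_cons, map_mul, Derivation.map_matrix_mul, ih, PhiQ_ι, genMat_map_adDeriv]
    noncomm_ring

theorem totalDegree_adDeriv_le (E : Matrix (Fin n) (Fin n) F) (f : CPoly F n) :
    (adDeriv E f).totalDegree ≤ f.totalDegree := by
  conv_lhs => rw [← f.sum_homogeneousComponent, map_sum]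
  refine totalDegree_finsetSum_le fun d hd => ?_
  exact (adDeriv_isHomogeneous E (homogeneousComponent_isHomogeneous d f)).totalDegree_le.trans
    (Nat.lt_succ_iff.1 (Finset.mem_range.1 hd))

/-- A semi-invariant of simultaneous conjugation is an invariant. -/
theorem adDeriv_eq_zero_of_dvd {f : CPoly F n} (hf : ∀ E, f ∣ adDeriv E f)
    (E : Matrix (Fin n) (Fin n) F) : adDeriv E f = 0 := by
  have h1 (E : Matrix (Fin n) (Fin n) F) : ∃ c : F, adDeriv E f = c • f := by
    obtain ⟨g, hg⟩ := hf E
    by_cases h0 : adDeriv E f = 0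
    · exact ⟨0, by rw [h0, zero_smul]⟩
    have hfg : f ≠ 0 ∧ g ≠ 0 := mul_ne_zero_iff.1 (hg ▸ h0)
    have hdeg := totalDegree_adDeriv_le E f
    rw [hg, totalDegree_mul_of_isDomain hfg.1 hfg.2] at hdeg
    have hg0 := totalDegree_eq_zero_iff_eq_C.1 (show g.totalDegree = 0 by omega)
    exact ⟨_, by rw [hg, hg0, mul_comm, ← smul_eq_C_mul]⟩
  have h2 (E E' : Matrix (Fin n) (Fin n) F) : adDerivₗ f (E * E' - E' * E) = 0 := by
    obtain ⟨c, hc⟩ := h1 E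
    obtain ⟨c', hc'⟩ := h1 E'
    rw [adDerivₗ_apply, adDeriv_commutator, Derivation.commutator_apply, hc, hc',
      Derivation.map_smul, Derivation.map_smul, hc, hc', smul_comm, sub_self]
  have h3 (i j : Fin n) (r : F) : adDerivₗ f (Matrix.single i j r) = 0 := by
    by_cases hij : i = j
    · subst hij
      have h4 (j : Fin n) : adDerivₗ f (Matrix.single i i r) = adDerivₗ f (Matrix.single j j r) := by
        have := h2 (Matrix.single i j r) (Matrix.single j i 1)
        rwa [Matrix.single_mul_single_same, Matrix.single_mul_single_same, mul_one, one_mul,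
          map_sub, sub_eq_zero] at this
      have h5 : ∑ j : Fin n, Matrix.single j j r = r • (1 : Matrix (Fin n) (Fin n) F) := by
        ext a b
        rw [Matrix.sum_apply, Finset.sum_eq_single a]
        · simp [Matrix.single_apply, Matrix.one_apply]
        · intro c _ hc
          simp [hc]
        · simp
      have h6 := congrArg (adDerivₗ f) h5
      rw [map_sum, ← Finset.sum_congr rfl fun j _ => h4 j, map_smul, adDerivₗ_apply f 1, adDeriv_one,
        Derivation.zero_apply, smul_zero, Finset.sum_const, Finset.card_univ, Fintype.card_fin,
        ← Nat.cast_smul_eq_nsmul F, smul_eq_zero] at h6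
      refine h6.resolve_left (Nat.cast_ne_zero.2 ?_)
      rintro rfl
      exact i.elim0
    · have := h2 (Matrix.single i j r) (Matrix.single j j 1)
      rwa [Matrix.single_mul_single_same, Matrix.single_mul_single_of_ne _ _ _ _ (Ne.symm hij),
        mul_one, sub_zero] at this
  rw [← adDerivₗ_apply, Matrix.matrix_eq_sum_single E, map_sum]
  exact Finset.sum_eq_zero fun i _ => by rw [map_sum]; exact Finset.sum_eq_zero fun j _ => h3 i j _

theorem linearIndependent_PhiQ_monQ {m t : ℕ} {w : Fin t → List (Fin m)}
    (h : ¬ MLocallyLinDep F n m t fun i => monF F (w i)) :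
    LinearIndependent (CPoly F n) fun i => PhiQ F n (monQ F n m (w i)) := by
  rw [MLocallyLinDep] at h
  push Not at h
  obtain ⟨A, hA⟩ := h
  refine linearIndependent_PhiQ _ (fun k => if hk : k < m then A ⟨k, hk⟩ else 0) ?_
  convert hA using 2 with i
  induction w i with
  | nil => rw [monQ_nil, map_one]; exact (map_one _).symm
  | cons k w ih =>
    have h : monF F (k :: w) = FreeAlgebra.ι F k * monF F w := List.prod_cons
    rw [monQ_cons, map_mul, ih, h, map_mul]
    congr 1
    ext a b
    simp [evalQ_apply, PhiQ_ι, genMat, evalC, evalNCFin]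

/-- The coefficients of a primitive relation between monomials are invariants. -/
theorem adDeriv_eq_zero_of_primitive {m : ℕ} {κ : Type*} [Fintype κ] {w₀ : List (Fin m)}
    {w : κ → List (Fin m)}
    (hw : LinearIndependent (CPoly F n) fun i => PhiQ F n (monQ F n m (w i)))
    {α₀ : CPoly F n} {α : κ → CPoly F n} (h0 : α₀ ≠ 0)
    (h : α₀ • PhiQ F n (monQ F n m w₀) + ∑ i, α i • PhiQ F n (monQ F n m (w i)) = 0)
    (hα : ∀ a b, a ∣ b * α₀ → (∀ i, a ∣ b * α i) → a ∣ b) (E : Matrix (Fin n) (Fin n) F) :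
    adDeriv E α₀ = 0 ∧ ∀ i, adDeriv E (α i) = 0 := by
  have h1 (E : Matrix (Fin n) (Fin n) F) : adDeriv E α₀ • PhiQ F n (monQ F n m w₀) +
      ∑ i, adDeriv E (α i) • PhiQ F n (monQ F n m (w i)) = 0 := by
    have hsmul (a : CPoly F n) (w : List (Fin m)) : (a • PhiQ F n (monQ F n m w)).map (adDeriv E) =
        adDeriv E a • PhiQ F n (monQ F n m w) + ((a • PhiQ F n (monQ F n m w)) * constMat E -
          constMat E * (a • PhiQ F n (monQ F n m w))) := by
      rw [smul_mul_assoc, mul_smul_comm, ← smul_sub, ← PhiQ_monQ_map_adDeriv]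
      ext1 i j
      simp only [Matrix.map_apply, Matrix.smul_apply, Matrix.add_apply, Derivation.leibniz,
        smul_eq_mul]
      ring
    have hadd (A B : Matrix (Fin n) (Fin n) (CPoly F n)) : (A + B).map (adDeriv E) =
      A.map (adDeriv E) + B.map (adDeriv E) := Matrix.map_add _ (map_add _) _ _
    have hsum (f : κ → Matrix (Fin n) (Fin n) (CPoly F n)) : (∑ i, f i).map (adDeriv E) =
        ∑ i, (f i).map (adDeriv E) := by
      ext1 i j
      simp [Matrix.sum_apply]
    have hD := congrArg (fun M => M.map (adDeriv E)) h
    simp only [hadd, hsum, hsmul, Finset.sum_add_distrib, Finset.sum_sub_distrib, ← Finset.sum_mul,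
      ← Finset.mul_sum] at hD
    rw [Matrix.map_zero _ (map_zero _), add_add_add_comm] at hD
    rw [← hD, left_eq_add]
    rw [sub_add_sub_comm, ← add_mul, ← mul_add, h, zero_mul, mul_zero, sub_zero]
  have h2 (E : Matrix (Fin n) (Fin n) F) (i : κ) : α₀ * adDeriv E (α i) = adDeriv E α₀ * α i := by
    refine sub_eq_zero.1 (Fintype.linearIndependent_iff.1 hw
      (fun i => α₀ * adDeriv E (α i) - adDeriv E α₀ * α i) ?_ i)
    have h3 := congrArg₂ (· - ·) (congrArg (α₀ • ·) (h1 E)) (congrArg (adDeriv E α₀ • ·) h)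
    simp only [smul_add, Finset.smul_sum, smul_smul, smul_zero, sub_zero, mul_comm (adDeriv E α₀) α₀,
      add_sub_add_left_eq_sub] at h3
    simpa only [sub_smul, Finset.sum_sub_distrib] using h3
  have h4 : adDeriv E α₀ = 0 := adDeriv_eq_zero_of_dvd (fun E => hα _ _ (dvd_mul_left _ _) fun i =>
    ⟨_, (h2 E i).symm⟩) E
  refine ⟨h4, fun i => ?_⟩
  have := h2 E i
  rw [h4, zero_mul, mul_eq_zero] at this
  exact this.resolve_left h0
end

/-- The nonzero elements of `Fin (e + 1)`. -/
def succList (e : ℕ) : List (Fin (e + 1)) := (List.finRange e).map Fin.succ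

theorem nodup_succList (e : ℕ) : (succList e).Nodup :=
  (List.nodup_finRange e).map (Fin.succ_injective e)

theorem mem_succList {e : ℕ} {x : Fin (e + 1)} : x ∈ succList e ↔ x ≠ 0 := by
  simp only [succList, List.mem_map, List.mem_finRange, true_and]
  exact Fin.exists_succ_eq

theorem length_succList (e : ℕ) : (succList e).length = e := by
  simp [succList]

section
variable {F : Type*} [Field F] [CharZero F] {n N : ℕ}
open MvPolynomial

variable (F n N) in
/-- The variable with a given index, or `1` for the last index. -/
noncomputable def letter (k : Fin (N + 1)) : QPoly F n :=
  if k = Fin.last N then 1 else FreeAlgebra.ι _ (k : ℕ)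

theorem letter_last : letter F n N (Fin.last N) = 1 := if_pos rfl

theorem letter_castSucc (k : Fin N) : letter F n N k.castSucc = FreeAlgebra.ι _ (k : ℕ) :=
  if_neg k.castSucc_lt_last.ne

theorem PhiQ_letter {k : Fin (N + 1)} (hk : k ≠ Fin.last N) :
    PhiQ F n (letter F n N k) = genMat F n k := by
  rw [letter, if_neg hk, PhiQ_ι]

/-- The index sequences in which the last index marks exactly the base point. -/
def IsRooted {e : ℕ} (c : Fin (e + 1) → Fin (N + 1)) : Prop := ∀ a, c a = Fin.last N ↔ a = 0

/-- The trace monomial with values in quasi-polynomials attached to a permutation. -/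
noncomputable def traceMon {e : ℕ} (σ : Perm (Fin (e + 1))) (c : Fin (e + 1) → Fin (N + 1)) :
    QPoly F n :=
  elimCycles (formalTrace F n) 0 (succList e) σ (letter F n N ∘ c)

theorem update_letter_zero {e : ℕ} {c : Fin (e + 1) → Fin (N + 1)} (hc : IsRooted c) :
    update (letter F n N ∘ c) 0 1 = letter F n N ∘ c := by
  rw [update_eq_self_iff, comp_apply, (hc 0).2 rfl, letter_last]

theorem traceMon_conj {e : ℕ} (σ s : Perm (Fin (e + 1))) (hs : s 0 = 0)
    (c : Fin (e + 1) → Fin (N + 1)) :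
    (traceMon (s * σ * s⁻¹) c : QPoly F n) = traceMon σ (c ∘ s) := by
  have h := elimCycles_map (t := formalTrace F n) s.toEmbedding 0 (succList e) σ (s * σ * s⁻¹)
    (by simp) (letter F n N ∘ c)
  refine Eq.trans ?_ h
  rw [show s.toEmbedding 0 = 0 from hs]
  refine elimCycles_perm isFormalTrace_formalTrace 0 ?_ (nodup_succList e) _ _
  rw [List.perm_ext_iff_of_nodup (nodup_succList e) ((nodup_succList e).map s.toEmbedding.injective)]
  intro x
  simp only [List.mem_map, mem_succList, Equiv.coe_toEmbedding]
  constructor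
  · intro hx
    refine ⟨s⁻¹ x, fun h => hx ?_, by simp⟩
    rw [← hs, ← h]; simp
  · rintro ⟨y, hy, rfl⟩ h
    exact hy (s.injective (h.trans hs.symm))

/-- Taking traces against an additional generic matrix. -/
noncomputable def markedTrace (F : Type*) [Field F] (n N : ℕ) : QPoly F n →ₗ[F] CPoly F n where
  toFun q := (genMat F n N * PhiQ F n q).trace
  map_add' p q := by rw [map_add, mul_add, Matrix.trace_add]
  map_smul' a q := by
    rw [← algebraMap_smul (CPoly F n) a q, map_smul, mul_smul_comm, Matrix.trace_smul,
      algebraMap_smul, RingHom.id_apply]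

theorem markedTrace_apply (q : QPoly F n) :
    markedTrace F n N q = (genMat F n N * PhiQ F n q).trace := rfl

theorem markedTrace_traceMon (hn : n ≠ 0) {e : ℕ} (σ : Perm (Fin (e + 1)))
    {c : Fin (e + 1) → Fin (N + 1)} (hc : IsRooted c) :
    markedTrace F n N (traceMon σ c) = permTrace σ fun a => genMat F n (c a) := by
  have h0 : (0 : Fin (e + 1)) ∉ succList e := by simp [mem_succList]
  have h := permTrace_eq_trace_elimCycles (nodup_succList e) h0 (σ := σ)
    (G := fun a => genMat F n (c a)) (fun x hx hx0 => absurd (mem_succList.2 hx0) hx)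
    (fun x hx hx0 => absurd (mem_succList.2 hx0) hx)
  rw [length_succList, Fintype.card_fin, Fintype.card_fin, Nat.add_sub_cancel] at h
  have h1 := mul_left_cancel₀ (pow_ne_zero _ (Nat.cast_ne_zero.2 hn)) h
  rw [h1]
  have hG : (fun a => genMat F n (c a)) =
      update (fun a => PhiQ F n (letter F n N (c a))) 0 (genMat F n N * 1) := by
    ext1 a
    by_cases ha : a = 0
    · subst ha
      simp [(hc 0).2 rfl]
    · rw [update_of_ne ha, PhiQ_letter fun h => ha ((hc a).1 h)]
  have hG' : update (fun a => PhiQ F n (letter F n N (c a))) 0 1 =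
      fun a => PhiQ F n (letter F n N (c a)) := by
    rw [update_eq_self_iff, (hc 0).2 rfl, letter_last, map_one]
  rw [hG, elimCycles_update_mul_left isFormalTrace_scalarTrace h0, hG', markedTrace_apply, traceMon]
  let g : QPoly F n →+* Matrix (Fin n) (Fin n) (CPoly F n) := (PhiQ F n).toRingHom
  have := map_elimCycles g (t := formalTrace F n) (t' := scalarTrace (Fin n) (CPoly F n))
    PhiQ_formalTrace 0 (succList e) σ (letter F n N ∘ c)
  exact congrArg (fun M => (genMat F n N * M).trace) this

theorem trace_genMat_ne_zero (hn : n ≠ 0) (k : ℕ) : (genMat F n k).trace ≠ 0 := by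
  intro h
  have := congrArg (MvPolynomial.eval fun _ => (1 : F)) h
  simp [Matrix.trace, genMat] at this
  exact hn this

theorem isRooted_cons {d : ℕ} (c : Fin d → Fin N) :
    IsRooted (Fin.cons (Fin.last N) (Fin.castSucc ∘ c) : Fin (d + 1) → Fin (N + 1)) := by
  intro a
  refine Fin.cases ?_ (fun a => ?_) a
  · simp
  · simp [Fin.castSucc_ne_last]

/-- A scalar trace monomial is a trace monomial with empty root. -/
theorem algebraMap_permTrace (hn : n ≠ 0) {d : ℕ} (σ : Perm (Fin d)) (c : Fin d → Fin N) :
    algebraMap (CPoly F n) (QPoly F n) (permTrace σ fun a => genMat F n (c a)) =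
      traceMon (Perm.decomposeFin.symm (0, σ)) (Fin.cons (Fin.last N) (Fin.castSucc ∘ c)) := by
  set σ' : Perm (Fin (d + 1)) := Perm.decomposeFin.symm (0, σ) with hσ'
  set c' : Fin (d + 1) → Fin (N + 1) := Fin.cons (Fin.last N) (Fin.castSucc ∘ c) with hc'
  have hc : IsRooted c' := isRooted_cons c
  obtain ⟨g, hg⟩ := exists_elimCycles_eq_algebraMap (C := CPoly F n) (t := formalTrace F n)
    (fun q => ⟨_, formalTrace_apply q⟩) (p := 0) (l := succList d) (by simp [mem_succList])
    (σ := σ') (by simp [hσ']) (H := letter F n N ∘ c') (by simp [hc', letter_last])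
  have h1 : traceMon σ' c' = algebraMap (CPoly F n) (QPoly F n) g := hg
  rw [h1]
  congr 1
  have h2 := markedTrace_traceMon (F := F) hn σ' hc
  rw [h1, markedTrace_apply, AlgHom.commutes, Algebra.algebraMap_eq_smul_one, mul_smul_comm, mul_one,
    Matrix.trace_smul, smul_eq_mul, mul_comm] at h2
  refine mul_left_cancel₀ (trace_genMat_ne_zero hn N) (Eq.trans ?_ h2.symm)
  rw [permTrace, permTrace, ← (Fin.consEquiv fun _ => Fin n).sum_comp, Fintype.sum_prod_type,
    Matrix.trace, Finset.sum_mul]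
  refine Finset.sum_congr rfl fun i _ => ?_
  rw [Finset.mul_sum]
  refine Finset.sum_congr rfl fun I _ => ?_
  rw [Fin.prod_univ_succ]
  simp [hσ', hc', Perm.decomposeFin_symm_apply_succ]

theorem letter_mul_traceMon {e : ℕ} (σ : Perm (Fin (e + 1))) {c : Fin (e + 1) → Fin (N + 1)}
    (hc : IsRooted c) (k : Fin N) :
    ∃ (σ' : Perm (Fin (e + 2))) (c' : Fin (e + 2) → Fin (N + 1)), IsRooted c' ∧
      FreeAlgebra.ι _ (k : ℕ) * traceMon σ c = (traceMon σ' c' : QPoly F n) := by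
  let ε : Fin (e + 1) ↪ Fin (e + 2) := Fin.castSuccEmb
  have hlast : Fin.last (e + 1) ∉ Set.range ε := by
    rintro ⟨x, hx⟩
    exact x.castSucc_lt_last.ne hx
  have hl0 : (0 : Fin (e + 2)) ≠ Fin.last (e + 1) := (Fin.last_pos).ne
  let c' : Fin (e + 2) → Fin (N + 1) := Fin.snoc (α := fun _ => Fin (N + 1)) c k.castSucc
  refine ⟨σ.viaEmbedding ε * swap 0 (Fin.last (e + 1)), c', ?_, ?_⟩
  · intro a
    refine Fin.lastCases ?_ (fun a => ?_) a
    · simp [c', k.castSucc_lt_last.ne, hl0.symm]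
    · simp only [c', Fin.snoc_castSucc, hc a]
      exact (Fin.castSucc_inj (a := a) (b := 0)).symm
  symm
  have hperm : (succList (e + 1)).Perm (Fin.last (e + 1) :: (succList e).map ε) := by
    have hnd : (Fin.last (e + 1) :: (succList e).map ε).Nodup := by
      refine List.nodup_cons.2 ⟨fun h => ?_, (nodup_succList e).map ε.injective⟩
      obtain ⟨x, -, hx⟩ := List.mem_map.1 h
      exact hlast ⟨x, hx⟩
    rw [List.perm_ext_iff_of_nodup (nodup_succList _) hnd]
    intro x
    refine Fin.lastCases ?_ (fun a => ?_) x
    · simp [mem_succList, hl0.symm]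
    · have : ∀ y, ε y = a.castSucc ↔ y = a := fun y => Fin.castSucc_inj
      simp only [mem_succList, List.mem_cons, a.castSucc_lt_last.ne, false_or, List.mem_map, this,
        exists_eq_right]
      exact not_congr (Fin.castSucc_inj (a := a) (b := 0))
  have happly : (σ.viaEmbedding ε * swap 0 (Fin.last (e + 1))) 0 = Fin.last (e + 1) := by
    rw [Perm.mul_apply, swap_apply_left, Perm.viaEmbedding_apply_of_notMem _ _ _ hlast]
  rw [traceMon, elimCycles_perm isFormalTrace_formalTrace 0 hperm (nodup_succList _),
    elimCycles_cons_of_apply_eq happly hl0, mul_assoc, swap_mul_self, mul_one]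
  have h := elimCycles_map (t := formalTrace F n) ε 0 (succList e) σ (σ.viaEmbedding ε)
    (fun b => Perm.viaEmbedding_apply ..)
    (update (update (letter F n N ∘ c') 0 ((letter F n N ∘ c') 0 *
      (letter F n N ∘ c') (Fin.last (e + 1)))) (Fin.last (e + 1)) 1)
  refine Eq.trans h ?_
  have hH : (update (update (letter F n N ∘ c') 0 ((letter F n N ∘ c') 0 *
      (letter F n N ∘ c') (Fin.last (e + 1)))) (Fin.last (e + 1)) 1) ∘ ε =
      update (letter F n N ∘ c) 0 (FreeAlgebra.ι _ (k : ℕ) * 1) := by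
    have h1 : letter F n N (c 0) = 1 := by rw [(hc 0).2 rfl, letter_last]
    have h2 : c' 0 = c 0 := Fin.snoc_castSucc (α := fun _ => Fin (N + 1)) k.castSucc c 0
    ext1 a
    have h3 : c' (ε a) = c a := Fin.snoc_castSucc (α := fun _ => Fin (N + 1)) k.castSucc c a
    have h4 : ε a ≠ Fin.last (e + 1) := fun h => hlast ⟨a, h⟩
    have h5 : c' (Fin.last (e + 1)) = k.castSucc := Fin.snoc_last (α := fun _ => Fin (N + 1)) _ _
    rw [comp_apply, update_of_ne h4]
    by_cases ha : a = 0
    · subst ha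
      rw [show ε 0 = 0 from rfl, update_self, update_self, comp_apply, comp_apply, h2, h5, h1,
        one_mul, mul_one, letter_castSucc]
    · have h6 : ε a ≠ 0 := fun h => ha (ε.injective h)
      rw [update_of_ne ha, update_of_ne h6, comp_apply, comp_apply, h3]
  rw [hH, elimCycles_update_mul_left isFormalTrace_formalTrace (by simp [mem_succList]),
    update_letter_zero hc]
  rfl
end

instance {N e : ℕ} : DecidablePred (IsRooted (N := N) (e := e)) := fun _ =>
  inferInstanceAs (Decidable (∀ _, _))

/-- The index set of the trace monomials of a given degree. -/
abbrev TraceIndex (N e : ℕ) := Perm (Fin (e + 1)) × {c : Fin (e + 1) → Fin (N + 1) // IsRooted c}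

section
variable {F : Type*} [Field F] [CharZero F] {n N e : ℕ}

/-- The second fundamental theorem, in the form that a combination of trace monomials whose
coefficients kill all the matrix contractions lies in the T-ideal. -/
theorem sum_smul_traceMon_mem {I : Set (QPoly F n)} (hI : IsTIdeal F n I) (hq : chQ F n ∈ I)
    (hn : n ≠ 0) (d : Fin (e + 1) → Fin (N + 1)) {a : Perm (Fin (e + 1)) → F}
    (ha : a ∈ antisymSpan n (e + 1) F) : ∑ τ, a τ • (traceMon τ d : QPoly F n) ∈ hI.toIdeal := by
  let L : (Perm (Fin (e + 1)) → F) →ₗ[F] QPoly F n :=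
    Fintype.linearCombination F fun τ => (traceMon τ d : QPoly F n)
  have hL (v : Perm (Fin (e + 1)) → F) : L v = ∑ τ, v τ • (traceMon τ d : QPoly F n) :=
    Fintype.linearCombination_apply ..
  have h : antisymSpan n (e + 1) F ≤ (hI.toIdeal.restrictScalars F).comap L := by
    refine Submodule.span_le.2 ?_
    rintro _ ⟨f, σ, rfl⟩
    rw [SetLike.mem_coe, Submodule.mem_comap, Submodule.restrictScalars_mem, map_sum]
    have := sum_sign_elimCycles_mem hI hq hn (Fintype.card_fin (n + 1)) f 0 (nodup_succList e)
      (fun _ => mem_succList) σ (letter F n N ∘ d)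
    convert this using 2 with π
    rw [map_zsmul, Fintype.linearCombination_apply_single, one_smul]
    rfl
  rw [← hL]
  exact h ha

/-- The coefficients at the trace monomials with a given index sequence, after symmetrization. -/
noncomputable def symmCoeff (a : TraceIndex N e → F) (d : Fin (e + 1) → Fin (N + 1)) :
    Perm (Fin (e + 1)) → F :=
  ∑ s : Perm (Fin (e + 1)), ∑ p : TraceIndex N e,
    Pi.single (s * p.1 * s⁻¹) (if p.2.1 = d ∘ s then a p else 0)

theorem sum_prod_X_eq_zero (hn : n ≠ 0) (a : TraceIndex N e → F)
    (h : markedTrace F n N (∑ p, a p • traceMon p.1 p.2.1) = 0) :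
    ∑ ω : TraceIndex N e × (Fin (e + 1) → Fin n), MvPolynomial.C (a ω.1) * ∏ b, (MvPolynomial.X
      (ω.2 b, ω.2 (ω.1.1 b), (ω.1.2.1 b : ℕ)) : CPoly F n) = 0 := by
  rw [← h, map_sum, Fintype.sum_prod_type]
  refine Finset.sum_congr rfl fun p _ => ?_
  rw [map_smul, markedTrace_traceMon hn _ p.2.2, permTrace, MvPolynomial.smul_eq_C_mul,
    Finset.mul_sum]
  rfl

theorem slots_eq_comp_iff (K J I : Fin (e + 1) → Fin n) (d c : Fin (e + 1) → Fin (N + 1))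
    (σ s : Perm (Fin (e + 1))) :
    ((fun b => (I b, I (σ b), (c b : ℕ))) = (fun b => (K b, J b, (d b : ℕ))) ∘ s) ↔
      I = K ∘ s ∧ J = K ∘ (s * σ * s⁻¹ : Perm _) ∧ c = d ∘ s := by
  constructor
  · intro h
    simp only [funext_iff, comp_apply, Prod.mk.injEq, Fin.val_inj] at h
    refine ⟨funext fun b => (h b).1, funext fun b => ?_, funext fun b => (h b).2.2⟩
    have := (h (s⁻¹ b)).2.1
    rw [(h _).1, show s (s⁻¹ b) = b from s.apply_symm_apply b] at this
    exact this.symm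
  · rintro ⟨rfl, rfl, rfl⟩
    ext1 b
    simp

theorem symmCoeff_mem_antisymSpan (hn : n ≠ 0) (a : TraceIndex N e → F)
    (h : markedTrace F n N (∑ p, a p • traceMon p.1 p.2.1) = 0) (d : Fin (e + 1) → Fin (N + 1)) :
    symmCoeff a d ∈ antisymSpan n (e + 1) F := by
  refine mem_antisymSpan fun K J => ?_
  have h3 := sum_sum_ite_eq_zero_of_sum_prod_X_eq_zero (K := F) (T := Fin n × Fin n × ℕ)
    (Ω := TraceIndex N e × (Fin (e + 1) → Fin n)) (fun ω => a ω.1)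
    (fun ω b => (ω.2 b, ω.2 (ω.1.1 b), (ω.1.2.1 b : ℕ)))
    (by convert sum_prod_X_eq_zero hn a h using 1) fun b => (K b, J b, (d b : ℕ))
  refine Eq.trans ?_ h3
  simp only [symmCoeff, Finset.sum_apply, Finset.sum_mul]
  rw [Finset.sum_comm]
  refine Finset.sum_congr rfl fun s _ => ?_
  rw [Finset.sum_comm]
  refine Eq.trans ?_ (Fintype.sum_prod_type _).symm
  refine Finset.sum_congr rfl fun p _ => ?_
  simp only [slots_eq_comp_iff]
  rw [Finset.sum_eq_single (s * p.1 * s⁻¹), Finset.sum_eq_single (K ∘ s), Pi.single_eq_same]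
  · by_cases hd : p.2.1 = d ∘ s
    · by_cases hJ : J = K ∘ (s * p.1 * s⁻¹ : Perm _)
      · rw [if_pos hd, if_pos hJ, if_pos ⟨rfl, hJ, hd⟩]
      · rw [if_neg hJ, mul_zero, if_neg fun h => hJ h.2.1, mul_zero]
    · rw [if_neg hd, zero_mul, if_neg fun h => hd h.2.2, mul_zero]
  · intro I' _ hI'
    rw [if_neg fun h => hI' h.1, mul_zero]
  · simp
  · intro τ _ hτ
    rw [Pi.single_eq_of_ne hτ, zero_mul]
  · simp

theorem sum_symmCoeff_smul (a : TraceIndex N e → F)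
    (d : {c : Fin (e + 1) → Fin (N + 1) // IsRooted c}) :
    ∑ τ, symmCoeff a d.1 τ • (traceMon τ d.1 : QPoly F n) =
      ∑ s : Perm (Fin (e + 1)), ∑ p : TraceIndex N e,
        if p.2.1 = d.1 ∘ s then a p • (traceMon p.1 p.2.1 : QPoly F n) else 0 := by
  simp only [symmCoeff, Finset.sum_apply, Finset.sum_smul]
  rw [Finset.sum_comm]
  refine Finset.sum_congr rfl fun s _ => ?_
  rw [Finset.sum_comm]
  refine Finset.sum_congr rfl fun p _ => ?_
  rw [Finset.sum_eq_single (s * p.1 * s⁻¹), Pi.single_eq_same]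
  · split_ifs with hd
    · have hs : s 0 = 0 := by
        rw [← d.2, ← comp_apply (f := d.1), ← hd, p.2.2]
      rw [traceMon_conj _ _ hs, hd]
    · rw [zero_smul]
  · intro τ _ hτ
    rw [Pi.single_eq_of_ne hτ, zero_smul]
  · simp

theorem sum_smul_traceMon_mem_of_markedTrace_eq_zero {I : Set (QPoly F n)} (hI : IsTIdeal F n I)
    (hq : chQ F n ∈ I) (hn : n ≠ 0) (a : TraceIndex N e → F)
    (h : markedTrace F n N (∑ p, a p • traceMon p.1 p.2.1) = 0) :
    ∑ p, a p • (traceMon p.1 p.2.1 : QPoly F n) ∈ hI.toIdeal := by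
  have h3 : ∑ d : {c : Fin (e + 1) → Fin (N + 1) // IsRooted c}, _ ∈ hI.toIdeal :=
    Submodule.sum_mem _ fun d _ => sum_smul_traceMon_mem hI hq hn d.1
      (symmCoeff_mem_antisymSpan hn a h d.1)
  refine hI.mem_of_natCast_smul_mem
    (k := (Finset.univ.filter fun s : Perm (Fin (e + 1)) => s 0 = 0).card)
    (Finset.card_ne_zero.2 ⟨1, by simp⟩) ?_
  convert h3 using 1
  rw [Finset.sum_congr rfl fun d _ => sum_symmCoeff_smul a d, Finset.sum_comm, Finset.card_eq_sum_ones,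
    Finset.sum_smul, Finset.sum_filter]
  refine Finset.sum_congr rfl fun s _ => ?_
  rw [Finset.sum_comm]
  split_ifs with hs
  · rw [one_smul]
    refine Finset.sum_congr rfl fun p _ => ?_
    have hr : IsRooted (p.2.1 ∘ ⇑s⁻¹) := fun b => by
      rw [comp_apply, p.2.2, Perm.inv_eq_iff_eq, hs, eq_comm]
    rw [Finset.sum_eq_single ⟨p.2.1 ∘ ⇑s⁻¹, hr⟩, if_pos]
    · ext1 b
      simp
    · intro d _ hd
      refine if_neg fun h5 => hd (Subtype.ext (funext fun b => ?_))
      simp [h5]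
    · simp
  · symm
    refine Finset.sum_eq_zero fun p _ => Finset.sum_eq_zero fun d _ => if_neg fun h5 => hs ?_
    rw [← d.2, ← comp_apply (f := d.1), ← h5, p.2.2]

variable (F n N e) in
/-- The span of the trace monomials of a given degree. -/
noncomputable def traceMonSpan : Submodule F (QPoly F n) :=
  Submodule.span F (Set.range fun p : TraceIndex N e => traceMon p.1 p.2.1)

theorem traceMon_mem (σ : Perm (Fin (e + 1))) {c : Fin (e + 1) → Fin (N + 1)} (hc : IsRooted c) :
    traceMon σ c ∈ ⨆ e, traceMonSpan F n N e :=
  Submodule.mem_iSup_of_mem e (Submodule.subset_span ⟨(σ, ⟨c, hc⟩), rfl⟩)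

theorem isHomogeneous_markedTrace (hn : n ≠ 0) {q : QPoly F n} (hq : q ∈ traceMonSpan F n N e) :
    (markedTrace F n N q).IsHomogeneous (e + 1) := by
  have h : traceMonSpan F n N e ≤
      (MvPolynomial.homogeneousSubmodule _ F (e + 1)).comap (markedTrace F n N) := by
    refine Submodule.span_le.2 ?_
    rintro _ ⟨p, rfl⟩
    simp only [SetLike.mem_coe, Submodule.mem_comap]
    rw [markedTrace_traceMon hn _ p.2.2]
    refine Submodule.sum_mem _ fun I _ => ?_
    have := MvPolynomial.IsHomogeneous.prod Finset.univ
      (fun a => genMat F n (p.2.1 a) (I a) (I (p.1 a))) (fun _ => 1)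
      fun a _ => MvPolynomial.isHomogeneous_X _ _
    simpa using this
  exact h hq

theorem mem_of_mem_iSup_traceMonSpan {I : Set (QPoly F n)} (hI : IsTIdeal F n I)
    (hq : chQ F n ∈ I) (hn : n ≠ 0) {q : QPoly F n} (h : q ∈ ⨆ e, traceMonSpan F n N e)
    (h0 : PhiQ F n q = 0) : q ∈ hI.toIdeal := by
  obtain ⟨f, hf, rfl⟩ := (Submodule.mem_iSup_iff_exists_finsupp _ _).1 h
  refine Submodule.sum_mem _ fun e _ => ?_
  have h1 : markedTrace F n N (f e) = 0 := by
    have h2 : markedTrace F n N (f.sum fun _ x => x) = 0 := by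
      rw [markedTrace_apply, h0, mul_zero, Matrix.trace_zero]
    have h3 := congrArg (MvPolynomial.homogeneousComponent (e + 1)) h2
    rw [Finsupp.sum, map_sum, map_sum, map_zero, Finset.sum_eq_single e] at h3
    · rwa [MvPolynomial.homogeneousComponent_of_mem (isHomogeneous_markedTrace hn (hf e)),
        if_pos rfl] at h3
    · intro e' _ he
      rw [MvPolynomial.homogeneousComponent_of_mem (isHomogeneous_markedTrace hn (hf e')),
        if_neg (by omega)]
    · intro he
      rw [Finsupp.notMem_support_iff.1 he, map_zero, map_zero]
  obtain ⟨a, ha⟩ := (Submodule.mem_span_range_iff_exists_fun F).1 (hf e)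
  rw [← ha] at h1 ⊢
  exact sum_smul_traceMon_mem_of_markedTrace_eq_zero hI hq hn a h1

theorem algebraMap_mem_iSup_traceMonSpan (hn : n ≠ 0) {f : CPoly F n} (hf : f ∈ traceSpan F n N) :
    algebraMap (CPoly F n) (QPoly F n) f ∈ ⨆ e, traceMonSpan F n N e := by
  have h : traceSpan F n N ≤ (⨆ e, traceMonSpan F n N e).comap
      (IsScalarTower.toAlgHom F (CPoly F n) (QPoly F n)).toLinearMap := by
    refine Submodule.span_le.2 ?_
    rintro _ ⟨d, σ, c, rfl⟩
    rw [SetLike.mem_coe, Submodule.mem_comap, AlgHom.toLinearMap_apply,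
      IsScalarTower.coe_toAlgHom', algebraMap_permTrace hn]
    exact traceMon_mem _ (isRooted_cons c)
  exact h hf

theorem ι_mul_mem_iSup_traceMonSpan {q : QPoly F n} (hq : q ∈ ⨆ e, traceMonSpan F n N e)
    (k : Fin N) : FreeAlgebra.ι _ (k : ℕ) * q ∈ ⨆ e, traceMonSpan F n N e := by
  have h : ⨆ e, traceMonSpan F n N e ≤ (⨆ e, traceMonSpan F n N e).comap
      (LinearMap.mulLeft F (FreeAlgebra.ι _ (k : ℕ))) := by
    refine iSup_le fun e => Submodule.span_le.2 ?_
    rintro _ ⟨p, rfl⟩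
    obtain ⟨σ, c, hc, h⟩ := letter_mul_traceMon (F := F) (n := n) p.1 p.2.2 k
    rw [SetLike.mem_coe, Submodule.mem_comap, LinearMap.mulLeft_apply, h]
    exact traceMon_mem σ hc
  exact h hq

theorem algebraMap_mul_monQ_mem_iSup_traceMonSpan (hn : n ≠ 0) {f : CPoly F n}
    (hf : f ∈ traceSpan F n N) {m : ℕ} (hm : m ≤ N) (w : List (Fin m)) :
    algebraMap (CPoly F n) (QPoly F n) f * monQ F n m w ∈ ⨆ e, traceMonSpan F n N e := by
  rw [Algebra.commutes]
  induction w with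
  | nil =>
    rw [monQ_nil, one_mul]
    exact algebraMap_mem_iSup_traceMonSpan hn hf
  | cons k w ih =>
    rw [monQ_cons, mul_assoc]
    exact ι_mul_mem_iSup_traceMonSpan ih (k.castLE hm)

/-- A relation with invariant coefficients is a consequence of the Cayley–Hamilton identity. -/
theorem mem_of_adDeriv_eq_zero {I : Set (QPoly F n)} (hI : IsTIdeal F n I) (hq : chQ F n ∈ I)
    (hn : n ≠ 0) {m : ℕ} {κ : Type*} [Fintype κ] {α : κ → CPoly F n} {w : κ → List (Fin m)}
    (hα : ∀ i E, adDeriv E (α i) = 0)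
    (h : ∑ i, α i • PhiQ F n (monQ F n m (w i)) = 0) :
    ∑ i, algebraMap (CPoly F n) (QPoly F n) (α i) * monQ F n m (w i) ∈ hI.toIdeal := by
  obtain ⟨N, hN⟩ := (insert m ((Finset.univ.biUnion fun i => (α i).vars.image
    fun x => x.2.2 + 1) : Finset ℕ)).bddAbove
  refine mem_of_mem_iSup_traceMonSpan (N := N) hI hq hn (Submodule.sum_mem _ fun i _ =>
    algebraMap_mul_monQ_mem_iSup_traceMonSpan hn (mem_traceSpan (hα i) fun x hx => ?_)
      (hN (by simp)) (w i)) ?_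
  · refine Nat.lt_of_succ_le (hN (Finset.mem_insert_of_mem (Finset.mem_biUnion.2
      ⟨i, Finset.mem_univ i, Finset.mem_image_of_mem _ hx⟩)))
  · simpa only [map_sum, PhiQ_algebraMap_mul] using h

/-- A quasi-identity with one monomial more than a locally independent family lies in every
T-ideal containing the Cayley–Hamilton quasi-polynomial. -/
theorem mem_of_relation {I : Set (QPoly F n)} (hI : IsTIdeal F n I) (hq : chQ F n ∈ I)
    (hn : n ≠ 0) {m : ℕ} {κ : Type*} [Fintype κ] {w₀ : List (Fin m)} {w : κ → List (Fin m)}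
    (hw : LinearIndependent (CPoly F n) fun i => PhiQ F n (monQ F n m (w i)))
    (α : Option κ → CPoly F n)
    (h : ∑ i, α i • PhiQ F n (monQ F n m (i.elim w₀ w)) = 0) :
    ∑ i, algebraMap (CPoly F n) (QPoly F n) (α i) * monQ F n m (i.elim w₀ w) ∈ hI.toIdeal := by
  by_cases h0 : α none = 0
  · rw [Fintype.sum_option, h0, zero_smul, zero_add] at h
    have h1 := Fintype.linearIndependent_iff.1 hw _ h
    rw [Fintype.sum_option, h0, map_zero, zero_mul, zero_add]
    refine Submodule.sum_mem _ fun i _ => ?_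
    rw [h1 i, map_zero, zero_mul]
    exact Submodule.zero_mem _
  obtain ⟨d, g, hg, hg0, hprim⟩ := exists_eq_mul_of_ne_zero α none h0
  have hd : d ≠ 0 := by
    rintro rfl
    exact h0 (by rw [hg, zero_mul])
  have h1 : ∑ i, g i • PhiQ F n (monQ F n m (i.elim w₀ w)) = 0 := by
    simp only [hg, mul_smul, ← Finset.smul_sum] at h
    exact (smul_eq_zero.1 h).resolve_left hd
  have h2 := h1
  rw [Fintype.sum_option] at h2
  have h3 := adDeriv_eq_zero_of_primitive hw hg0 h2 fun a b hab hab' =>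
    hprim a b (Option.forall.2 ⟨hab, hab'⟩)
  have h4 := mem_of_adDeriv_eq_zero hI hq hn (α := g) (w := fun i => i.elim w₀ w)
    (Option.forall.2 ⟨fun E => (h3 E).1, fun i E => (h3 E).2 i⟩) h1
  have h5 := hI.toIdeal.mul_mem_left (algebraMap (CPoly F n) (QPoly F n) d) h4
  rw [Finset.mul_sum] at h5
  simpa only [hg, map_mul, mul_assoc] using h5
end

end

theorem stmt9 (F : Type*) [Field F] [CharZero F] (n : ℕ) (hn : 1 ≤ n)
    (m t : ℕ) (w₀ : List (Fin m)) (lam₀ : CPoly F n)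
    (w : Fin t → List (Fin m)) (lam : Fin t → CPoly F n)
    (P : QPoly F n)
    (hPdef : P = algebraMap (CPoly F n) (QPoly F n) lam₀ * monQ F n m w₀ +
      ∑ i, algebraMap (CPoly F n) (QPoly F n) (lam i) * monQ F n m (w i))
    (hP : IsQuasiIdentity F n P)
    (hindep : ¬ MLocallyLinDep F n m t (fun i => monF F (w i))) :
    P ∈ TIdealSpan F n {chQ F n} := by
  have hn0 : n ≠ 0 := Nat.one_le_iff_ne_zero.1 hn
  refine Set.mem_sInter.2 fun I hI => ?_
  let α : Option (Fin t) → CPoly F n := fun i => i.elim lam₀ lam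
  have hPα : P = ∑ i, algebraMap (CPoly F n) (QPoly F n) (α i) * monQ F n m (i.elim w₀ w) := by
    rw [Fintype.sum_option]
    exact hPdef
  have h0 : ∑ i, α i • PhiQ F n (monQ F n m (i.elim w₀ w)) = 0 := by
    simpa only [hPα, map_sum, PhiQ_algebraMap_mul] using hP.PhiQ_eq_zero
  rw [hPα]
  exact mem_of_relation hI.1 (hI.2 rfl) hn0 (linearIndependent_PhiQ_monQ hindep) α h0
end

section
/- Let p ∈ C₁[t] be a polynomial such that for every matrix A ∈ M_n(F) one has Σ_i p_i(A)·A^i = 0, where p = Σ_i p_i t^i and p_i(A) ∈ F is obtained by substituting the (i,j) entry of A for the variable x_{ij}. Then the generic characteristic polynomial q_n divides p in C₁[t], i.e. there exists r ∈ C₁[t] with p = r·q_n. -/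
variable (F : Type*) [Field F] [CharZero F] (n : ℕ)

/-- `C₁ = F[x_{ij}]`, the polynomial ring in the entries of one generic matrix. -/
abbrev CPoly1 := MvPolynomial (Fin n × Fin n) F

/-- The generic matrix `ξ`. -/
noncomputable def genMat1 : Matrix (Fin n) (Fin n) (CPoly1 F n) :=
  Matrix.of fun i j => MvPolynomial.X (i, j)

/-- Evaluation of coefficients at a matrix `A`, followed by the scalar embedding
into `M_n(F)`. -/
noncomputable def evalCoeff1 (A : Matrix (Fin n) (Fin n) F) :
    CPoly1 F n →+* Matrix (Fin n) (Fin n) F :=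
  (algebraMap F (Matrix (Fin n) (Fin n) F)).comp
    (MvPolynomial.aeval (fun q : Fin n × Fin n => A q.1 q.2) :
      CPoly1 F n →ₐ[F] F).toRingHom

/-- In characteristic zero, a quasi-identity in one variable vanishes at the generic matrix. -/
theorem aeval_genMat1_eq_zero (F : Type*) [Field F] [CharZero F] (n : ℕ)
    (p : Polynomial (CPoly1 F n))
    (hp : ∀ A : Matrix (Fin n) (Fin n) F, Polynomial.eval₂ (evalCoeff1 F n A) A p = 0) :
    Polynomial.aeval (genMat1 F n) p = 0 := by
  ext1 i j
  refine MvPolynomial.funext fun x => ?_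
  let A : Matrix (Fin n) (Fin n) F := Matrix.of fun i j => x (i, j)
  have hgen : (MvPolynomial.eval x).mapMatrix (genMat1 F n) = A := by
    ext i j
    simp [genMat1, A]
  have hcoeff : (MvPolynomial.eval x).mapMatrix.comp
      (algebraMap (CPoly1 F n) (Matrix (Fin n) (Fin n) (CPoly1 F n))) = evalCoeff1 F n A := by
    refine RingHom.ext fun c => ?_
    ext i j
    by_cases h : i = j <;>
      simp [evalCoeff1, A, Matrix.algebraMap_matrix_apply, h]
  have h := Polynomial.hom_eval₂ p
    (algebraMap (CPoly1 F n) (Matrix (Fin n) (Fin n) (CPoly1 F n)))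
    (MvPolynomial.eval x).mapMatrix (genMat1 F n)
  rw [hcoeff, hgen, hp A] at h
  simpa [Polynomial.aeval_def] using congrFun (congrFun h i) j

/-- The powers of the lower shift matrix move the first basis vector along the basis. -/
theorem shift_pow_apply_zero (R : Type*) [CommRing R] (n : ℕ) [NeZero n] (k : ℕ) (hk : k < n)
    (i : Fin n) :
    ((Matrix.of fun i j : Fin n => if (i : ℕ) = j + 1 then (1 : R) else 0) ^ k) i 0 =
      if (i : ℕ) = k then 1 else 0 := by
  induction k generalizing i with
  | zero => simp [Matrix.one_apply]
  | succ k ih =>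
    rw [pow_succ', Matrix.mul_apply, Finset.sum_eq_single ⟨k, by omega⟩]
    · simp [ih (by omega)]
    · intro m _ hm
      have hmk : (m : ℕ) ≠ k := fun h => hm (Fin.ext h)
      simp [ih (by omega), hmk]
    · simp

/-- The first basis vector is cyclic for the generic matrix. -/
theorem det_krylov_genMat1_ne_zero (F : Type*) [Field F] (n : ℕ) [NeZero n] :
    (Matrix.of fun i j : Fin n => (genMat1 F n ^ (j : ℕ)) i 0).det ≠ 0 := by
  intro h
  let S : Matrix (Fin n) (Fin n) F := Matrix.of fun i j => if (i : ℕ) = j + 1 then 1 else 0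
  let φ : CPoly1 F n →+* F := MvPolynomial.eval fun q => S q.1 q.2
  have hgen : φ.mapMatrix (genMat1 F n) = S := by
    ext i j
    simp [genMat1, φ]
  have hone : φ.mapMatrix (Matrix.of fun i j : Fin n => (genMat1 F n ^ (j : ℕ)) i 0) = 1 := by
    ext i j
    have hpow := congrFun (congrFun (map_pow φ.mapMatrix (genMat1 F n) (j : ℕ)) i) 0
    rw [hgen, shift_pow_apply_zero F n j j.isLt] at hpow
    simpa [Matrix.one_apply, Fin.ext_iff] using hpow
  have hdet := φ.map_det (Matrix.of fun i j : Fin n => (genMat1 F n ^ (j : ℕ)) i 0)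
  rw [hone, h] at hdet
  simp at hdet

/-- The generic matrix satisfies no nonzero polynomial of degree less than its size. -/
theorem eq_zero_of_aeval_genMat1_eq_zero (F : Type*) [Field F] (n : ℕ) (hn : 1 ≤ n)
    (r : Polynomial (CPoly1 F n)) (hdeg : r.degree < n)
    (hr : Polynomial.aeval (genMat1 F n) r = 0) : r = 0 := by
  have : NeZero n := ⟨by omega⟩
  have hzero : (fun i : Fin n => r.coeff i) = 0 := by
    refine Matrix.eq_zero_of_mulVec_eq_zero (det_krylov_genMat1_ne_zero F n) ?_
    ext1 i
    have hnat : r.natDegree < n := by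
      rcases eq_or_ne r 0 with rfl | h
      · simpa using Nat.pos_of_neZero n
      · exact (Polynomial.natDegree_lt_iff_degree_lt h).2 hdeg
    rw [Polynomial.aeval_eq_sum_range' hnat, Finset.sum_range] at hr
    have h := congrFun (congrFun hr i) 0
    simpa [Matrix.mulVec, dotProduct, Matrix.sum_apply, mul_comm] using h
  ext1 k
  rcases lt_or_ge k n with hk | hk
  · exact congrFun hzero ⟨k, hk⟩
  · exact Polynomial.coeff_eq_zero_of_degree_lt (hdeg.trans_le (by exact_mod_cast hk))

/-- A polynomial vanishing at the generic matrix is divisible by its characteristic polynomial. -/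
theorem charpoly_dvd_of_aeval_eq_zero (F : Type*) [Field F] (n : ℕ) (hn : 1 ≤ n)
    (p : Polynomial (CPoly1 F n)) (hp : Polynomial.aeval (genMat1 F n) p = 0) :
    (genMat1 F n).charpoly ∣ p := by
  have hq : (genMat1 F n).charpoly.Monic := Matrix.charpoly_monic _
  have hdeg := Polynomial.degree_modByMonic_lt p hq
  rw [Matrix.charpoly_degree_eq_dim, Fintype.card_fin] at hdeg
  rw [← Polynomial.modByMonic_eq_zero_iff_dvd hq]
  refine eq_zero_of_aeval_genMat1_eq_zero F n hn _ hdeg ?_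
  have hc : Polynomial.aeval (genMat1 F n) (genMat1 F n).charpoly = 0 :=
    Matrix.aeval_self_charpoly _
  rw [Polynomial.aeval_modByMonic_eq_self_of_root hc, hp]

theorem stmt10 (F : Type*) [Field F] [CharZero F] (n : ℕ) (hn : 1 ≤ n)
    (p : Polynomial (CPoly1 F n))
    (hp : ∀ A : Matrix (Fin n) (Fin n) F, Polynomial.eval₂ (evalCoeff1 F n A) A p = 0) :
    ∃ r : Polynomial (CPoly1 F n), p = r * (genMat1 F n).charpoly := by
  obtain ⟨r, hr⟩ := charpoly_dvd_of_aeval_eq_zero F n hn p (aeval_genMat1_eq_zero F n p hp)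
  exact ⟨r, by rw [hr, mul_comm]⟩
end
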